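/- arXiv:2009.14255 — 2 statements merged into one kernel-verified Lean document; each statement's English description precedes it below -/
import Mathlib

section
/- Let Ω ⊂ ℝ³ be an open bounded domain, 1 ≤ p < ∞, and 𝒜 a first-order constant-coefficient linear differential operator 𝒜z = Σ_{i=1}^3 A^{(i)} ∂_{x_i} z with l×m real matrices A^{(i)}, l ≥ 3, of constant rank (i.e., the rank of Σᵢ ξᵢ A^{(i)} is the same for all ξ ∈ ℝ³∖{0}), and let Λ = {z̄ ∈ ℝ^m : ∃ ξ ∈ ℝ³∖{0} with (Σᵢ ξᵢ A^{(i)}) z̄ = 0} be its wave cone. Let z̄₁, z̄₂ ∈ L^∞(Ω; ℝ^m) satisfy z̄₂(x) − z̄₁(x) ∉ Λ for a.e. x ∈ Ω. Suppose zₙ : Ω → ℝ^m is an equi-integrable sequence with ‖zₙ‖_{L^p} ≤ c, 𝒜zₙ → 0 in W^{−1,r}(Ω) for some r ∈ (1, 3/2) (meaning: sup over φ ∈ C_c^∞(Ω;ℝˡ) with ‖φ‖_{L^{r'}} + ‖∇φ‖_{L^{r'}} ≤ 1 of |Σᵢ ∫ (A^{(i)} zₙ)·∂_iφ| → 0, where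 1/r + 1/r' = 1), and (zₙ) generates a compactly supported Young measure (ν_x) with supp ν_x ⊆ {λz̄₁(x) + (1−λ)z̄₂(x) : λ ∈ [0,1]} for a.e. x ∈ Ω. Then there exists w ∈ L¹(Ω; ℝ^m) such that ν_x = δ_{w(x)} for a.e. x ∈ Ω and zₙ → w strongly in L¹(Ω). -/
open MeasureTheory Filter Topology Bornology
open scoped Matrix

noncomputable section

/-- The wave cone of the first-order constant-coefficient operator
`𝒜z = Σᵢ A⁽ⁱ⁾ ∂ᵢ z`: the set of `z̄ ∈ ℝ^d` for which there is `ξ ∈ ℝᴺ∖{0}` with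
`(Σᵢ ξᵢ A⁽ⁱ⁾) z̄ = 0` (equivalently, all plane waves `z̄ h(y·ξ)` are `𝒜`-free). -/
def waveCone {N l d : ℕ} (A : Fin N → Matrix (Fin l) (Fin d) ℝ) : Set (Fin d → ℝ) :=
  {z | ∃ ξ : Fin N → ℝ, ξ ≠ 0 ∧ (∑ i : Fin N, ξ i • A i) *ᵥ z = 0}

/-- `𝒜 zₙ → 0` in `W^{-1,r}(Ω)`, formulated by duality: the supremum over smooth
`φ` compactly supported in `Ω` with `‖φ‖_{L^{r'}} + ‖∇φ‖_{L^{r'}} ≤ 1` (where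
`1/r + 1/r' = 1`) of `|Σᵢ ∫_Ω (A⁽ⁱ⁾ zₙ)·∂ᵢφ|` tends to `0`. -/
def AconvergesToZeroWminusOneR {N l d : ℕ} (Ω : Set (Fin N → ℝ))
    (A : Fin N → Matrix (Fin l) (Fin d) ℝ) (r' : ℝ)
    (z : ℕ → (Fin N → ℝ) → Fin d → ℝ) : Prop :=
  ∀ ε > (0 : ℝ), ∃ n₀ : ℕ, ∀ n ≥ n₀,
    ∀ φ : (Fin N → ℝ) → Fin l → ℝ, ContDiff ℝ (⊤ : ℕ∞) φ → HasCompactSupport φ →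
      tsupport φ ⊆ Ω →
      eLpNorm φ (ENNReal.ofReal r') volume
          + eLpNorm (fun x => ‖fderiv ℝ φ x‖) (ENNReal.ofReal r') volume ≤ 1 →
      |∑ i : Fin N, ∫ x in Ω, (A i *ᵥ z n x) ⬝ᵥ fderiv ℝ φ x (Pi.single i 1)| ≤ ε

/-- A Young measure on `(Ω, μ)` with values in `ℝ^d`: a weakly*-measurable family of
probability measures. -/
def IsYoungMeasure {N d : ℕ} (μ : Measure (Fin N → ℝ))
    (ν : (Fin N → ℝ) → Measure (Fin d → ℝ)) : Prop :=
  (∀ᵐ x ∂μ, IsProbabilityMeasure (ν x)) ∧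
  ∀ f : BoundedContinuousFunction (Fin d → ℝ) ℝ,
    Measurable fun x => ∫ ξ, f ξ ∂(ν x)

/-- `(zₙ)` generates the parametrized (Young) measure `(ν_x)`: for every continuous
`f : ℝ^d → ℝ` such that `(f(zₙ))` is equi-integrable, `f(zₙ) ⇀ ⟨ν, f⟩` weakly in
`L¹(μ)`. -/
def GeneratesYM {N d : ℕ} (μ : Measure (Fin N → ℝ))
    (z : ℕ → (Fin N → ℝ) → Fin d → ℝ)
    (ν : (Fin N → ℝ) → Measure (Fin d → ℝ)) : Prop :=
  ∀ f : (Fin d → ℝ) → ℝ, Continuous f →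
    (∀ n, Integrable (fun x => f (z n x)) μ) →
    UnifIntegrable (fun n x => f (z n x)) 1 μ →
    Integrable (fun x => ∫ ξ, f ξ ∂(ν x)) μ ∧
    ∀ g : (Fin N → ℝ) → ℝ, Measurable g → (∃ C : ℝ, ∀ x, |g x| ≤ C) →
      Tendsto (fun n => ∫ x, g x * f (z n x) ∂μ) atTop
        (𝓝 (∫ x, g x * ∫ ξ, f ξ ∂(ν x) ∂μ))

end


section Part1
open MeasureTheory Filter Topology Bornology
open scoped Matrix

abbrev E3 := EuclideanSpace ℝ (Fin 3)

theorem schwartz_sq_int (f : SchwartzMap E3 ℂ) : Integrable (fun x => ‖f x‖ ^ 2) := by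
  have := f.memLp 2 (volume : Measure E3)
  exact (memLp_two_iff_integrable_sq_norm this.1).1 this

open SchwartzMap FourierTransform LineDeriv in
theorem bessel_exists (v : SchwartzMap E3 ℂ) :
    ∃ (f : SchwartzMap E3 ℂ) (φ : Fin 3 → SchwartzMap E3 ℂ),
      (∀ x, ∑ j, (fderiv ℝ (φ j) x) (EuclideanSpace.single j 1) = v x - f x) ∧
      (∀ i j, ∫ x, ‖(fderiv ℝ (φ j) x) (EuclideanSpace.single i 1)‖ ^ 2 ≤ ∫ x, ‖v x‖ ^ 2) ∧
      (∫ x, ‖f x‖ ^ 2 = ∫ ξ, ‖𝓕 v ξ‖ ^ 2 * ((1 + ‖ξ‖ ^ 2) ^ (-4 / 2 : ℝ))) ∧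
      (∀ j, ∫ x, ‖φ j x‖ ^ 2 ≤ ∫ ξ, ‖𝓕 v ξ‖ ^ 2 * ((1 + ‖ξ‖ ^ 2) ^ (-2 / 2 : ℝ))) ∧
      (∀ i j, Integrable (fun x => ‖(fderiv ℝ (φ j) x) (EuclideanSpace.single i 1)‖ ^ 2)) := by
  set m : E3 → ℝ := fun ξ => (1 + ‖ξ‖ ^ 2) ^ (-2 / 2 : ℝ) with hm
  have hmt : m.HasTemperateGrowth := by
    simp only [hm]; fun_prop
  set f : SchwartzMap E3 ℂ := 𝓕⁻ (smulLeftCLM ℂ m (𝓕 v)) with hf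
  set e : Fin 3 → E3 := fun i => EuclideanSpace.single i 1 with he
  have hin : ∀ i, (fun ξ : E3 => inner ℝ ξ (e i)).HasTemperateGrowth := fun i => by fun_prop
  have hie : ∀ i (ξ : E3), inner ℝ ξ (e i) = ξ i := by
    intro i ξ; simp [he, EuclideanSpace.inner_single_right]
  have hpi : (2 * Real.pi * Complex.I) ≠ 0 := by simp [Real.pi_ne_zero]
  set φ : Fin 3 → SchwartzMap E3 ℂ := fun j => ((2 * Real.pi * Complex.I)^2)⁻¹ • ∂_{e j} f with hφ
  have hFf : 𝓕 f = smulLeftCLM ℂ m (𝓕 v) := by simp [hf]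
  have hFf' : ∀ ξ, 𝓕 f ξ = m ξ * 𝓕 v ξ := by
    intro ξ; rw [hFf, smulLeftCLM_apply_apply hmt]; simp
  have hFφ : ∀ j ξ, 𝓕 (φ j) ξ = (2 * Real.pi * Complex.I)⁻¹ * ((ξ j : ℝ) * m ξ * 𝓕 v ξ) := by
    intro j ξ
    rw [hφ]
    simp only [FourierTransform.fourier_smul]
    rw [fourier_lineDerivOp_eq]
    simp only [smul_apply, smulLeftCLM_apply_apply (hin j)]
    simp only [hFf', hie, smul_eq_mul, Complex.real_smul]
    field_simp
  have hFd : ∀ i j ξ, 𝓕 (∂_{e i} (φ j)) ξ = ((ξ i : ℝ) * (ξ j : ℝ) * m ξ * 𝓕 v ξ) := by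
    intro i j ξ
    rw [fourier_lineDerivOp_eq]
    simp only [smul_apply, smulLeftCLM_apply_apply (hin i)]
    simp only [hFφ, hie, smul_eq_mul, Complex.real_smul]
    field_simp
  have hmpos : ∀ ξ, 0 < 1 + ‖ξ‖ ^ 2 := fun ξ : E3 => by positivity
  have hm1 : ∀ ξ, m ξ = (1 + ‖ξ‖ ^ 2)⁻¹ := by
    intro ξ; simp only [hm]; norm_num [Real.rpow_neg_one]
  have hm2 : ∀ ξ : E3, (1 + ‖ξ‖ ^ 2) ^ (-4 / 2 : ℝ) = m ξ ^ 2 := by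
    intro ξ; simp only [hm]; rw [← Real.rpow_mul_natCast (hmpos ξ).le]; norm_num
  have hnsq : ∀ ξ : E3, ‖ξ‖ ^ 2 = ∑ i, ξ i ^ 2 := fun ξ => EuclideanSpace.real_norm_sq_eq ξ
  have hle : ∀ i (ξ : E3), ξ i ^ 2 ≤ ‖ξ‖ ^ 2 := by
    intro i ξ
    rw [hnsq]; exact Finset.single_le_sum (f := fun i => ξ i ^ 2) (fun _ _ => sq_nonneg _) (Finset.mem_univ i)
  have hmn : ∀ ξ, ‖ξ‖ ^ 2 * m ξ ≤ 1 := by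
    intro ξ; rw [hm1, ← div_eq_mul_inv, div_le_one (hmpos ξ)]; linarith
  have hm0 : ∀ ξ, 0 ≤ m ξ := fun ξ => by rw [hm1]; exact (inv_pos.2 (hmpos ξ)).le
  have hmle : ∀ ξ, m ξ ≤ 1 := fun ξ => by
    rw [hm1]; apply inv_le_one_of_one_le₀; nlinarith [sq_nonneg ‖ξ‖]
  have hmcont : Continuous m := by
    simp only [hm]
    exact (by fun_prop : Continuous fun ξ : E3 => 1 + ‖ξ‖ ^ 2).rpow_const (fun ξ => Or.inl (hmpos ξ).ne')
  refine ⟨f, φ, ?_, ?_, ?_, ?_, ?_⟩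
  · intro x
    have : ∑ j, ∂_{e j} (φ j) = v - f := by
      have h : 𝓕 (∑ j, ∂_{e j} (φ j)) = 𝓕 (v - f) := by
        ext ξ
        have h1 : 𝓕 (∑ j, ∂_{e j} (φ j)) = ∑ j, 𝓕 (∂_{e j} (φ j)) :=
          map_sum (fourierCLM ℂ (SchwartzMap E3 ℂ)) _ _
        have h2 : 𝓕 (v - f) = 𝓕 v - 𝓕 f := map_sub (fourierCLM ℂ (SchwartzMap E3 ℂ)) _ _
        rw [h1, h2, sum_apply]
        simp only [hFd, sub_apply, hFf']
        have : m ξ * ∑ i, ξ i ^ 2 = 1 - m ξ := by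
          rw [← hnsq, hm1]; field_simp [(hmpos ξ).ne']; ring
        have h3 : (m ξ : ℂ) * ∑ i, (ξ i : ℂ) ^ 2 = 1 - m ξ := by exact_mod_cast this
        rw [← Finset.sum_mul, ← Finset.sum_mul]
        simp only [← sq]
        rw [mul_comm _ (m ξ : ℂ), h3]; ring
      have := congrArg (fun g => 𝓕⁻ g) h
      simpa using this
    have h2 := DFunLike.congr_fun this x
    rw [sum_apply, sub_apply] at h2
    exact h2
  · intro i j
    have h1 := integral_norm_sq_fourier (∂_{e i} (φ j))
    have h2 := integral_norm_sq_fourier v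
    have : ∫ x, ‖(fderiv ℝ (φ j) x) (e i)‖ ^ 2 = ∫ x, ‖∂_{e i} (φ j) x‖ ^ 2 := rfl
    rw [this, ← h1, ← h2]
    apply integral_mono (schwartz_sq_int _) (schwartz_sq_int _)
    intro ξ
    simp only [hFd]
    rw [norm_mul, mul_pow]
    refine mul_le_of_le_one_left (sq_nonneg _) ?_
    rw [norm_mul, norm_mul, Complex.norm_real, Complex.norm_real, Complex.norm_real, mul_pow, mul_pow]
    simp only [Real.norm_eq_abs, sq_abs]
    calc _ ≤ ‖ξ‖ ^ 2 * ‖ξ‖ ^ 2 * m ξ ^ 2 := by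
          apply mul_le_mul_of_nonneg_right _ (sq_nonneg _)
          exact mul_le_mul (hle i ξ) (hle j ξ) (sq_nonneg _) (sq_nonneg _)
      _ = (‖ξ‖ ^ 2 * m ξ) ^ 2 := by ring
      _ ≤ 1 := by
        apply pow_le_one₀ _ (hmn ξ); exact mul_nonneg (sq_nonneg _) (hm0 ξ)
  · rw [← integral_norm_sq_fourier f]
    congr 1; ext ξ
    rw [hFf', hm2, norm_mul, Complex.norm_real, mul_pow, Real.norm_eq_abs, sq_abs]; ring
  · intro j
    rw [← integral_norm_sq_fourier (φ j)]
    apply integral_mono (schwartz_sq_int _)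
    · refine (schwartz_sq_int (𝓕 v)).mono' ?_ (Eventually.of_forall fun ξ => ?_)
      · exact (((𝓕 v).continuous.norm.pow 2).mul hmcont).aestronglyMeasurable
      · rw [Real.norm_eq_abs, abs_of_nonneg (mul_nonneg (sq_nonneg _) (hm0 ξ))]
        exact mul_le_of_le_one_right (sq_nonneg _) (hmle ξ)
    intro ξ
    simp only [hFφ]
    rw [norm_mul, norm_mul, norm_mul, Complex.norm_real, Complex.norm_real, mul_pow, mul_pow, mul_pow]
    have h1 : ‖(2 * Real.pi * Complex.I)⁻¹‖ ^ 2 ≤ 1 := by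
      apply pow_le_one₀ (norm_nonneg _)
      rw [norm_inv]; apply inv_le_one_of_one_le₀
      simp; rw [abs_of_pos Real.pi_pos]; linarith [Real.pi_gt_three]
    have h2 : ξ j ^ 2 * m ξ ^ 2 ≤ m ξ := by
      nlinarith [hle j ξ, hmn ξ, hm0 ξ, mul_le_mul_of_nonneg_right (hle j ξ) (hm0 ξ)]
    simp only [Real.norm_eq_abs, sq_abs]
    calc _ ≤ 1 * (m ξ * ‖𝓕 v ξ‖ ^ 2) := by gcongr
      _ = _ := by ring
  · intro i j
    exact schwartz_sq_int (∂_{e i} (φ j))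

end Part1

section Part2
open MeasureTheory Filter Topology Bornology
open scoped Matrix

abbrev V3 := Fin 3 → ℝ

theorem cs_int {α : Type*} [MeasurableSpace α] {μ : Measure α} {f g : α → ℝ}
    (hf : AEStronglyMeasurable f μ) (hg : AEStronglyMeasurable g μ)
    (hf2 : Integrable (fun x => f x ^ 2) μ) (hg2 : Integrable (fun x => g x ^ 2) μ) :
    Integrable (fun x => f x * g x) μ ∧
    ∫ x, |f x * g x| ∂μ ≤ Real.sqrt (∫ x, f x ^ 2 ∂μ) * Real.sqrt (∫ x, g x ^ 2 ∂μ) := by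
  have h1 : MemLp f 2 μ := (memLp_two_iff_integrable_sq hf).2 hf2
  have h2 : MemLp g 2 μ := (memLp_two_iff_integrable_sq hg).2 hg2
  refine ⟨h1.integrable_mul h2, ?_⟩
  have := integral_mul_le_Lp_mul_Lq_of_nonneg (μ := μ) (p := 2) (q := 2) (by constructor <;> norm_num)
    (f := fun x => |f x|) (g := fun x => |g x|) (Eventually.of_forall fun x => abs_nonneg _)
    (Eventually.of_forall fun x => abs_nonneg _) (by simpa using h1.norm) (by simpa using h2.norm)
  simp only [abs_mul]
  simpa [Real.sqrt_eq_rpow] using this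

open SchwartzMap FourierTransform LineDeriv in
theorem fourier_tendsto (v : ℕ → SchwartzMap E3 ℂ) (M M2 : ℝ) (hM : ∀ n, ∫ x, ‖v n x‖ ≤ M)
    (hM2 : ∀ n, ∫ x, ‖v n x‖ ^ 2 ≤ M2)
    (hw : ∀ ξ, Tendsto (fun n => 𝓕 (v n) ξ) atTop (𝓝 0)) :
    Tendsto (fun n => ∫ ξ, ‖𝓕 (v n) ξ‖ ^ 2 * ((1 + ‖ξ‖ ^ 2) ^ (-4 / 2 : ℝ))) atTop (𝓝 0) ∧
    Tendsto (fun n => ∫ ξ, ‖𝓕 (v n) ξ‖ ^ 2 * ((1 + ‖ξ‖ ^ 2) ^ (-2 / 2 : ℝ))) atTop (𝓝 0) := by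
  have hpos : ∀ ξ : E3, 0 < 1 + ‖ξ‖ ^ 2 := fun ξ : E3 => by positivity
  have hcont : ∀ s : ℝ, Continuous (fun ξ : E3 => (1 + ‖ξ‖ ^ 2) ^ s) := fun s =>
    (by fun_prop : Continuous fun ξ : E3 => 1 + ‖ξ‖ ^ 2).rpow_const (fun ξ => Or.inl (hpos ξ).ne')
  have hb : ∀ n ξ, ‖𝓕 (v n) ξ‖ ≤ M := by
    intro n ξ
    refine le_trans ?_ (hM n)
    rw [fourier_coe, Real.fourier_eq]
    refine (norm_integral_le_integral_norm _).trans (le_of_eq ?_)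
    congr 1; ext x; simp
  have h1 : Tendsto (fun n => ∫ ξ, ‖𝓕 (v n) ξ‖ ^ 2 * ((1 + ‖ξ‖ ^ 2) ^ (-4 / 2 : ℝ))) atTop (𝓝 0) := by
    have := tendsto_integral_of_dominated_convergence
      (F := fun n ξ => ‖𝓕 (v n) ξ‖ ^ 2 * ((1 + ‖ξ‖ ^ 2) ^ (-4 / 2 : ℝ))) (f := fun _ => (0 : ℝ)) (μ := (volume : Measure E3))
      (fun ξ => M ^ 2 * ((1 + ‖ξ‖ ^ 2) ^ (-4 / 2 : ℝ))) ?_ ?_ ?_ ?_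
    · simpa using this
    · intro n
      exact (((𝓕 (v n)).continuous.norm.pow 2).mul (hcont _)).aestronglyMeasurable
    · exact (integrable_rpow_neg_one_add_norm_sq (by simp; norm_num)).const_mul _
    · intro n; refine Eventually.of_forall fun ξ => ?_
      have := Real.rpow_nonneg (hpos ξ).le (-4 / 2)
      rw [Real.norm_eq_abs, abs_of_nonneg (by positivity)]
      gcongr; exact hb n ξ
    · refine Eventually.of_forall fun ξ => ?_
      have := (((hw ξ).norm).pow 2).mul_const ((1 + ‖ξ‖ ^ 2) ^ (-4 / 2 : ℝ))
      simpa using this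
  refine ⟨h1, ?_⟩
  have h2 : ∀ n, ∫ ξ, ‖𝓕 (v n) ξ‖ ^ 2 * ((1 + ‖ξ‖ ^ 2) ^ (-2 / 2 : ℝ)) ≤
      Real.sqrt M2 * Real.sqrt (∫ ξ, ‖𝓕 (v n) ξ‖ ^ 2 * ((1 + ‖ξ‖ ^ 2) ^ (-4 / 2 : ℝ))) := by
    intro n
    have hs : ∀ ξ : E3, ‖𝓕 (v n) ξ‖ ^ 2 * ((1 + ‖ξ‖ ^ 2) ^ (-4 / 2 : ℝ)) = (‖𝓕 (v n) ξ‖ * ((1 + ‖ξ‖ ^ 2) ^ (-2 / 2 : ℝ))) ^ 2 := by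
      intro ξ
      rw [mul_pow, ← Real.rpow_mul_natCast (hpos ξ).le]; norm_num
    have := cs_int (μ := (volume : Measure E3)) (f := fun ξ => ‖𝓕 (v n) ξ‖) (g := fun ξ => ‖𝓕 (v n) ξ‖ * ((1 + ‖ξ‖ ^ 2) ^ (-2 / 2 : ℝ)))
      (𝓕 (v n)).continuous.norm.aestronglyMeasurable
      (((𝓕 (v n)).continuous.norm).mul (hcont _)).aestronglyMeasurable (schwartz_sq_int _) (by
        refine (schwartz_sq_int (𝓕 (v n))).mono' ((((𝓕 (v n)).continuous.norm).mul (hcont _)).pow 2).aestronglyMeasurable (Eventually.of_forall fun ξ => ?_)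
        rw [Real.norm_eq_abs, abs_of_nonneg (by positivity), mul_pow]
        refine mul_le_of_le_one_right (sq_nonneg _) (pow_le_one₀ (Real.rpow_nonneg (hpos ξ).le _) ?_)
        apply Real.rpow_le_one_of_one_le_of_nonpos
        · nlinarith [sq_nonneg ‖ξ‖]
        · norm_num)
    simp only [hs]
    refine le_trans (le_of_eq ?_) (this.2.trans ?_)
    · congr 1; ext ξ
      have := Real.rpow_nonneg (hpos ξ).le (-2 / 2)
      rw [abs_of_nonneg (by positivity)]; ring
    · gcongr
      rw [integral_norm_sq_fourier]; exact hM2 n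
  refine squeeze_zero (fun n => integral_nonneg fun ξ => ?_) h2 ?_
  · have := Real.rpow_nonneg (hpos ξ).le (-2 / 2)
    positivity
  · have := (h1.sqrt).const_mul (Real.sqrt M2)
    simpa using this

end Part2

section Part3
open MeasureTheory Filter Topology Bornology
open scoped Matrix

theorem int_toLp (g : E3 → ℝ) : ∫ x : V3, g (WithLp.toLp 2 x) = ∫ y, g y :=
  (PiLp.volume_preserving_toLp (Fin 3)).integral_comp (MeasurableEquiv.toLp 2 (Fin 3 → ℝ)).measurableEmbedding g

theorem integrable_toLp (g : E3 → ℝ) (hg : Integrable g) : Integrable (fun x : V3 => g (WithLp.toLp 2 x)) :=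
  ((PiLp.volume_preserving_toLp (Fin 3)).integrable_comp_emb (MeasurableEquiv.toLp 2 (Fin 3 → ℝ)).measurableEmbedding).2 hg

open SchwartzMap FourierTransform LineDeriv in
theorem bessel_seq (v : ℕ → V3 → ℝ) (hv : ∀ n, ContDiff ℝ (⊤ : ℕ∞) (v n))
    (hc : ∀ n, HasCompactSupport (v n)) (M M2 : ℝ) (hM : ∀ n, ∫ x, |v n x| ≤ M)
    (hM2 : ∀ n, ∫ x, v n x ^ 2 ≤ M2)
    (hw : ∀ h : V3 → ℝ, Continuous h → (∃ C : ℝ, ∀ x, |h x| ≤ C) →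
      Tendsto (fun n => ∫ x, v n x * h x) atTop (𝓝 0)) :
    ∃ (f : ℕ → V3 → ℝ) (φ : ℕ → Fin 3 → V3 → ℝ),
      (∀ n j, ContDiff ℝ (⊤ : ℕ∞) (φ n j)) ∧ (∀ n, Continuous (f n)) ∧
      (∀ n x, ∑ j, fderiv ℝ (φ n j) x (Pi.single j 1) = v n x - f n x) ∧
      (∀ n i j, Integrable (fun x => (fderiv ℝ (φ n j) x (Pi.single i 1)) ^ 2) ∧
        ∫ x, (fderiv ℝ (φ n j) x (Pi.single i 1)) ^ 2 ≤ ∫ x, v n x ^ 2) ∧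
      (∀ n, Integrable (fun x => f n x ^ 2)) ∧
      Tendsto (fun n => ∫ x, f n x ^ 2) atTop (𝓝 0) ∧
      (∀ n j, Integrable (fun x => φ n j x ^ 2)) ∧
      (∀ j, Tendsto (fun n => ∫ x, φ n j x ^ 2) atTop (𝓝 0)) := by
  let T : V3 ≃L[ℝ] E3 := (EuclideanSpace.equiv (Fin 3) ℝ).symm
  have hT : ∀ x : V3, T x = WithLp.toLp 2 x := fun x => rfl
  have hTs : ∀ i, T (Pi.single i 1) = EuclideanSpace.single i 1 := fun i => by
    rw [hT]; rfl
  have hvc : ∀ n, HasCompactSupport (fun x : E3 => (v n (T.symm x) : ℂ)) := fun n => by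
    have := (hc n).comp_homeomorph T.symm.toHomeomorph
    exact this.comp_left (g := fun r : ℝ => (r : ℂ)) (by simp)
  have hvs : ∀ n, ContDiff ℝ (⊤ : ℕ∞) (fun x : E3 => (v n (T.symm x) : ℂ)) := fun n =>
    Complex.ofRealCLM.contDiff.comp ((hv n).comp T.symm.contDiff)
  let w : ℕ → SchwartzMap E3 ℂ := fun n => (hvc n).toSchwartzMap (hvs n)
  have hwv : ∀ n x, w n (T x) = v n x := fun n x => by
    change ((v n (T.symm (T x)) : ℝ) : ℂ) = _
    simp
  have hnw : ∀ n, ∫ x, ‖w n x‖ ^ 2 = ∫ x, v n x ^ 2 := fun n => by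
    rw [← int_toLp]; congr 1; ext x; rw [← hT, hwv]; simp
  have hnw1 : ∀ n, ∫ x, ‖w n x‖ = ∫ x, |v n x| := fun n => by
    rw [← int_toLp]; congr 1; ext x; rw [← hT, hwv]; simp
  have hvint : ∀ n (h : V3 → ℝ), Continuous h → Integrable (fun x => v n x * h x) := fun n h hh =>
    ((hv n).continuous.mul hh).integrable_of_hasCompactSupport (hc n).mul_right
  have hF : ∀ ξ, Tendsto (fun n => 𝓕 (w n) ξ) atTop (𝓝 0) := by
    intro ξ
    let θ : V3 → ℝ := fun x => -(2 * Real.pi * inner ℝ (T x) ξ)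
    have hθ : Continuous θ := by fun_prop
    have key : ∀ n, 𝓕 (w n) ξ = ((∫ x, v n x * Real.cos (θ x) : ℝ) : ℂ) + ((∫ x, v n x * Real.sin (θ x) : ℝ) : ℂ) * Complex.I := by
      intro n
      rw [fourier_coe, Real.fourier_eq']
      rw [← (PiLp.volume_preserving_toLp (Fin 3)).integral_comp (MeasurableEquiv.toLp 2 (Fin 3 → ℝ)).measurableEmbedding]
      rw [← integral_complex_ofReal, ← integral_complex_ofReal, ← integral_mul_const, ← integral_add]
      · congr 1; ext x
        rw [← hT, hwv]
        have : (((-2 * Real.pi * inner ℝ (T x) ξ : ℝ) : ℂ) * Complex.I) = (θ x : ℂ) * Complex.I := by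
          simp [θ]
        rw [this, Complex.exp_mul_I]
        simp; ring
      · exact (hvint n _ (Real.continuous_cos.comp hθ)).ofReal
      · exact (hvint n _ (Real.continuous_sin.comp hθ)).ofReal.mul_const _
    simp only [key]
    have h1 := hw (fun x => Real.cos (θ x)) (Real.continuous_cos.comp hθ) ⟨1, fun x => Real.abs_cos_le_one _⟩
    have h2 := hw (fun x => Real.sin (θ x)) (Real.continuous_sin.comp hθ) ⟨1, fun x => Real.abs_sin_le_one _⟩
    have h1' := (Complex.continuous_ofReal.tendsto 0).comp h1
    have h2' := (Complex.continuous_ofReal.tendsto 0).comp h2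
    have := h1'.add (h2'.mul_const Complex.I)
    simpa [Function.comp_def] using this
  obtain ⟨ht1, ht2⟩ := fourier_tendsto w M M2 (fun n => by rw [hnw1]; exact hM n) (fun n => by rw [hnw]; exact hM2 n) hF
  choose F Φ h1 h2 h3 h4 h5 using fun n => bessel_exists (w n)
  have hfd : ∀ n j x i, fderiv ℝ (fun x : V3 => (Φ n j (T x)).re) x (Pi.single i 1) =
      (fderiv ℝ (Φ n j) (T x) (EuclideanSpace.single i 1)).re := by
    intro n j x i
    have hd : HasFDerivAt (fun x : V3 => (Φ n j (T x)).re)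
        (Complex.reCLM.comp ((fderiv ℝ (Φ n j) (T x)).comp (T : V3 →L[ℝ] E3))) x := by
      have a := ((Φ n j).differentiable (T x)).hasFDerivAt
      have b := a.comp x (T : V3 →L[ℝ] E3).hasFDerivAt
      exact Complex.reCLM.hasFDerivAt.comp x b
    rw [hd.fderiv]
    simp [hTs]
  have hsq : ∀ z : ℂ, z.re ^ 2 ≤ ‖z‖ ^ 2 := fun z => by
    rw [← sq_abs]; exact pow_le_pow_left₀ (abs_nonneg _) (Complex.abs_re_le_norm z) 2
  have hGint : ∀ G : E3 → ℂ, Continuous G → Integrable (fun x => ‖G x‖ ^ 2) →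
      Integrable (fun x : V3 => (G (T x)).re ^ 2) ∧ ∫ x : V3, (G (T x)).re ^ 2 ≤ ∫ y, ‖G y‖ ^ 2 := by
    intro G hG hGi
    have hi := integrable_toLp _ hGi
    have hi2 : Integrable (fun x : V3 => (G (T x)).re ^ 2) := by
      refine hi.mono' ?_ (Eventually.of_forall fun x => ?_)
      · exact ((Complex.continuous_re.comp (hG.comp T.continuous)).pow 2).aestronglyMeasurable
      · rw [Real.norm_eq_abs, abs_of_nonneg (sq_nonneg _)]; exact hsq _
    refine ⟨hi2, ?_⟩
    rw [← int_toLp]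
    exact integral_mono hi2 hi fun x => hsq _
  have hcd : ∀ n j i, Continuous fun y => fderiv ℝ (Φ n j) y (EuclideanSpace.single i 1) := fun n j i =>
    (∂_{(EuclideanSpace.single i 1 : E3)} (Φ n j)).continuous
  refine ⟨fun n x => (F n (T x)).re, fun n j x => (Φ n j (T x)).re, ?_, ?_, ?_, ?_, ?_, ?_, ?_, ?_⟩
  · intro n j
    exact Complex.reCLM.contDiff.comp (((Φ n j).smooth _).comp T.contDiff)
  · intro n
    exact Complex.continuous_re.comp ((F n).continuous.comp T.continuous)
  · intro n x
    simp only [hfd]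
    have := congrArg Complex.re (h1 n (T x))
    rw [hwv] at this
    simpa using this
  · intro n i j
    simp only [hfd]
    have := hGint _ (hcd n j i) (h5 n i j)
    exact ⟨this.1, this.2.trans ((h2 n i j).trans (hnw n).le)⟩
  · intro n; exact (hGint _ (F n).continuous (schwartz_sq_int _)).1
  · refine squeeze_zero (fun n => integral_nonneg fun x => sq_nonneg _)
      (fun n => (hGint _ (F n).continuous (schwartz_sq_int _)).2) ?_
    simpa only [h3] using ht1
  · intro n j; exact (hGint _ (Φ n j).continuous (schwartz_sq_int _)).1
  · intro j
    exact squeeze_zero (fun n => integral_nonneg fun x => sq_nonneg _)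
      (fun n => (hGint _ (Φ n j).continuous (schwartz_sq_int _)).2.trans (h4 n j)) ht2

end Part3

section Part4
open MeasureTheory Filter Topology Bornology
open scoped Matrix ENNReal NNReal

theorem vol_cb (x : V3) (r : ℝ) (hr : 0 ≤ r) : volume (Metric.closedBall x r) = ENNReal.ofReal ((2 * r) ^ 3) := by
  rw [Real.volume_pi_closedBall x hr]; simp

theorem weak_type (H : V3 → ℝ≥0∞) (hHfin : ∫⁻ x, H x ≠ ∞) (t : ℝ) (ht : 0 < t) :
    volume {x : V3 | ∃ r > 0, ENNReal.ofReal (t * (2 * r) ^ 3) < ∫⁻ y in Metric.closedBall x r, H y}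
      ≤ 125 * (∫⁻ x, H x) / ENNReal.ofReal t := by
  set S := {x : V3 | ∃ r > 0, ENNReal.ofReal (t * (2 * r) ^ 3) < ∫⁻ y in Metric.closedBall x r, H y} with hS
  choose! r hr0 hr using (fun x (hx : x ∈ S) => hx)
  set I := (∫⁻ x, H x).toReal with hI
  have hrle : ∀ x ∈ S, r x ≤ max 1 (I / t) := by
    intro x hx
    have h1 : ENNReal.ofReal (t * (2 * r x) ^ 3) < ∫⁻ y, H y := (hr x hx).trans_le (setLIntegral_le_lintegral _ _)
    have h2 : t * (2 * r x) ^ 3 < I := (ENNReal.ofReal_lt_iff_lt_toReal (by have := hr0 x hx; positivity) hHfin).1 h1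
    by_contra hcon
    push Not at hcon
    have h3 := (max_lt_iff.1 hcon)
    rw [div_lt_iff₀ ht] at h3
    have : r x * t ≤ t * (2 * r x) ^ 3 := by
      have h4 : r x ≤ (2 * r x) ^ 3 := by
        have : (1:ℝ) ≤ r x ^ 2 := by nlinarith [h3.1]
        nlinarith [hr0 x hx]
      nlinarith
    linarith [h3.2]
  obtain ⟨u, huS, hdis, hcov⟩ := Vitali.exists_disjoint_subfamily_covering_enlargement_closedBall S
    (fun x => x) r _ hrle 5 (by norm_num)
  have hcount : u.Countable := by
    apply hdis.countable_of_nonempty_interior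
    intro a ha
    exact ⟨a, Metric.ball_subset_interior_closedBall (Metric.mem_ball_self (hr0 a (huS ha)))⟩
  have hsub : S ⊆ ⋃ b ∈ u, Metric.closedBall b (5 * r b) := by
    intro x hx
    obtain ⟨b, hb, hxb⟩ := hcov x hx
    exact Set.mem_biUnion hb (hxb (Metric.mem_closedBall_self (hr0 x hx).le))
  rw [ENNReal.le_div_iff_mul_le (Or.inl (by simpa using ht)) (Or.inl ENNReal.ofReal_ne_top)]
  have hone : ∀ b ∈ u, volume (Metric.closedBall b (5 * r b)) * ENNReal.ofReal t ≤ 125 * ∫⁻ y in Metric.closedBall b (r b), H y := by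
    intro b hb
    have hb0 := hr0 b (huS hb)
    rw [vol_cb _ _ (by positivity), ← ENNReal.ofReal_mul (by positivity)]
    have : (2 * (5 * r b)) ^ 3 * t = 125 * (t * (2 * r b) ^ 3) := by ring
    rw [this, ENNReal.ofReal_mul (by norm_num)]
    gcongr
    · simp
    · exact (hr b (huS hb)).le
  calc volume S * ENNReal.ofReal t ≤ (∑' b : u, volume (Metric.closedBall (b : V3) (5 * r b))) * ENNReal.ofReal t := by
        gcongr
        refine (measure_mono hsub).trans ?_
        exact measure_biUnion_le _ hcount _
    _ = ∑' b : u, volume (Metric.closedBall (b : V3) (5 * r b)) * ENNReal.ofReal t := ENNReal.tsum_mul_right.symm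
    _ ≤ ∑' b : u, 125 * ∫⁻ y in Metric.closedBall (b : V3) (r b), H y := ENNReal.tsum_le_tsum fun b => hone b b.2
    _ = 125 * ∑' b : u, ∫⁻ y in Metric.closedBall (b : V3) (r b), H y := ENNReal.tsum_mul_left
    _ = 125 * ∫⁻ y in ⋃ b ∈ u, Metric.closedBall (b : V3) (r b), H y := by
        rw [lintegral_biUnion hcount (fun b _ => measurableSet_closedBall) hdis]
    _ ≤ 125 * ∫⁻ y, H y := by gcongr; exact Measure.restrict_le_self

theorem scale_bd (D : V3 → ℝ) (hD : Continuous D) (hD0 : ∀ x, 0 ≤ D x) (a c : V3) (R L : ℝ) (hR : 0 < R)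
    (hac : dist c a ≤ R)
    (hmax : ∀ r > 0, ∫ y in Metric.closedBall a r, D y ≤ L * (2 * r) ^ 3) :
    Integrable (fun z => ∫ t in Set.Ioc (0:ℝ) 1, D (a + t • (z - a))) (volume.restrict (Metric.closedBall c R)) ∧
    ∫ z in Metric.closedBall c R, ∫ t in Set.Ioc (0:ℝ) 1, D (a + t • (z - a)) ≤ L * (4 * R) ^ 3 := by
  set Q := Metric.closedBall c R with hQ
  have hQc : IsCompact Q := isCompact_closedBall _ _
  have hcont : Continuous (Function.uncurry fun (z : V3) (t : ℝ) => D (a + t • (z - a))) := by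
    apply hD.comp (g := D) (f := fun p : V3 × ℝ => a + p.2 • (p.1 - a))
    fun_prop
  have hQsub : ∀ z ∈ Q, ‖z - a‖ ≤ 2 * R := by
    intro z hz
    rw [← dist_eq_norm]
    have := dist_triangle z c a
    have h2 : dist z c ≤ R := hz
    linarith
  have hprod : Integrable (Function.uncurry fun (z : V3) (t : ℝ) => D (a + t • (z - a)))
      ((volume.restrict Q).prod (volume.restrict (Set.Ioc (0:ℝ) 1))) := by
    rw [Measure.prod_restrict]
    have : IntegrableOn (Function.uncurry fun (z : V3) (t : ℝ) => D (a + t • (z - a))) (Q ×ˢ Set.Icc (0:ℝ) 1) (volume.prod volume) :=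
      hcont.continuousOn.integrableOn_compact (hQc.prod isCompact_Icc)
    exact this.mono_set (Set.prod_mono le_rfl Set.Ioc_subset_Icc_self)
  have hscale : ∀ t ∈ Set.Ioc (0:ℝ) 1, ∫ z in Q, D (a + t • (z - a)) ≤ L * (4 * R) ^ 3 := by
    intro t ht
    have hct : Continuous fun z => D (a + t • (z - a)) := hD.comp (by fun_prop)
    calc ∫ z in Q, D (a + t • (z - a)) ≤ ∫ z in Metric.closedBall a (2 * R), D (a + t • (z - a)) := by
          apply setIntegral_mono_set (hct.continuousOn.integrableOn_compact (isCompact_closedBall _ _))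
          · exact Eventually.of_forall fun z => hD0 _
          · apply LE.le.eventuallyLE
            intro z hz; rw [Metric.mem_closedBall, dist_eq_norm]; exact hQsub z hz
      _ = ∫ z in Metric.closedBall 0 (2 * R), D (a + t • z) := by
          have := (measurePreserving_sub_right (volume : Measure V3) a).setIntegral_preimage_emb (MeasurableEquiv.subRight a).measurableEmbedding (fun z => D (a + t • z)) (Metric.closedBall 0 (2 * R))
          rw [← this]; congr 2
          ext z; simp [dist_eq_norm]
      _ = (t ^ 3)⁻¹ * ∫ z in Metric.closedBall 0 (2 * (R * t)), D (a + z) := by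
          rw [Measure.setIntegral_comp_smul_of_pos volume (fun z => D (a + z)) _ ht.1]
          rw [smul_closedBall _ _ (by positivity)]
          simp [abs_of_pos ht.1]
          left; congr 3; ring
      _ = (t ^ 3)⁻¹ * ∫ z in Metric.closedBall a (2 * (R * t)), D z := by
          have := (measurePreserving_add_left (volume : Measure V3) a).setIntegral_preimage_emb (MeasurableEquiv.addLeft a).measurableEmbedding (fun z => D z) (Metric.closedBall a (2 * (R * t)))
          rw [← this]; congr 3
          ext z; simp [dist_eq_norm]
      _ ≤ (t ^ 3)⁻¹ * (L * (2 * (2 * (R * t))) ^ 3) := by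
          have := ht.1
          gcongr
          exact hmax _ (by positivity)
      _ = L * (4 * R) ^ 3 := by
          have := ht.1.ne'
          field_simp; ring
  refine ⟨hprod.integral_prod_left, ?_⟩
  rw [integral_integral_swap hprod]
  calc _ ≤ ∫ t in Set.Ioc (0:ℝ) 1, L * (4 * R) ^ 3 := 
        setIntegral_mono_on hprod.integral_prod_right (integrable_const _) measurableSet_Ioc hscale
    _ = _ := by simp

theorem half_lip (φ : V3 → ℝ) (hφ : ContDiff ℝ 1 φ) (a c : V3) (R L : ℝ) (hR : 0 < R)
    (hac : dist c a ≤ R)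
    (hmax : ∀ r > 0, ∫ y in Metric.closedBall a r, ‖fderiv ℝ φ y‖ ≤ L * (2 * r) ^ 3) :
    |∫ z in Metric.closedBall c R, (φ z - φ a)| ≤ 16 * L * R * (2 * R) ^ 3 := by
  have hD : Continuous (fun y => ‖fderiv ℝ φ y‖) := (hφ.continuous_fderiv one_ne_zero).norm
  set Q := Metric.closedBall c R with hQ
  have hQc : IsCompact Q := isCompact_closedBall _ _
  have hQsub : ∀ z ∈ Q, ‖z - a‖ ≤ 2 * R := by
    intro z hz
    rw [← dist_eq_norm]
    have := dist_triangle z c a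
    have h2 : dist z c ≤ R := hz
    linarith
  have hpt : ∀ z ∈ Q, |φ z - φ a| ≤ 2 * R * ∫ t in Set.Ioc (0:ℝ) 1, ‖fderiv ℝ φ (a + t • (z - a))‖ := by
    intro z hz
    have hder : ∀ t ∈ Set.uIcc (0:ℝ) 1, HasDerivAt (fun t : ℝ => φ (a + t • (z - a))) (fderiv ℝ φ (a + t • (z - a)) (z - a)) t := by
      intro t _
      have h1 : HasDerivAt (fun t : ℝ => a + t • (z - a)) (z - a) t := by
        simpa using ((hasDerivAt_id t).smul_const (z - a)).const_add a
      exact ((hφ.differentiable one_ne_zero) _).hasFDerivAt.comp_hasDerivAt t h1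
    have hci : Continuous fun t : ℝ => fderiv ℝ φ (a + t • (z - a)) (z - a) := by
      have : Continuous fun t : ℝ => fderiv ℝ φ (a + t • (z - a)) :=
        (hφ.continuous_fderiv one_ne_zero).comp (by fun_prop)
      fun_prop
    have hFTC := intervalIntegral.integral_eq_sub_of_hasDerivAt hder (hci.intervalIntegrable _ _)
    simp only [one_smul, zero_smul, add_zero, add_sub_cancel] at hFTC
    rw [← hFTC, intervalIntegral.integral_of_le zero_le_one, ← Real.norm_eq_abs, ← integral_const_mul]
    refine norm_integral_le_of_norm_le ?_ (Eventually.of_forall fun t => ?_)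
    · have : Continuous fun t : ℝ => 2 * R * ‖fderiv ℝ φ (a + t • (z - a))‖ :=
        continuous_const.mul (hD.comp (g := fun y => ‖fderiv ℝ φ y‖) (f := fun t : ℝ => a + t • (z - a)) (by fun_prop))
      exact (this.integrableOn_Icc).mono_set Set.Ioc_subset_Icc_self
    · refine (ContinuousLinearMap.le_opNorm _ _).trans ?_
      rw [mul_comm]
      gcongr; exact hQsub z hz
  obtain ⟨h1, h2⟩ := scale_bd _ hD (fun x => norm_nonneg _) a c R L hR hac hmax
  calc |∫ z in Q, (φ z - φ a)| ≤ ∫ z in Q, 2 * R * ∫ t in Set.Ioc (0:ℝ) 1, ‖fderiv ℝ φ (a + t • (z - a))‖ := by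
        rw [← Real.norm_eq_abs]
        refine norm_integral_le_of_norm_le (h1.const_mul _) ?_
        exact (ae_restrict_iff' hQc.measurableSet).2 (Eventually.of_forall fun z hz => hpt z hz)
    _ = 2 * R * ∫ z in Q, ∫ t in Set.Ioc (0:ℝ) 1, ‖fderiv ℝ φ (a + t • (z - a))‖ := by
        rw [integral_const_mul]
    _ ≤ 2 * R * (L * (4 * R) ^ 3) := by gcongr
    _ = 16 * L * R * (2 * R) ^ 3 := by ring

end Part4

section Part5
open MeasureTheory Filter Topology Bornology
open scoped Matrix ENNReal NNReal

theorem lip_pair (φ : V3 → ℝ) (hφ : ContDiff ℝ 1 φ) (x y : V3) (L : ℝ)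
    (hx : ∀ r > 0, ∫ z in Metric.closedBall x r, ‖fderiv ℝ φ z‖ ≤ L * (2 * r) ^ 3)
    (hy : ∀ r > 0, ∫ z in Metric.closedBall y r, ‖fderiv ℝ φ z‖ ≤ L * (2 * r) ^ 3) :
    |φ x - φ y| ≤ 32 * L * dist x y := by
  rcases eq_or_ne x y with rfl | hne
  · simp
  set R := dist x y with hRdef
  have hR : 0 < R := dist_pos.2 hne
  have h1 := half_lip φ hφ x x R L hR (by simpa using hR.le) hx
  have h2 := half_lip φ hφ y x R L hR le_rfl hy
  have hi : ∀ a : V3, IntegrableOn (fun z => φ z - φ a) (Metric.closedBall x R) := fun a =>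
    (hφ.continuous.sub continuous_const).continuousOn.integrableOn_compact (isCompact_closedBall _ _)
  have h3 : (∫ z in Metric.closedBall x R, (φ z - φ y)) - ∫ z in Metric.closedBall x R, (φ z - φ x) = (2 * R) ^ 3 * (φ x - φ y) := by
    rw [← integral_sub (hi y) (hi x)]
    have : (fun z => φ z - φ y - (φ z - φ x)) = fun _ => φ x - φ y := by ext; ring
    rw [this, setIntegral_const, smul_eq_mul, Measure.real, vol_cb _ _ hR.le, ENNReal.toReal_ofReal (by positivity)]
  have h4 : (2 * R) ^ 3 * |φ x - φ y| ≤ (2 * R) ^ 3 * (32 * L * R) := by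
    have : (2 * R) ^ 3 * |φ x - φ y| = |(2 * R) ^ 3 * (φ x - φ y)| := by
      rw [abs_mul, abs_of_pos (by positivity : 0 < (2 * R) ^ 3)]
    rw [this, ← h3]
    refine (abs_sub _ _).trans ?_
    linarith
  exact le_of_mul_le_mul_left h4 (by positivity)

theorem ae_fderiv_eq (s : Set V3) (hs : MeasurableSet s) (f g : V3 → ℝ) (hf : ∀ᵐ x, DifferentiableAt ℝ f x)
    (hg : Differentiable ℝ g) (hfg : ∀ x ∈ s, f x = g x) : ∀ᵐ x, x ∈ s → fderiv ℝ f x = fderiv ℝ g x := by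
  let e : ℝ →L[ℝ] V3 := ContinuousLinearMap.toSpanSingleton ℝ (Pi.single 0 1)
  let s' := s ∩ {x | DifferentiableAt ℝ f x}
  have hs' : MeasurableSet s' := hs.inter (measurableSet_of_differentiableAt ℝ f)
  have key : ∀ x ∈ s', HasFDerivWithinAt (fun x => e (f x - g x)) (e ∘L (fderiv ℝ f x - fderiv ℝ g x)) s' x := by
    intro x hx
    exact (e.hasFDerivAt.comp x (hx.2.hasFDerivAt.sub (hg x).hasFDerivAt)).hasFDerivWithinAt
  have happ : ApproximatesLinearOn (fun x => e (f x - g x)) (0 : V3 →L[ℝ] V3) s' 0 := by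
    intro x hx y hy
    simp [hfg x hx.1, hfg y hy.1]
  have h := happ.norm_fderiv_sub_le (μ := volume) hs' _ key
  rw [ae_restrict_iff' hs'] at h
  filter_upwards [h, hf] with x hx hfx hxs
  have h0 := hx ⟨hxs, hfx⟩
  simp only [sub_zero] at h0
  have h1 : e ∘L (fderiv ℝ f x - fderiv ℝ g x) = 0 := by
    apply norm_le_zero_iff.1; simpa using h0
  rw [← sub_eq_zero]
  ext v
  have h2 := congrFun (DFunLike.congr_fun h1 v) 0
  simpa [e] using h2

theorem lip_trunc (φ : V3 → ℝ) (hφ : ContDiff ℝ 1 φ) (h2 : Integrable (fun x => φ x ^ 2))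
    (hD2 : Integrable (fun x => ‖fderiv ℝ φ x‖ ^ 2)) (L : ℝ) (hL : 0 < L) :
    ∃ (ψ : V3 → ℝ) (N : Set V3), MeasurableSet N ∧ LipschitzWith (32 * L).toNNReal ψ ∧
      (∀ x, |ψ x| ≤ L) ∧ (∀ x, x ∉ N → ψ x = φ x) ∧
      (∀ᵐ x, x ∉ N → fderiv ℝ ψ x = fderiv ℝ φ x) ∧
      volume N ≤ ENNReal.ofReal (125 * ((∫ x, φ x ^ 2) + ∫ x, ‖fderiv ℝ φ x‖ ^ 2) / L ^ 2) := by
  have hDc : Continuous (fun y => ‖fderiv ℝ φ y‖) := (hφ.continuous_fderiv one_ne_zero).norm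
  set H : V3 → ℝ≥0∞ := fun x => ENNReal.ofReal (‖fderiv ℝ φ x‖ ^ 2) with hH
  have hHint : ∫⁻ x, H x = ENNReal.ofReal (∫ x, ‖fderiv ℝ φ x‖ ^ 2) := by
    rw [ofReal_integral_eq_lintegral_ofReal hD2 (Eventually.of_forall fun x => by positivity)]
  set S := {x : V3 | ∃ r > 0, ENNReal.ofReal (L ^ 2 * (2 * r) ^ 3) < ∫⁻ y in Metric.closedBall x r, H y} with hS
  have hSvol := weak_type H (by rw [hHint]; exact ENNReal.ofReal_ne_top) (L ^ 2) (by positivity)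
  have hgood : ∀ x, x ∉ S → ∀ r > 0, ∫ y in Metric.closedBall x r, ‖fderiv ℝ φ y‖ ≤ L * (2 * r) ^ 3 := by
    intro x hx r hr
    have hx' : ∫⁻ y in Metric.closedBall x r, H y ≤ ENNReal.ofReal (L ^ 2 * (2 * r) ^ 3) := by
      by_contra hcon
      exact hx ⟨r, hr, not_le.1 hcon⟩
    rw [← ofReal_integral_eq_lintegral_ofReal hD2.integrableOn (Eventually.of_forall fun x => by positivity)] at hx'
    rw [ENNReal.ofReal_le_ofReal_iff (by positivity)] at hx'
    have hI1 : IntegrableOn (fun y => ‖fderiv ℝ φ y‖) (Metric.closedBall x r) :=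
      hDc.continuousOn.integrableOn_compact (isCompact_closedBall _ _)
    have hI3 : IntegrableOn (fun y => (‖fderiv ℝ φ y‖ ^ 2 / L + L) / 2) (Metric.closedBall x r) :=
      (Continuous.continuousOn (by fun_prop)).integrableOn_compact (isCompact_closedBall _ _)
    calc ∫ y in Metric.closedBall x r, ‖fderiv ℝ φ y‖ ≤ ∫ y in Metric.closedBall x r, (‖fderiv ℝ φ y‖ ^ 2 / L + L) / 2 := by
          apply setIntegral_mono hI1 hI3
          intro y
          have : 0 ≤ (‖fderiv ℝ φ y‖ - L) ^ 2 / L := by positivity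
          have h5 : (‖fderiv ℝ φ y‖ - L) ^ 2 / L = ‖fderiv ℝ φ y‖ ^ 2 / L + L - 2 * ‖fderiv ℝ φ y‖ := by
            field_simp; ring
          simp only; linarith
      _ = ((∫ y in Metric.closedBall x r, ‖fderiv ℝ φ y‖ ^ 2) / L + L * (2 * r) ^ 3) / 2 := by
          rw [integral_div, integral_add (hD2.integrableOn.div_const _) (by
            exact (continuous_const.continuousOn.integrableOn_compact (isCompact_closedBall _ _)))]
          rw [integral_div, setIntegral_const, smul_eq_mul, Measure.real, vol_cb _ _ hr.le, ENNReal.toReal_ofReal (by positivity)]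
          ring
      _ ≤ ((L ^ 2 * (2 * r) ^ 3) / L + L * (2 * r) ^ 3) / 2 := by gcongr
      _ = L * (2 * r) ^ 3 := by field_simp; ring
  set N0 := S ∪ {x | L ^ 2 ≤ φ x ^ 2} with hN0
  have hmark : volume {x | L ^ 2 ≤ φ x ^ 2} ≤ ENNReal.ofReal ((∫ x, φ x ^ 2) / L ^ 2) := by
    have := mul_meas_ge_le_integral_of_nonneg (Eventually.of_forall fun x => by positivity) h2 (L ^ 2)
    have hfin : volume {x | L ^ 2 ≤ φ x ^ 2} ≠ ∞ := (Integrable.measure_ge_lt_top h2 (by positivity)).ne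
    rw [ENNReal.le_ofReal_iff_toReal_le hfin (by positivity), le_div_iff₀ (by positivity), mul_comm]
    exact this
  have hN0vol : volume N0 ≤ ENNReal.ofReal (125 * ((∫ x, φ x ^ 2) + ∫ x, ‖fderiv ℝ φ x‖ ^ 2) / L ^ 2) := by
    have hp1 : 0 ≤ ∫ x, φ x ^ 2 := by positivity
    have hp2 : 0 ≤ ∫ x, ‖fderiv ℝ φ x‖ ^ 2 := by positivity
    have hS2 : volume S ≤ ENNReal.ofReal (125 * (∫ x, ‖fderiv ℝ φ x‖ ^ 2) / L ^ 2) := by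
      refine hSvol.trans (le_of_eq ?_)
      rw [hHint, ENNReal.ofReal_div_of_pos (by positivity), ENNReal.ofReal_mul (by norm_num)]
      simp
    refine (measure_union_le _ _).trans ((add_le_add hS2 hmark).trans ?_)
    rw [← ENNReal.ofReal_add (by positivity) (by positivity)]
    apply ENNReal.ofReal_le_ofReal
    rw [← add_div]
    gcongr
    linarith
  set N := toMeasurable volume N0 with hN
  have hNN0 : ∀ x, x ∉ N → x ∉ S ∧ |φ x| ≤ L := by
    intro x hx
    have : x ∉ N0 := fun h => hx (subset_toMeasurable _ _ h)
    rw [hN0] at this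
    simp only [Set.mem_union, not_or, Set.mem_ofPred_eq, not_le] at this
    exact ⟨this.1, (abs_lt_of_sq_lt_sq this.2 hL.le).le⟩
  have hLip : LipschitzOnWith (32 * L).toNNReal φ Nᶜ := by
    apply LipschitzOnWith.of_dist_le_mul
    intro x hx y hy
    rw [Real.coe_toNNReal _ (by positivity), Real.dist_eq]
    exact lip_pair φ hφ x y L (hgood x (hNN0 x hx).1) (hgood y (hNN0 y hy).1)
  obtain ⟨g, hg, hgeq⟩ := hLip.extend_real
  refine ⟨fun x => max (-L) (min L (g x)), N, measurableSet_toMeasurable _ _, ?_, ?_, ?_, ?_, ?_⟩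
  · exact (hg.const_min L).const_max (-L)
  · intro x
    rw [abs_le]
    exact ⟨le_max_left _ _, max_le (by linarith) (min_le_left _ _)⟩
  · intro x hx
    have h1 := abs_le.1 (hNN0 x hx).2
    simp only
    rw [← hgeq hx, min_eq_right h1.2, max_eq_right h1.1]
  · have := ae_fderiv_eq Nᶜ (measurableSet_toMeasurable _ _).compl (fun x => max (-L) (min L (g x))) φ
      ((hg.const_min L).const_max (-L)).ae_differentiableAt (hφ.differentiable one_ne_zero) (by
        intro x hx
        have h1 := abs_le.1 (hNN0 x hx).2
        rw [← hgeq hx, min_eq_right h1.2, max_eq_right h1.1])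
    exact this
  · rw [hN, measure_toMeasurable]; exact hN0vol

end Part5

section Part6
open MeasureTheory Filter Topology Bornology
open scoped Matrix ENNReal NNReal

open Convolution in
theorem moll_exists : ∃ ρ : ℕ → V3 → ℝ, (∀ k, ContDiff ℝ (⊤ : ℕ∞) (ρ k)) ∧ (∀ k, HasCompactSupport (ρ k)) ∧
    (∀ k x, 0 ≤ ρ k x) ∧ (∀ k, ∫ x, ρ k x = 1) ∧ (∀ k x, ρ k x ≠ 0 → ‖x‖ < 1 / ((k : ℝ) + 1)) ∧
    ∀ g : V3 → ℝ, LocallyIntegrable g → ∀ᵐ x, Tendsto (fun k => ∫ t, g t * ρ k (x - t)) atTop (𝓝 (g x)) := by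
  let b : ℕ → ContDiffBump (0 : V3) := fun k => ⟨1 / (2 * ((k : ℝ) + 1)), 1 / ((k : ℝ) + 1), by positivity, by
    apply one_div_lt_one_div_of_lt (by positivity); linarith [(by positivity : (0:ℝ) < (k:ℝ) + 1)]⟩
  refine ⟨fun k => (b k).normed volume, fun k => (b k).contDiff_normed, fun k => (b k).hasCompactSupport_normed,
    fun k x => (b k).nonneg_normed x, fun k => (b k).integral_normed, ?_, ?_⟩
  · intro k x hx
    have : x ∈ Function.support ((b k).normed volume) := hx
    rw [ContDiffBump.support_normed_eq] at this
    exact mem_ball_zero_iff.1 this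
  · intro g hg
    have h1 : Tendsto (fun k => (b k).rOut) atTop (𝓝 0) := tendsto_one_div_add_atTop_nhds_zero_nat
    have := ContDiffBump.ae_convolution_tendsto_right_of_locallyIntegrable (K := 2) h1
      (Eventually.of_forall fun k => by
        change 1 / ((k : ℝ) + 1) ≤ 2 * (1 / (2 * ((k : ℝ) + 1)))
        apply le_of_eq; field_simp) hg
    filter_upwards [this] with x hx
    refine hx.congr fun k => ?_
    rw [convolution_eq_swap]
    congr 1; ext t; simp [mul_comm]

theorem moll_bdd (ρ : V3 → ℝ) (h1 : ContDiff ℝ (⊤ : ℕ∞) ρ) (h2 : HasCompactSupport ρ)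
    (h3 : ∀ x, 0 ≤ ρ x) (h4 : ∫ x, ρ x = 1) (g : V3 → ℝ) (M : ℝ) (hM : ∀ x, |g x| ≤ M) (x : V3) :
      |∫ t, g t * ρ (x - t)| ≤ M := by
  have hi : Integrable (fun t => ρ (x - t)) :=
    (h1.continuous.integrable_of_hasCompactSupport h2).comp_sub_left x
  rw [← Real.norm_eq_abs]
  calc _ ≤ ∫ t, M * ρ (x - t) := by
        refine norm_integral_le_of_norm_le (hi.const_mul _) (Eventually.of_forall fun t => ?_)
        rw [Real.norm_eq_abs, abs_mul, abs_of_nonneg (h3 _)]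
        exact mul_le_mul_of_nonneg_right (hM t) (h3 _)
    _ = M := by rw [integral_const_mul, integral_sub_left_eq_self, h4, mul_one]

open Convolution in
theorem moll_smooth (ρ : V3 → ℝ) (h1 : ContDiff ℝ (⊤ : ℕ∞) ρ) (h2 : HasCompactSupport ρ) (g : V3 → ℝ)
    (hg : LocallyIntegrable g) :
    ContDiff ℝ (⊤ : ℕ∞) (fun x => ∫ t, g t * ρ (x - t)) ∧
    ∀ x v, fderiv ℝ (fun x => ∫ t, g t * ρ (x - t)) x v = ∫ t, g t * fderiv ℝ ρ (x - t) v := by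
  constructor
  · exact h2.contDiff_convolution_right (ContinuousLinearMap.mul ℝ ℝ) hg h1
  · intro x v
    have h1' : ContDiff ℝ 1 ρ := h1.of_le (by simp)
    have h := (h2.hasFDerivAt_convolution_right (ContinuousLinearMap.mul ℝ ℝ) hg h1' x).fderiv
    have h' : fderiv ℝ (fun x => ∫ t, g t * ρ (x - t)) x = (g ⋆[(ContinuousLinearMap.mul ℝ ℝ).precompR V3, volume] fderiv ℝ ρ) x := h
    rw [h', convolution_precompR_apply _ hg (h2.fderiv ℝ) (h1'.continuous_fderiv one_ne_zero)]
    rfl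

theorem moll_lip (ψ : V3 → ℝ) (K : ℝ≥0) (hψ : LipschitzWith K ψ) (L : ℝ) (hL : ∀ x, |ψ x| ≤ L) :
    ∃ ψk : ℕ → V3 → ℝ, (∀ k, ContDiff ℝ (⊤ : ℕ∞) (ψk k)) ∧ (∀ k x, |ψk k x| ≤ L) ∧
      (∀ k x i, |fderiv ℝ (ψk k) x (Pi.single i 1)| ≤ K) ∧
      (∀ᵐ x, Tendsto (fun k => ψk k x) atTop (𝓝 (ψ x))) ∧
      (∀ᵐ x, ∀ i, Tendsto (fun k => fderiv ℝ (ψk k) x (Pi.single i 1)) atTop (𝓝 (fderiv ℝ ψ x (Pi.single i 1)))) := by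
  obtain ⟨ρ, h1, h2, h3, h4, h5, h6⟩ := moll_exists
  have hψi : LocallyIntegrable ψ := hψ.continuous.locallyIntegrable
  have hld : ∀ i x, |lineDeriv ℝ ψ x (Pi.single i 1)| ≤ K := fun i x => by
    have := norm_lineDeriv_le_of_lipschitz ℝ (v := (Pi.single i 1 : V3)) (x₀ := x) hψ
    have hn : ‖(Pi.single i 1 : V3)‖ = 1 := by rw [Pi.norm_single]; simp
    rwa [hn, mul_one] at this
  have hldi : ∀ i, LocallyIntegrable (fun x => lineDeriv ℝ ψ x (Pi.single i 1)) := fun i =>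
    (locallyIntegrable_const (K : ℝ)).mono (measurable_lineDeriv hψ.continuous).aestronglyMeasurable
      (Eventually.of_forall fun x => by simpa using hld i x)
  have hder : ∀ k x i, fderiv ℝ (fun x => ∫ t, ψ t * ρ k (x - t)) x (Pi.single i 1) =
      ∫ t, lineDeriv ℝ ψ t (Pi.single i 1) * ρ k (x - t) := by
    intro k x i
    rw [(moll_smooth (ρ k) (h1 k) (h2 k) ψ hψi).2]
    have hs : ContDiff ℝ 1 (fun t => ρ k (x - t)) := ((h1 k).of_le (by simp)).comp (contDiff_const.sub contDiff_id)
    have hc : HasCompactSupport (fun t => ρ k (x - t)) := (h2 k).comp_homeomorph (Homeomorph.subLeft x)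
    obtain ⟨C, hC⟩ := hs.lipschitzWith_of_hasCompactSupport hc (one_ne_zero)
    rw [hψ.integral_lineDeriv_mul_eq hC hc]
    congr 1; ext t
    have hd : HasFDerivAt (fun t => ρ k (x - t)) (fderiv ℝ (ρ k) (x - t) ∘L (-ContinuousLinearMap.id ℝ V3)) t := by
      apply HasFDerivAt.comp t (((h1 k).differentiable (by simp)) _).hasFDerivAt
      exact (hasFDerivAt_id t).const_sub x
    rw [hd.differentiableAt.lineDeriv_eq_fderiv, hd.fderiv]
    simp [mul_comm]
  refine ⟨fun k x => ∫ t, ψ t * ρ k (x - t), fun k => (moll_smooth _ (h1 k) (h2 k) ψ hψi).1,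
    fun k x => moll_bdd _ (h1 k) (h2 k) (h3 k) (h4 k) ψ L hL x, ?_, h6 ψ hψi, ?_⟩
  · intro k x i
    rw [hder]
    exact moll_bdd _ (h1 k) (h2 k) (h3 k) (h4 k) _ K (hld i) x
  · have hall : ∀ᵐ x, ∀ i, Tendsto (fun k => ∫ t, lineDeriv ℝ ψ t (Pi.single i 1) * ρ k (x - t)) atTop (𝓝 (lineDeriv ℝ ψ x (Pi.single i 1))) :=
      ae_all_iff.2 fun i => h6 _ (hldi i)
    filter_upwards [hall, hψ.ae_differentiableAt] with x hx hd i
    simp only [hder]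
    rw [← hd.lineDeriv_eq_fderiv]
    exact hx i

end Part6

section Part7
open MeasureTheory Filter Topology Bornology
open scoped Matrix ENNReal NNReal

theorem lip_test (χ : V3 → ℝ) (hχ : ContDiff ℝ (⊤ : ℕ∞) χ) (hχc : HasCompactSupport χ)
    (b : Fin 3 → Fin 3 → V3 → ℝ) (hb : ∀ i j, Measurable (b i j)) (M : ℝ) (hbM : ∀ i j x, |b i j x| ≤ M)
    (L : ℝ) (K : ℝ≥0) (ε : ℝ)
    (H : ∀ ψ : Fin 3 → V3 → ℝ, (∀ j, ContDiff ℝ (⊤ : ℕ∞) (ψ j)) → (∀ j x, |ψ j x| ≤ L) →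
      (∀ j x i, |fderiv ℝ (ψ j) x (Pi.single i 1)| ≤ K) →
      |∫ x, ∑ i, ∑ j, b i j x * (fderiv ℝ χ x (Pi.single i 1) * ψ j x + χ x * fderiv ℝ (ψ j) x (Pi.single i 1))| ≤ ε)
    (ψ : Fin 3 → V3 → ℝ) (hψ : ∀ j, LipschitzWith K (ψ j)) (hψL : ∀ j x, |ψ j x| ≤ L) :
    |∫ x, ∑ i, ∑ j, b i j x * (fderiv ℝ χ x (Pi.single i 1) * ψ j x + χ x * fderiv ℝ (ψ j) x (Pi.single i 1))| ≤ ε := by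
  have hM0 : 0 ≤ M := (abs_nonneg _).trans (hbM 0 0 0)
  have hL0 : 0 ≤ L := (abs_nonneg _).trans (hψL 0 0)
  choose ψk h1 h2 h3 h4 h5 using fun j => moll_lip (ψ j) K (hψ j) L (hψL j)
  have hdχ : ∀ i, Continuous fun x => fderiv ℝ χ x (Pi.single i 1) := fun i =>
    (hχ.continuous_fderiv (by simp)).clm_apply continuous_const
  have hdχc : ∀ i, HasCompactSupport fun x => fderiv ℝ χ x (Pi.single i 1) := fun i => hχc.fderiv_apply ℝ _
  have hlim : Tendsto (fun k => ∫ x, ∑ i, ∑ j, b i j x * (fderiv ℝ χ x (Pi.single i 1) * ψk j k x + χ x * fderiv ℝ (ψk j k) x (Pi.single i 1))) atTop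
      (𝓝 (∫ x, ∑ i, ∑ j, b i j x * (fderiv ℝ χ x (Pi.single i 1) * ψ j x + χ x * fderiv ℝ (ψ j) x (Pi.single i 1)))) := by
    apply tendsto_integral_of_dominated_convergence (fun x => ∑ i : Fin 3, ∑ j : Fin 3, M * (|fderiv ℝ χ x (Pi.single i 1)| * L + |χ x| * K))
    · intro k
      apply Measurable.aestronglyMeasurable
      refine Finset.measurable_sum _ fun i _ => Finset.measurable_sum _ fun j _ => ?_
      refine (hb i j).mul (((hdχ i).measurable.mul (h1 j k).continuous.measurable).add (hχ.continuous.measurable.mul ?_))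
      exact (((h1 j k).continuous_fderiv (by simp)).clm_apply continuous_const).measurable
    · refine integrable_finsetSum _ fun i _ => integrable_finsetSum _ fun j _ => Integrable.const_mul (Integrable.add ?_ ?_) _
      · exact (((hdχ i).integrable_of_hasCompactSupport (hdχc i)).abs).mul_const _
      · exact ((hχ.continuous.integrable_of_hasCompactSupport hχc).abs).mul_const _
    · intro k
      refine Eventually.of_forall fun x => ?_
      refine norm_sum_le_of_le _ fun i _ => norm_sum_le_of_le _ fun j _ => ?_
      rw [norm_mul]
      gcongr
      · exact hbM i j x
      · refine (norm_add_le _ _).trans ?_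
        rw [norm_mul, norm_mul]
        gcongr
        · exact le_rfl
        · exact h2 j k x
        · exact le_rfl
        · exact h3 j k x i
    · have h4' := ae_all_iff.2 h4
      have h5' := ae_all_iff.2 h5
      filter_upwards [h4', h5'] with x hx4 hx5
      refine tendsto_finsetSum _ fun i _ => tendsto_finsetSum _ fun j _ => ?_
      exact tendsto_const_nhds.mul ((tendsto_const_nhds.mul (hx4 j)).add (tendsto_const_nhds.mul (hx5 j i)))
  refine le_of_tendsto hlim.abs (Eventually.of_forall fun k => ?_)
  exact H (fun j => ψk j k) (fun j => h1 j k) (fun j x => h2 j k x) (fun j x i => h3 j k x i)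

theorem trunc_test (φ : V3 → ℝ) (hφ : ContDiff ℝ 1 φ) (h2 : Integrable (fun x => φ x ^ 2))
    (hD2 : Integrable (fun x => ‖fderiv ℝ φ x‖ ^ 2)) (P : ℝ)
    (hP : 125 * ((∫ x, φ x ^ 2) + ∫ x, ‖fderiv ℝ φ x‖ ^ 2) ≤ P) (L : ℝ) (hL : 0 < L) :
    ∃ ψ : V3 → ℝ, LipschitzWith (32 * L).toNNReal ψ ∧ (∀ x, |ψ x| ≤ L) ∧
      ∀ (M : ℝ) (β0 : V3 → ℝ) (β : Fin 3 → V3 → ℝ), Measurable β0 → (∀ i, Measurable (β i)) →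
        (∀ x, |β0 x| ≤ M) → (∀ i x, |β i x| ≤ M) →
        Integrable (fun x => β0 x * (φ x - ψ x) + ∑ i, β i x * (fderiv ℝ φ x (Pi.single i 1) - fderiv ℝ ψ x (Pi.single i 1))) ∧
        |∫ x, (β0 x * (φ x - ψ x) + ∑ i, β i x * (fderiv ℝ φ x (Pi.single i 1) - fderiv ℝ ψ x (Pi.single i 1)))| ≤ 104 * M * P / L := by
  obtain ⟨ψ, N, hN, hlip, hbd, heq, hdeq, hvol⟩ := lip_trunc φ hφ h2 hD2 L hL
  refine ⟨ψ, hlip, hbd, ?_⟩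
  intro M β0 β hβ0 hβ hM0 hM
  have hMnn : 0 ≤ M := (abs_nonneg _).trans (hM0 0)
  have hp1 : 0 ≤ ∫ x, φ x ^ 2 := by positivity
  have hp2 : 0 ≤ ∫ x, ‖fderiv ℝ φ x‖ ^ 2 := by positivity
  have hvol2 : volume N ≤ ENNReal.ofReal (P / L ^ 2) := hvol.trans (ENNReal.ofReal_le_ofReal (by gcongr))
  have hNfin : volume N ≠ ∞ := (hvol2.trans_lt ENNReal.ofReal_lt_top).ne
  have hPnn : 0 ≤ P := by linarith
  have hNr : volume.real N ≤ P / L ^ 2 := by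
    rw [Measure.real]; exact ENNReal.toReal_le_of_le_ofReal (by positivity) hvol2
  let G : V3 → ℝ := N.indicator fun x => M * (φ x ^ 2 / L + 3 * (‖fderiv ℝ φ x‖ ^ 2 / L) + 101 * L)
  have hGi0 : IntegrableOn (fun x => φ x ^ 2 / L + 3 * (‖fderiv ℝ φ x‖ ^ 2 / L)) N :=
    ((h2.div_const _).add ((hD2.div_const _).const_mul 3)).integrableOn
  have hGi1 : IntegrableOn (fun x : V3 => 101 * L) N := integrableOn_const hNfin
  have hGi : Integrable G := by
    rw [integrable_indicator_iff hN]
    exact (hGi0.add hGi1).const_mul M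
  have hns : ∀ i, ‖(Pi.single i 1 : V3)‖ = 1 := fun i => by rw [Pi.norm_single]; simp
  have hbound : ∀ᵐ x, ‖β0 x * (φ x - ψ x) + ∑ i, β i x * (fderiv ℝ φ x (Pi.single i 1) - fderiv ℝ ψ x (Pi.single i 1))‖ ≤ G x := by
    filter_upwards [hdeq] with x hx
    by_cases hxN : x ∈ N
    · simp only [G, Set.indicator_of_mem hxN]
      have hφx : |φ x| ≤ φ x ^ 2 / L + L := by
        have h6 : φ x ^ 2 / L + L - |φ x| = ((|φ x| - L / 2) ^ 2 + 3 / 4 * L ^ 2) / L := by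
          rw [← sq_abs]; field_simp; ring
        have : 0 ≤ ((|φ x| - L / 2) ^ 2 + 3 / 4 * L ^ 2) / L := by positivity
        linarith
      have hDx : ‖fderiv ℝ φ x‖ ≤ ‖fderiv ℝ φ x‖ ^ 2 / L + L := by
        have h6 : ‖fderiv ℝ φ x‖ ^ 2 / L + L - ‖fderiv ℝ φ x‖ = ((‖fderiv ℝ φ x‖ - L / 2) ^ 2 + 3 / 4 * L ^ 2) / L := by
          field_simp; ring
        have : 0 ≤ ((‖fderiv ℝ φ x‖ - L / 2) ^ 2 + 3 / 4 * L ^ 2) / L := by positivity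
        linarith
      have hd1 : ∀ i, ‖fderiv ℝ φ x (Pi.single i 1)‖ ≤ ‖fderiv ℝ φ x‖ := fun i => by
        have := (fderiv ℝ φ x).le_opNorm (Pi.single i 1); rwa [hns, mul_one] at this
      have hd2 : ∀ i, ‖fderiv ℝ ψ x (Pi.single i 1)‖ ≤ 32 * L := fun i => by
        have := (fderiv ℝ ψ x).le_opNorm (Pi.single i 1); rw [hns, mul_one] at this
        have h7 := norm_fderiv_le_of_lipschitz ℝ (x₀ := x) hlip
        rw [Real.coe_toNNReal _ (by positivity)] at h7
        exact this.trans h7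
      have hb1 : ‖β0 x * (φ x - ψ x)‖ ≤ M * (φ x ^ 2 / L + 2 * L) := by
        rw [norm_mul]
        gcongr
        · exact hM0 x
        · refine (norm_sub_le _ _).trans ?_
          rw [Real.norm_eq_abs, Real.norm_eq_abs]
          linarith [hbd x]
      have hb2 : ∀ i ∈ (Finset.univ : Finset (Fin 3)), ‖β i x * (fderiv ℝ φ x (Pi.single i 1) - fderiv ℝ ψ x (Pi.single i 1))‖ ≤ M * (‖fderiv ℝ φ x‖ ^ 2 / L + 33 * L) := by
        intro i _
        rw [norm_mul]
        gcongr
        · exact hM i x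
        · refine (norm_sub_le _ _).trans ?_
          linarith [hd1 i, hd2 i]
      refine (norm_add_le_of_le hb1 (norm_sum_le_of_le _ hb2)).trans (le_of_eq ?_)
      simp; ring
    · simp only [G, Set.indicator_of_notMem hxN]
      rw [heq x hxN, hx hxN]
      simp
  have hmeas : AEStronglyMeasurable (fun x => β0 x * (φ x - ψ x) + ∑ i, β i x * (fderiv ℝ φ x (Pi.single i 1) - fderiv ℝ ψ x (Pi.single i 1))) volume := by
    apply Measurable.aestronglyMeasurable
    refine (hβ0.mul (hφ.continuous.measurable.sub hlip.continuous.measurable)).add (Finset.measurable_sum _ fun i _ => (hβ i).mul ?_)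
    exact (measurable_fderiv_apply_const ℝ φ _).sub (measurable_fderiv_apply_const ℝ ψ _)
  refine ⟨hGi.mono' hmeas hbound, ?_⟩
  rw [← Real.norm_eq_abs]
  refine (norm_integral_le_of_norm_le hGi hbound).trans ?_
  rw [integral_indicator hN, integral_const_mul, integral_add hGi0 hGi1, integral_add (h2.div_const _).integrableOn ((hD2.div_const _).const_mul 3).integrableOn,
    setIntegral_const, integral_const_mul, integral_div, integral_div, smul_eq_mul]
  have e1 : ∫ x in N, φ x ^ 2 ≤ ∫ x, φ x ^ 2 := setIntegral_le_integral h2 (Eventually.of_forall fun x => by positivity)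
  have e2 : ∫ x in N, ‖fderiv ℝ φ x‖ ^ 2 ≤ ∫ x, ‖fderiv ℝ φ x‖ ^ 2 := setIntegral_le_integral hD2 (Eventually.of_forall fun x => by positivity)
  have e3 : volume.real N * (101 * L) ≤ P / L ^ 2 * (101 * L) := by gcongr
  have e4 : P / L ^ 2 * (101 * L) = 101 * P / L := by field_simp
  have e5 : (∫ x in N, φ x ^ 2) / L + 3 * ((∫ x in N, ‖fderiv ℝ φ x‖ ^ 2) / L) ≤ 3 * P / L := by
    have : (∫ x in N, φ x ^ 2) / L + 3 * ((∫ x in N, ‖fderiv ℝ φ x‖ ^ 2) / L) = ((∫ x in N, φ x ^ 2) + 3 * (∫ x in N, ‖fderiv ℝ φ x‖ ^ 2)) / L := by field_simp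
    rw [this]
    gcongr
    linarith
  calc _ ≤ M * (3 * P / L + 101 * P / L) := by gcongr; linarith
    _ = _ := by field_simp; ring

end Part7

section Part8
open MeasureTheory Filter Topology Bornology
open scoped Matrix ENNReal NNReal

theorem moll_cpt (g : V3 → ℝ) (hg : Measurable g) (M : ℝ) (hM : ∀ x, |g x| ≤ M) (R : ℝ)
    (hR : ∀ x, g x ≠ 0 → ‖x‖ ≤ R) (δ : ℝ) (hδ : 0 < δ) :
    ∃ v : V3 → ℝ, ContDiff ℝ (⊤ : ℕ∞) v ∧ (∀ x, |v x| ≤ M) ∧ (∀ x, v x ≠ 0 → ‖x‖ ≤ R + 1) ∧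
      ∫ x, |v x - g x| ≤ δ := by
  have hM0 : 0 ≤ M := (abs_nonneg _).trans (hM 0)
  obtain ⟨ρ, h1, h2, h3, h4, h5, h6⟩ := moll_exists
  have hgi : LocallyIntegrable g := (locallyIntegrable_const M).mono hg.aestronglyMeasurable
    (Eventually.of_forall fun x => by simpa [abs_of_nonneg hM0] using hM x)
  let v : ℕ → V3 → ℝ := fun k x => ∫ t, g t * ρ k (x - t)
  have hvs : ∀ k x, v k x ≠ 0 → ‖x‖ ≤ R + 1 := by
    intro k x hx
    by_contra hcon
    push Not at hcon
    apply hx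
    have : ∀ t, g t * ρ k (x - t) = 0 := by
      intro t
      by_contra hne
      have hg0 := left_ne_zero_of_mul hne
      have hr0 := h5 k _ (right_ne_zero_of_mul hne)
      have h7 := hR t hg0
      have h8 : 1 / ((k : ℝ) + 1) ≤ 1 := by
        rw [div_le_one (by positivity)]; linarith [(Nat.cast_nonneg k : (0:ℝ) ≤ k)]
      have h9 : ‖x‖ ≤ ‖x - t‖ + ‖t‖ := by simpa using norm_add_le (x - t) t
      linarith
    simp [v, this]
  have hvM : ∀ k x, |v k x| ≤ M := fun k x => moll_bdd _ (h1 k) (h2 k) (h3 k) (h4 k) g M hM x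
  have hvc : ∀ k, ContDiff ℝ (⊤ : ℕ∞) (v k) := fun k => (moll_smooth _ (h1 k) (h2 k) g hgi).1
  have hlim : Tendsto (fun k => ∫ x, |v k x - g x|) atTop (𝓝 (∫ x : V3, (0 : ℝ))) := by
    apply tendsto_integral_of_dominated_convergence ((Metric.closedBall (0 : V3) (R + 1)).indicator fun _ => 2 * M)
    · intro k; exact ((hvc k).continuous.measurable.sub hg).norm.aestronglyMeasurable
    · rw [integrable_indicator_iff measurableSet_closedBall]
      exact integrableOn_const (isCompact_closedBall _ _).measure_lt_top.ne
    · intro k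
      refine Eventually.of_forall fun x => ?_
      by_cases hx : x ∈ Metric.closedBall (0 : V3) (R + 1)
      · rw [Set.indicator_of_mem hx]
        simp only [norm_abs_eq_norm] 
        refine (norm_sub_le _ _).trans ?_
        rw [Real.norm_eq_abs, Real.norm_eq_abs]; linarith [hvM k x, hM x]
      · rw [Set.indicator_of_notMem hx]
        rw [mem_closedBall_zero_iff, not_le] at hx
        have e1 : v k x = 0 := by by_contra h; linarith [hvs k x h]
        have e2 : g x = 0 := by by_contra h; linarith [hR x h]
        simp [e1, e2]
    · filter_upwards [h6 g hgi] with x hx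
      have : Tendsto (fun k => |v k x - g x|) atTop (𝓝 |g x - g x|) := (hx.sub_const _).abs
      simpa using this
  rw [integral_zero] at hlim
  obtain ⟨k, hk⟩ := (hlim.eventually (eventually_le_nhds hδ)).exists
  exact ⟨v k, hvc k, hvM k, hvs k, hk⟩

theorem norm_fderiv_le_sum (φ : V3 → ℝ) (x : V3) : ‖fderiv ℝ φ x‖ ^ 2 ≤ 3 * ∑ i, (fderiv ℝ φ x (Pi.single i 1)) ^ 2 := by
  have h : ‖fderiv ℝ φ x‖ ≤ ∑ i, |fderiv ℝ φ x (Pi.single i 1)| := by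
    apply ContinuousLinearMap.opNorm_le_bound _ (by positivity)
    intro v
    have hv : v = ∑ i, v i • (Pi.single i 1 : V3) := by
      ext j; simp [Finset.sum_apply, Pi.single_apply]
    conv_lhs => rw [hv]
    rw [map_sum, Finset.sum_mul]
    refine norm_sum_le_of_le _ fun i _ => ?_
    rw [map_smul, norm_smul, mul_comm]
    gcongr
    · exact le_rfl
    · exact norm_le_pi_norm v i
  have h2 := pow_le_pow_left₀ (norm_nonneg _) h 2
  refine h2.trans ?_
  have := sq_sum_le_card_mul_sum_sq (s := (Finset.univ : Finset (Fin 3))) (f := fun i => |fderiv ℝ φ x (Pi.single i 1)|)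
  simpa using this

end Part8

section Part9
open MeasureTheory Filter Topology Bornology
open scoped Matrix ENNReal NNReal

theorem core_test (χ : V3 → ℝ) (hχ : ContDiff ℝ (⊤ : ℕ∞) χ) (hχc : HasCompactSupport χ)
    (b : ℕ → Fin 3 → Fin 3 → V3 → ℝ) (hb : ∀ n i j, Measurable (b n i j)) (M : ℝ) (hbM : ∀ n i j x, |b n i j x| ≤ M)
    (H : ∀ L > 0, ∀ ε > 0, ∀ᶠ n in atTop, ∀ ψ : Fin 3 → V3 → ℝ, (∀ j, ContDiff ℝ (⊤ : ℕ∞) (ψ j)) → (∀ j x, |ψ j x| ≤ L) →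
      (∀ j x i, |fderiv ℝ (ψ j) x (Pi.single i 1)| ≤ L) →
      |∫ x, ∑ i, ∑ j, b n i j x * (fderiv ℝ χ x (Pi.single i 1) * ψ j x + χ x * fderiv ℝ (ψ j) x (Pi.single i 1))| ≤ ε)
    (φ : ℕ → Fin 3 → V3 → ℝ) (hφ : ∀ n j, ContDiff ℝ (⊤ : ℕ∞) (φ n j))
    (h2 : ∀ n j, Integrable (fun x => φ n j x ^ 2)) (hD2 : ∀ n j, Integrable (fun x => ‖fderiv ℝ (φ n j) x‖ ^ 2))
    (P : ℝ) (hP : ∀ᶠ n in atTop, ∀ j, 125 * ((∫ x, φ n j x ^ 2) + ∫ x, ‖fderiv ℝ (φ n j) x‖ ^ 2) ≤ P) :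
    Tendsto (fun n => ∫ x, ∑ i, ∑ j, b n i j x * (fderiv ℝ χ x (Pi.single i 1) * φ n j x + χ x * fderiv ℝ (φ n j) x (Pi.single i 1)))
      atTop (𝓝 0) := by
  have hM0 : 0 ≤ M := (abs_nonneg _).trans (hbM 0 0 0 0)
  have hdχ : ∀ i, Continuous fun x => fderiv ℝ χ x (Pi.single i 1) := fun i =>
    (hχ.continuous_fderiv (by simp)).clm_apply continuous_const
  have hdχc : ∀ i, HasCompactSupport fun x => fderiv ℝ χ x (Pi.single i 1) := fun i => hχc.fderiv_apply ℝ _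
  obtain ⟨C0, hC0⟩ := hχ.continuous.bounded_above_of_compact_support hχc
  choose C1 hC1 using fun i => (hdχ i).bounded_above_of_compact_support (hdχc i)
  set C := max C0 (∑ i, |C1 i|) with hC
  have hCn : 0 ≤ C := le_max_of_le_right (by positivity)
  have hχC : ∀ x, |χ x| ≤ C := fun x => (hC0 x).trans (le_max_left _ _)
  have hdχC : ∀ i x, |fderiv ℝ χ x (Pi.single i 1)| ≤ C := fun i x => by
    refine (hC1 i x).trans ((le_abs_self _).trans (le_max_of_le_right ?_))
    exact Finset.single_le_sum (f := fun i => |C1 i|) (fun i _ => abs_nonneg _) (Finset.mem_univ i)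
  set M' := 3 * (M * C) with hM'
  have hM'0 : 0 ≤ M' := by positivity
  rw [Metric.tendsto_nhds]
  intro ε hε
  set P' := max P 0
  have hP'0 : 0 ≤ P' := le_max_right _ _
  obtain ⟨L, hL, hLe⟩ : ∃ L : ℝ, 0 < L ∧ 3 * (104 * M' * P' / L) ≤ ε / 3 := by
    refine ⟨3 * (104 * M' * P') * 3 / ε + 1, by positivity, ?_⟩
    rw [← mul_div_assoc, div_le_iff₀ (by positivity)]
    have : ε / 3 * (3 * (104 * M' * P') * 3 / ε + 1) = 3 * (104 * M' * P') + ε / 3 := by field_simp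
    rw [this]; linarith
  filter_upwards [hP, H (32 * L) (by positivity) (ε / 3) (by positivity)] with n hPn hHn
  choose ψ hψlip hψL hψ using fun j => trunc_test (φ n j) ((hφ n j).of_le (by simp)) (h2 n j) (hD2 n j) P' ((hPn j).trans (le_max_left _ _)) L hL
  have hψd : ∀ j x i, |fderiv ℝ (ψ j) x (Pi.single i 1)| ≤ 32 * L := fun j x i => by
    have := (fderiv ℝ (ψ j) x).le_opNorm (Pi.single i 1)
    rw [Pi.norm_single, norm_one, mul_one] at this
    have h7 := norm_fderiv_le_of_lipschitz ℝ (x₀ := x) (hψlip j)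
    rw [Real.coe_toNNReal _ (by positivity)] at h7
    exact this.trans h7
  have hlt := lip_test χ hχ hχc (b n) (hb n) M (hbM n) L (32 * L).toNNReal (ε / 3) (by
    intro ψ' a1 a2 a3
    rw [Real.coe_toNNReal _ (by positivity)] at a3
    exact hHn ψ' a1 (fun j x => (a2 j x).trans (by linarith)) a3) ψ hψlip hψL
  have hE : ∀ j, _ := fun j => hψ j M' (fun x => ∑ i, b n i j x * fderiv ℝ χ x (Pi.single i 1)) (fun i x => b n i j x * χ x)
    (Finset.measurable_sum _ fun i _ => (hb n i j).mul (hdχ i).measurable) (fun i => (hb n i j).mul hχ.continuous.measurable)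
    (fun x => by
      have : ∀ i ∈ (Finset.univ : Finset (Fin 3)), ‖b n i j x * fderiv ℝ χ x (Pi.single i 1)‖ ≤ M * C := fun i _ => by
        rw [norm_mul]; exact mul_le_mul (hbM n i j x) (hdχC i x) (norm_nonneg _) hM0
      refine (norm_sum_le_of_le _ this).trans ?_
      simp [hM'])
    (fun i x => by
      rw [abs_mul]
      refine (mul_le_mul (hbM n i j x) (hχC x) (abs_nonneg _) hM0).trans ?_
      rw [hM']; nlinarith [mul_nonneg hM0 hCn])
  have hIψ : Integrable (fun x => ∑ i, ∑ j, b n i j x * (fderiv ℝ χ x (Pi.single i 1) * ψ j x + χ x * fderiv ℝ (ψ j) x (Pi.single i 1))) := by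
    refine integrable_finsetSum _ fun i _ => integrable_finsetSum _ fun j _ => ?_
    have hdom : Integrable (fun x => M * (|fderiv ℝ χ x (Pi.single i 1)| * L + |χ x| * (32 * L))) := by
      refine Integrable.const_mul (Integrable.add ?_ ?_) _
      · exact (((hdχ i).integrable_of_hasCompactSupport (hdχc i)).abs).mul_const _
      · exact ((hχ.continuous.integrable_of_hasCompactSupport hχc).abs).mul_const _
    refine hdom.mono' (Measurable.aestronglyMeasurable ?_) (Eventually.of_forall fun x => ?_)
    · exact (hb n i j).mul (((hdχ i).measurable.mul (hψlip j).continuous.measurable).add (hχ.continuous.measurable.mul (measurable_fderiv_apply_const ℝ _ _)))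
    · rw [norm_mul]
      gcongr
      · exact hbM n i j x
      · refine (norm_add_le _ _).trans ?_
        rw [norm_mul, norm_mul]
        gcongr
        · exact le_rfl
        · exact hψL j x
        · exact le_rfl
        · exact hψd j x i
  have hsplit : (∫ x, ∑ i, ∑ j, b n i j x * (fderiv ℝ χ x (Pi.single i 1) * φ n j x + χ x * fderiv ℝ (φ n j) x (Pi.single i 1)))
      = (∫ x, ∑ i, ∑ j, b n i j x * (fderiv ℝ χ x (Pi.single i 1) * ψ j x + χ x * fderiv ℝ (ψ j) x (Pi.single i 1)))
       + ∑ j, ∫ x, ((∑ i, b n i j x * fderiv ℝ χ x (Pi.single i 1)) * (φ n j x - ψ j x) + ∑ i, (b n i j x * χ x) * (fderiv ℝ (φ n j) x (Pi.single i 1) - fderiv ℝ (ψ j) x (Pi.single i 1))) := by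
    rw [← integral_finsetSum _ (fun j _ => (hE j).1), ← integral_add hIψ (integrable_finsetSum _ (fun j _ => (hE j).1))]
    congr 1; ext x
    rw [Finset.sum_comm, Finset.sum_comm (f := fun i j => b n i j x * (fderiv ℝ χ x (Pi.single i 1) * ψ j x + χ x * fderiv ℝ (ψ j) x (Pi.single i 1))), ← Finset.sum_add_distrib]
    refine Finset.sum_congr rfl fun j _ => ?_
    rw [Finset.sum_mul, ← Finset.sum_add_distrib, ← Finset.sum_add_distrib]
    refine Finset.sum_congr rfl fun i _ => ?_
    ring
  rw [dist_zero_right, hsplit]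
  have hs : ‖∑ j, ∫ x, ((∑ i, b n i j x * fderiv ℝ χ x (Pi.single i 1)) * (φ n j x - ψ j x) + ∑ i, (b n i j x * χ x) * (fderiv ℝ (φ n j) x (Pi.single i 1) - fderiv ℝ (ψ j) x (Pi.single i 1)))‖ ≤ ε / 3 := by
    refine (norm_sum_le_of_le _ (fun j _ => (hE j).2)).trans ?_
    simpa using hLe
  have := norm_add_le_of_le hlt hs
  linarith

end Part9

section Part10
open MeasureTheory Filter Topology Bornology
open scoped Matrix ENNReal NNReal

theorem int_bdd_cpt (f : V3 → ℝ) (hf : Measurable f) (C : ℝ) (hC : ∀ x, |f x| ≤ C) (R : ℝ)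
    (hR : ∀ x, f x ≠ 0 → ‖x‖ ≤ R) : Integrable f ∧ ∫ x, |f x| ≤ C * volume.real (Metric.closedBall (0 : V3) R) := by
  have hi : Integrable ((Metric.closedBall (0 : V3) R).indicator fun _ => C) := by
    rw [integrable_indicator_iff measurableSet_closedBall]
    exact integrableOn_const (isCompact_closedBall _ _).measure_lt_top.ne
  have hb : ∀ x, |f x| ≤ (Metric.closedBall (0 : V3) R).indicator (fun _ => C) x := by
    intro x
    by_cases hx : x ∈ Metric.closedBall (0 : V3) R
    · rw [Set.indicator_of_mem hx]; exact hC x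
    · rw [Set.indicator_of_notMem hx]
      rw [mem_closedBall_zero_iff] at hx
      have : f x = 0 := by by_contra h; exact hx (hR x h)
      simp [this]
  have hfi : Integrable f := hi.mono' hf.aestronglyMeasurable (Eventually.of_forall hb)
  refine ⟨hfi, (integral_mono hfi.abs hi hb).trans (le_of_eq ?_)⟩
  rw [integral_indicator measurableSet_closedBall, setIntegral_const, smul_eq_mul, mul_comm]

theorem core (χ : V3 → ℝ) (hχ : ContDiff ℝ (⊤ : ℕ∞) χ) (hχc : HasCompactSupport χ) (hχ1 : ∀ x, |χ x| ≤ 1)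
    (b : ℕ → Fin 3 → Fin 3 → V3 → ℝ) (hb : ∀ n i j, Measurable (b n i j)) (M : ℝ) (hbM : ∀ n i j x, |b n i j x| ≤ M)
    (u : ℕ → V3 → ℝ) (hu : ∀ n, Measurable (u n)) (huM : ∀ n x, |u n x| ≤ M)
    (H : ∀ L > 0, ∀ ε > 0, ∀ᶠ n in atTop, ∀ ψ : Fin 3 → V3 → ℝ, (∀ j, ContDiff ℝ (⊤ : ℕ∞) (ψ j)) → (∀ j x, |ψ j x| ≤ L) →
      (∀ j x i, |fderiv ℝ (ψ j) x (Pi.single i 1)| ≤ L) →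
      |∫ x, ∑ i, ∑ j, b n i j x * (fderiv ℝ χ x (Pi.single i 1) * ψ j x + χ x * fderiv ℝ (ψ j) x (Pi.single i 1))| ≤ ε)
    (hw : ∀ h : V3 → ℝ, Continuous h → (∃ C : ℝ, ∀ x, |h x| ≤ C) →
      Tendsto (fun n => ∫ x, (χ x * u n x) * h x) atTop (𝓝 0))
    (η : ℝ) (hη0 : 0 ≤ η)
    (hη : ∀ᶠ n in atTop, ∀ i j, ∫ x, (χ x * (b n i j x - if i = j then u n x else 0)) ^ 2 ≤ η) :
    ∀ ε > 0, ∀ᶠ n in atTop, ∫ x, (χ x * u n x) ^ 2 ≤ 81 * η + ε := by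
  have hM0 : 0 ≤ M := (abs_nonneg _).trans (huM 0 0)
  obtain ⟨R, hR⟩ : ∃ R : ℝ, ∀ x, x ∈ tsupport χ → ‖x‖ ≤ R := by
    obtain ⟨R, hR⟩ := hχc.isBounded.exists_norm_le
    exact ⟨R, hR⟩
  have hR1 : ∀ x, χ x ≠ 0 → ‖x‖ ≤ R := fun x hx => hR x (subset_tsupport _ hx)
  have hdχ : ∀ i, Continuous fun x => fderiv ℝ χ x (Pi.single i 1) := fun i =>
    (hχ.continuous_fderiv (by simp)).clm_apply continuous_const
  have hdχc : ∀ i, HasCompactSupport fun x => fderiv ℝ χ x (Pi.single i 1) := fun i => hχc.fderiv_apply ℝ _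
  set g : ℕ → V3 → ℝ := fun n x => χ x * u n x with hgdef
  have hgm : ∀ n, Measurable (g n) := fun n => hχ.continuous.measurable.mul (hu n)
  have hgM : ∀ n x, |g n x| ≤ M := fun n x => by
    simp only [hgdef, abs_mul]
    calc _ ≤ 1 * M := mul_le_mul (hχ1 x) (huM n x) (abs_nonneg _) zero_le_one
      _ = M := one_mul M
  have hgR : ∀ n x, g n x ≠ 0 → ‖x‖ ≤ R := fun n x hx => hR1 x (left_ne_zero_of_mul hx)
  choose v hvs hvM hvR hvg using fun n : ℕ => moll_cpt (g n) (hgm n) M (hgM n) R (hgR n) (1 / ((n : ℝ) + 1)) (by positivity)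
  have hvm : ∀ n, Measurable (v n) := fun n => (hvs n).continuous.measurable
  have hgR' : ∀ n x, g n x ≠ 0 → ‖x‖ ≤ R + 1 := fun n x hx => (hgR n x hx).trans (by linarith)
  set Vol := volume.real (Metric.closedBall (0 : V3) (R + 1)) with hVol
  have hvi : ∀ n, Integrable (v n) ∧ ∫ x, |v n x| ≤ M * Vol := fun n => int_bdd_cpt (v n) (hvm n) M (hvM n) (R + 1) (hvR n)
  have hgi : ∀ n, Integrable (g n) := fun n => (int_bdd_cpt (g n) (hgm n) M (hgM n) (R + 1) (hgR' n)).1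
  have hsqM : ∀ t : ℝ, |t| ≤ M → |t ^ 2| ≤ M ^ 2 := fun t ht => by
    rw [abs_pow]; exact pow_le_pow_left₀ (abs_nonneg _) ht 2
  have hv2 : ∀ n, Integrable (fun x => v n x ^ 2) ∧ ∫ x, |v n x ^ 2| ≤ M ^ 2 * Vol := fun n =>
    int_bdd_cpt _ ((hvm n).pow_const 2) (M ^ 2) (fun x => hsqM _ (hvM n x)) (R + 1) (fun x hx => hvR n x (by rintro h; simp [h] at hx))
  have hg2 : ∀ n, Integrable (fun x => g n x ^ 2) ∧ ∫ x, |g n x ^ 2| ≤ M ^ 2 * Vol := fun n =>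
    int_bdd_cpt _ ((hgm n).pow_const 2) (M ^ 2) (fun x => hsqM _ (hgM n x)) (R + 1) (fun x hx => hgR' n x (by rintro h; simp [h] at hx))
  have hv2b : ∀ n, ∫ x, v n x ^ 2 ≤ M ^ 2 * Vol := fun n => by simpa only [abs_pow, sq_abs] using (hv2 n).2
  have hg2b : ∀ n, ∫ x, g n x ^ 2 ≤ M ^ 2 * Vol := fun n => by simpa only [abs_pow, sq_abs] using (hg2 n).2
  have hvcs : ∀ n, HasCompactSupport (v n) := fun n =>
    HasCompactSupport.intro (isCompact_closedBall (0 : V3) (R + 1)) fun x hx => by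
      by_contra h; exact hx (by rw [mem_closedBall_zero_iff]; exact hvR n x h)
  -- error by replacing g by v against a bounded function
  have herr : ∀ n (h : V3 → ℝ) (C : ℝ), Measurable h → (∀ x, |h x| ≤ C) →
      Integrable (fun x => (v n x - g n x) * h x) ∧ |∫ x, (v n x - g n x) * h x| ≤ C * (1 / ((n : ℝ) + 1)) := by
    intro n h C hh hC
    have hC0 : 0 ≤ C := (abs_nonneg _).trans (hC 0)
    have hi : Integrable (fun x => C * |v n x - g n x|) := (((hvi n).1.sub (hgi n)).abs).const_mul C
    have hbd : ∀ x, ‖(v n x - g n x) * h x‖ ≤ C * |v n x - g n x| := fun x => by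
      rw [norm_mul, mul_comm]
      exact mul_le_mul_of_nonneg_right (hC x) (abs_nonneg _)
    refine ⟨hi.mono' (((hvm n).sub (hgm n)).mul hh).aestronglyMeasurable (Eventually.of_forall hbd), ?_⟩
    rw [← Real.norm_eq_abs]
    refine (norm_integral_le_of_norm_le hi (Eventually.of_forall hbd)).trans ?_
    rw [integral_const_mul]
    gcongr
    exact hvg n
  have h1n : Tendsto (fun n : ℕ => 1 / ((n : ℝ) + 1)) atTop (𝓝 0) := tendsto_one_div_add_atTop_nhds_zero_nat
  have hw' : ∀ h : V3 → ℝ, Continuous h → (∃ C : ℝ, ∀ x, |h x| ≤ C) →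
      Tendsto (fun n => ∫ x, v n x * h x) atTop (𝓝 0) := by
    intro h hh ⟨C, hC⟩
    have h1 := hw h hh ⟨C, hC⟩
    have h2 : Tendsto (fun n => ∫ x, (v n x - g n x) * h x) atTop (𝓝 0) := by
      apply squeeze_zero_norm (fun n => (herr n h C hh.measurable hC).2)
      simpa using h1n.const_mul C
    have h3 := h1.add h2
    rw [add_zero] at h3
    refine h3.congr fun n => ?_
    have hgh : Integrable (fun x => g n x * h x) := (hgi n).mul_bdd hh.aestronglyMeasurable (Eventually.of_forall hC)
    rw [← integral_add hgh (herr n h C hh.measurable hC).1]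
    congr 1; ext x; ring
  obtain ⟨f, φ, hφs, hfc, hdiv, hD, hf2, hf0, hφ2, hφ0⟩ := bessel_seq v hvs hvcs (M * Vol) (M ^ 2 * Vol) (fun n => (hvi n).2) hv2b hw'
  have hdφc : ∀ n i j, Continuous fun x => fderiv ℝ (φ n j) x (Pi.single i 1) := fun n i j =>
    ((hφs n j).continuous_fderiv (by simp)).clm_apply continuous_const
  have hsumi : ∀ n j, Integrable (fun x => 3 * ∑ i, (fderiv ℝ (φ n j) x (Pi.single i 1)) ^ 2) := fun n j =>
    (integrable_finsetSum _ fun i _ => (hD n i j).1).const_mul 3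
  have hDi : ∀ n j, Integrable (fun x => ‖fderiv ℝ (φ n j) x‖ ^ 2) := fun n j =>
    (hsumi n j).mono' (((hφs n j).continuous_fderiv (by simp)).norm.pow 2).aestronglyMeasurable
      (Eventually.of_forall fun x => by
        rw [Real.norm_eq_abs, abs_of_nonneg (by positivity)]; exact norm_fderiv_le_sum _ x)
  have hDb : ∀ n j, ∫ x, ‖fderiv ℝ (φ n j) x‖ ^ 2 ≤ 9 * (M ^ 2 * Vol) := fun n j => by
    refine (integral_mono (hDi n j) (hsumi n j) (norm_fderiv_le_sum _)).trans ?_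
    rw [integral_const_mul, integral_finsetSum _ fun i _ => (hD n i j).1]
    have : ∑ i, ∫ x, (fderiv ℝ (φ n j) x (Pi.single i 1)) ^ 2 ≤ ∑ i : Fin 3, M ^ 2 * Vol :=
      Finset.sum_le_sum fun i _ => ((hD n i j).2.trans (hv2b n))
    simp at this; linarith
  have hX := core_test χ hχ hχc b hb M hbM H φ hφs hφ2 hDi (125 * (1 + 9 * (M ^ 2 * Vol))) (by
    have : ∀ᶠ n in atTop, ∀ j, ∫ x, φ n j x ^ 2 ≤ 1 := by
      rw [eventually_all]; exact fun j => (hφ0 j).eventually (eventually_le_nhds zero_lt_one)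
    filter_upwards [this] with n hn j
    linarith [hn j, hDb n j])
  -- first term
  have hbd2 : ∀ n i j, Integrable (fun x => (b n i j x * fderiv ℝ χ x (Pi.single i 1)) ^ 2) ∧
      ∫ x, (b n i j x * fderiv ℝ χ x (Pi.single i 1)) ^ 2 ≤ ∫ x, (M * fderiv ℝ χ x (Pi.single i 1)) ^ 2 := by
    intro n i j
    have hi : Integrable (fun x => (M * fderiv ℝ χ x (Pi.single i 1)) ^ 2) := by
      apply Continuous.integrable_of_hasCompactSupport
      · exact (continuous_const.mul (hdχ i)).pow 2
      · exact (hdχc i).comp_left (g := fun t : ℝ => (M * t) ^ 2) (by simp)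
    have hle : ∀ x, (b n i j x * fderiv ℝ χ x (Pi.single i 1)) ^ 2 ≤ (M * fderiv ℝ χ x (Pi.single i 1)) ^ 2 := fun x => by
      rw [mul_pow, mul_pow]
      refine mul_le_mul_of_nonneg_right ?_ (sq_nonneg _)
      rw [← sq_abs]
      exact pow_le_pow_left₀ (abs_nonneg _) (hbM n i j x) 2
    have hi2 : Integrable (fun x => (b n i j x * fderiv ℝ χ x (Pi.single i 1)) ^ 2) :=
      hi.mono' (((hb n i j).mul (hdχ i).measurable).pow_const 2).aestronglyMeasurable
        (Eventually.of_forall fun x => by rw [Real.norm_eq_abs, abs_of_nonneg (by positivity)]; exact hle x)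
    exact ⟨hi2, integral_mono hi2 hi hle⟩
  have hcsA : ∀ n i j, _ := fun n i j => cs_int (μ := volume) (f := fun x => b n i j x * fderiv ℝ χ x (Pi.single i 1)) ((hb n i j).mul (hdχ i).measurable).aestronglyMeasurable
    (hφs n j).continuous.aestronglyMeasurable (hbd2 n i j).1 (hφ2 n j)
  have hA : Tendsto (fun n => ∑ i, ∑ j, ∫ x, (b n i j x * fderiv ℝ χ x (Pi.single i 1)) * φ n j x) atTop (𝓝 0) := by
    have : Tendsto (fun n => ∑ i : Fin 3, ∑ j : Fin 3, ∫ x, (b n i j x * fderiv ℝ χ x (Pi.single i 1)) * φ n j x) atTop (𝓝 (∑ i : Fin 3, ∑ j : Fin 3, (0 : ℝ))) := by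
      refine tendsto_finsetSum _ fun i _ => tendsto_finsetSum _ fun j _ => ?_
      apply squeeze_zero_norm (a := fun n => Real.sqrt (∫ x, (M * fderiv ℝ χ x (Pi.single i 1)) ^ 2) * Real.sqrt (∫ x, φ n j x ^ 2))
      · intro n
        refine (norm_integral_le_integral_norm _).trans ((hcsA n i j).2.trans ?_)
        exact mul_le_mul_of_nonneg_right (Real.sqrt_le_sqrt (hbd2 n i j).2) (Real.sqrt_nonneg _)
      · have := ((Real.continuous_sqrt.tendsto 0).comp (hφ0 j)).const_mul (Real.sqrt (∫ x, (M * fderiv ℝ χ x (Pi.single i 1)) ^ 2))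
        simpa using this
    simpa using this
  -- the term with g f
  have hcsG : ∀ n, _ := fun n => cs_int (μ := volume) (hgm n).aestronglyMeasurable
    (hfc n).aestronglyMeasurable (hg2 n).1 (hf2 n)
  have hG : Tendsto (fun n => ∫ x, g n x * f n x) atTop (𝓝 0) := by
    apply squeeze_zero_norm (a := fun n => Real.sqrt (M ^ 2 * Vol) * Real.sqrt (∫ x, f n x ^ 2))
    · intro n
      refine (norm_integral_le_integral_norm _).trans ((hcsG n).2.trans ?_)
      gcongr
      exact hg2b n
    · have := ((Real.continuous_sqrt.tendsto 0).comp hf0).const_mul (Real.sqrt (M ^ 2 * Vol))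
      simpa using this
  -- the coupling term
  let d : ℕ → Fin 3 → Fin 3 → V3 → ℝ := fun n i j x => χ x * (b n i j x - if i = j then u n x else 0)
  have hdm : ∀ n i j, Measurable (d n i j) := fun n i j => by
    refine hχ.continuous.measurable.mul ((hb n i j).sub ?_)
    by_cases hij : i = j
    · simpa [hij] using hu n
    · simp [hij]
  have hd2 : ∀ n i j, Integrable (fun x => d n i j x ^ 2) := fun n i j => by
    refine (int_bdd_cpt _ ((hdm n i j).pow_const 2) ((2 * M) ^ 2) (fun x => ?_) R (fun x hx => hR1 x (by
      rintro h; simp [d, h] at hx))).1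
    rw [abs_pow]
    refine pow_le_pow_left₀ (abs_nonneg _) ?_ 2
    simp only [d, abs_mul]
    have h1 : |b n i j x - if i = j then u n x else 0| ≤ 2 * M := by
      refine (abs_sub _ _).trans ?_
      have := hbM n i j x
      have := huM n x
      split_ifs
      · linarith
      · simp; linarith
    calc _ ≤ 1 * (2 * M) := mul_le_mul (hχ1 x) h1 (abs_nonneg _) zero_le_one
      _ = _ := one_mul _
  have hcsD : ∀ n i j, _ := fun n i j => cs_int (μ := volume) (hdm n i j).aestronglyMeasurable
    (hdφc n i j).aestronglyMeasurable (hd2 n i j) (hD n i j).1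
  have hgv : ∀ n, Integrable (fun x => g n x * v n x) := fun n =>
    (cs_int (μ := volume) (hgm n).aestronglyMeasurable (hvm n).aestronglyMeasurable (hg2 n).1 (hv2 n).1).1
  have hid : ∀ n, (∫ x, ∑ i, ∑ j, b n i j x * (fderiv ℝ χ x (Pi.single i 1) * φ n j x + χ x * fderiv ℝ (φ n j) x (Pi.single i 1)))
      = (∑ i, ∑ j, ∫ x, (b n i j x * fderiv ℝ χ x (Pi.single i 1)) * φ n j x)
        + (∑ i, ∑ j, ∫ x, d n i j x * fderiv ℝ (φ n j) x (Pi.single i 1))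
        + ((∫ x, g n x * v n x) - ∫ x, g n x * f n x) := by
    intro n
    have i1 : ∀ i, Integrable (fun x => ∑ j, (b n i j x * fderiv ℝ χ x (Pi.single i 1)) * φ n j x) := fun i =>
      integrable_finsetSum _ fun j _ => (hcsA n i j).1
    have i2 : ∀ i, Integrable (fun x => ∑ j, d n i j x * fderiv ℝ (φ n j) x (Pi.single i 1)) := fun i =>
      integrable_finsetSum _ fun j _ => (hcsD n i j).1
    have e1 : (∑ i, ∑ j, ∫ x, (b n i j x * fderiv ℝ χ x (Pi.single i 1)) * φ n j x) = ∫ x, ∑ i, ∑ j, (b n i j x * fderiv ℝ χ x (Pi.single i 1)) * φ n j x := by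
      rw [integral_finsetSum _ fun i _ => i1 i]
      exact Finset.sum_congr rfl fun i _ => (integral_finsetSum _ fun j _ => (hcsA n i j).1).symm
    have e2 : (∑ i, ∑ j, ∫ x, d n i j x * fderiv ℝ (φ n j) x (Pi.single i 1)) = ∫ x, ∑ i, ∑ j, d n i j x * fderiv ℝ (φ n j) x (Pi.single i 1) := by
      rw [integral_finsetSum _ fun i _ => i2 i]
      exact Finset.sum_congr rfl fun i _ => (integral_finsetSum _ fun j _ => (hcsD n i j).1).symm
    have i3 : Integrable (fun x => (∑ i, ∑ j, (b n i j x * fderiv ℝ χ x (Pi.single i 1)) * φ n j x) + ∑ i, ∑ j, d n i j x * fderiv ℝ (φ n j) x (Pi.single i 1)) :=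
      (integrable_finsetSum _ fun i _ => i1 i).add (integrable_finsetSum _ fun i _ => i2 i)
    have i4 : Integrable (fun x => g n x * v n x - g n x * f n x) := (hgv n).sub (hcsG n).1
    rw [e1, e2, ← integral_sub (hgv n) (hcsG n).1, ← integral_add (integrable_finsetSum _ fun i _ => i1 i) (integrable_finsetSum _ fun i _ => i2 i),
      ← integral_add i3 i4]
    congr 1; ext x
    have hdx := hdiv n x
    have : g n x * v n x - g n x * f n x = χ x * u n x * ∑ j, fderiv ℝ (φ n j) x (Pi.single j 1) := by
      rw [hdx]; simp only [hgdef]; ring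
    rw [this]
    simp only [Fin.sum_univ_three, d]
    simp
    ring
  have hlim : Tendsto (fun n : ℕ => |∫ x, ∑ i, ∑ j, b n i j x * (fderiv ℝ χ x (Pi.single i 1) * φ n j x + χ x * fderiv ℝ (φ n j) x (Pi.single i 1))|
      + |∑ i, ∑ j, ∫ x, (b n i j x * fderiv ℝ χ x (Pi.single i 1)) * φ n j x| + |∫ x, g n x * f n x| + 2 * (M * (1 / ((n : ℝ) + 1)))) atTop (𝓝 0) := by
    have := ((hX.abs.add hA.abs).add hG.abs).add ((h1n.const_mul M).const_mul 2)
    simpa using this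
  intro ε hε
  filter_upwards [hη, hlim.eventually (eventually_le_nhds (by positivity : (0:ℝ) < ε / 2))] with n hηn hn
  have hDn : |∑ i, ∑ j, ∫ x, d n i j x * fderiv ℝ (φ n j) x (Pi.single i 1)| ≤ 9 * (Real.sqrt η * Real.sqrt (∫ x, v n x ^ 2)) := by
    have h1 : ∀ i ∈ (Finset.univ : Finset (Fin 3)), ∀ j ∈ (Finset.univ : Finset (Fin 3)), ‖∫ x, d n i j x * fderiv ℝ (φ n j) x (Pi.single i 1)‖ ≤ Real.sqrt η * Real.sqrt (∫ x, v n x ^ 2) := by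
      intro i _ j _
      refine (norm_integral_le_integral_norm _).trans ((hcsD n i j).2.trans ?_)
      exact mul_le_mul (Real.sqrt_le_sqrt (hηn i j)) (Real.sqrt_le_sqrt (hD n i j).2) (Real.sqrt_nonneg _) (Real.sqrt_nonneg _)
    have := norm_sum_le_of_le _ fun i hi => norm_sum_le_of_le _ (h1 i hi)
    simp at this
    linarith
  have hgv1 := (herr n (v n) M (hvm n) (hvM n)).2
  have hgg1 := (herr n (g n) M (hgm n) (hgM n)).2
  have ev : ∫ x, (v n x - g n x) * v n x = (∫ x, v n x ^ 2) - ∫ x, g n x * v n x := by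
    rw [← integral_sub (hv2 n).1 (hgv n)]; congr 1; ext x; ring
  have eg : ∫ x, (v n x - g n x) * g n x = (∫ x, g n x * v n x) - ∫ x, g n x ^ 2 := by
    rw [← integral_sub (hgv n) (hg2 n).1]; congr 1; ext x; ring
  rw [ev] at hgv1
  rw [eg] at hgg1
  have hidn := hid n
  have hs0 : 0 ≤ ∫ x, v n x ^ 2 := by positivity
  have hsq := Real.sq_sqrt hs0
  have hsη := Real.sq_sqrt hη0
  have hamgm : 9 * (Real.sqrt η * Real.sqrt (∫ x, v n x ^ 2)) ≤ (81 * η + ∫ x, v n x ^ 2) / 2 := by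
    nlinarith [sq_nonneg (9 * Real.sqrt η - Real.sqrt (∫ x, v n x ^ 2))]
  rw [abs_le] at hgv1 hgg1 hDn
  have hx1 := le_abs_self (∫ x, ∑ i, ∑ j, b n i j x * (fderiv ℝ χ x (Pi.single i 1) * φ n j x + χ x * fderiv ℝ (φ n j) x (Pi.single i 1)))
  have hx2 := neg_abs_le (∑ i, ∑ j, ∫ x, (b n i j x * fderiv ℝ χ x (Pi.single i 1)) * φ n j x)
  have hx3 := le_abs_self (∫ x, g n x * f n x)
  have hp1 := abs_nonneg (∫ x, ∑ i, ∑ j, b n i j x * (fderiv ℝ χ x (Pi.single i 1) * φ n j x + χ x * fderiv ℝ (φ n j) x (Pi.single i 1)))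
  have hp2 := abs_nonneg (∑ i, ∑ j, ∫ x, (b n i j x * fderiv ℝ χ x (Pi.single i 1)) * φ n j x)
  have hp3 := abs_nonneg (∫ x, g n x * f n x)
  linarith [hgv1.1, hgv1.2, hgg1.1, hgg1.2, hDn.1, hDn.2]

end Part10

section Part11
open MeasureTheory Filter Topology Bornology
open scoped Matrix ENNReal NNReal

theorem left_inv_exists {l m : ℕ} (A : Fin 3 → Matrix (Fin l) (Fin m) ℝ) (v0 : Fin m → ℝ) (hv0 : v0 ∉ waveCone A) :
    ∃ B : Matrix (Fin 3) (Fin l) ℝ, ∀ i j, (B *ᵥ (A i *ᵥ v0)) j = if i = j then 1 else 0 := by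
  let F : V3 →ₗ[ℝ] (Fin l → ℝ) := ∑ i, (LinearMap.proj i).smulRight (A i *ᵥ v0)
  have hF : ∀ ξ, F ξ = (∑ i : Fin 3, ξ i • A i) *ᵥ v0 := by
    intro ξ
    simp only [F, LinearMap.sum_apply, LinearMap.smulRight_apply, LinearMap.proj_apply]
    rw [Matrix.sum_mulVec]
    simp only [Matrix.smul_mulVec]
  have hker : LinearMap.ker F = ⊥ := by
    rw [LinearMap.ker_eq_bot']
    intro ξ hξ
    by_contra hne
    exact hv0 ⟨ξ, hne, by rw [← hF]; exact hξ⟩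
  obtain ⟨g, hg⟩ := LinearMap.exists_leftInverse_of_injective F hker
  refine ⟨LinearMap.toMatrix' g, fun i j => ?_⟩
  have h1 : F (Pi.single i 1) = A i *ᵥ v0 := by
    rw [hF]; congr 1
    simp [Pi.single_apply]
  rw [LinearMap.toMatrix'_mulVec, ← h1]
  have := LinearMap.congr_fun hg (Pi.single i 1)
  simp only [LinearMap.comp_apply, LinearMap.id_apply] at this
  rw [this]
  simp [Pi.single_apply, eq_comm]

theorem dot_bound {m : ℕ} (a x : Fin m → ℝ) (M : ℝ) (hx : ∀ k, |x k| ≤ M) : |a ⬝ᵥ x| ≤ (∑ k, |a k|) * M := by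
  rw [dotProduct, Finset.sum_mul]
  refine (Finset.abs_sum_le_sum_abs _ _).trans (Finset.sum_le_sum fun k _ => ?_)
  rw [abs_mul]
  exact mul_le_mul_of_nonneg_left (hx k) (abs_nonneg _)

theorem dot_measurable {m : ℕ} (a : Fin m → ℝ) (D : V3 → Fin m → ℝ) (hD : Measurable D) : Measurable (fun x => a ⬝ᵥ D x) := by
  unfold dotProduct
  exact Finset.measurable_sum _ fun k _ => ((measurable_pi_apply k).comp hD).const_mul _

theorem theta_deriv {l : ℕ} (B : Matrix (Fin 3) (Fin l) ℝ) (χ : V3 → ℝ) (ψ : Fin 3 → V3 → ℝ)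
    (hχ : ContDiff ℝ (⊤ : ℕ∞) χ) (hψ : ∀ j, ContDiff ℝ (⊤ : ℕ∞) (ψ j)) :
    ContDiff ℝ (⊤ : ℕ∞) (fun x (p : Fin l) => ∑ j, B j p * (χ x * ψ j x)) ∧
    ∀ x i p, fderiv ℝ (fun x (p : Fin l) => ∑ j, B j p * (χ x * ψ j x)) x (Pi.single i 1) p =
      ∑ j, B j p * (fderiv ℝ χ x (Pi.single i 1) * ψ j x + χ x * fderiv ℝ (ψ j) x (Pi.single i 1)) := by
  have h1 : ContDiff ℝ (⊤ : ℕ∞) (fun x (p : Fin l) => ∑ j, B j p * (χ x * ψ j x)) :=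
    contDiff_pi.2 fun p => ContDiff.sum fun j _ => contDiff_const.mul (hχ.mul (hψ j))
  refine ⟨h1, fun x i p => ?_⟩
  have hχx := (hχ.differentiable (by simp) x).hasFDerivAt
  have hψx := fun j => ((hψ j).differentiable (by simp) x).hasFDerivAt
  have h2 : HasFDerivAt (fun x => fun (p : Fin l) => ∑ j, B j p * (χ x * ψ j x))
      (ContinuousLinearMap.pi fun p => ∑ j, B j p • (χ x • fderiv ℝ (ψ j) x + ψ j x • fderiv ℝ χ x)) x := by
    rw [hasFDerivAt_pi]
    intro p
    exact HasFDerivAt.fun_sum fun j _ => (hχx.mul (hψx j)).const_mul (B j p)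
  rw [h2.fderiv]
  simp only [ContinuousLinearMap.coe_pi', ContinuousLinearMap.sum_apply, ContinuousLinearMap.smul_apply,
    ContinuousLinearMap.add_apply, smul_eq_mul]
  refine Finset.sum_congr rfl fun j _ => ?_
  ring

end Part11

section Part12
open MeasureTheory Filter Topology Bornology
open scoped Matrix ENNReal NNReal

/-- working package of limit facts -/
structure RigPkg {l m : ℕ} (Ω : Set V3) (A : Fin 3 → Matrix (Fin l) (Fin m) ℝ)
    (D : ℕ → V3 → Fin m → ℝ) (M : ℝ) (V : (Fin m → ℝ) → V3 → ℝ) (v : V3 → Fin m → ℝ) : Prop where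
  hΩ : IsOpen Ω
  hD : ∀ n, Measurable (D n)
  hDM : ∀ n x k, |D n x k| ≤ M
  hw : ∀ (a : Fin m → ℝ) (g : V3 → ℝ), Measurable g → (∃ C, ∀ x, |g x| ≤ C) →
    Tendsto (fun n => ∫ x in Ω, g x * (a ⬝ᵥ D n x)) atTop (𝓝 0)
  hV : ∀ (a : Fin m → ℝ) (g : V3 → ℝ), Measurable g → (∃ C, ∀ x, |g x| ≤ C) →
    Tendsto (fun n => ∫ x in Ω, g x * (a ⬝ᵥ D n x) ^ 2) atTop (𝓝 (∫ x in Ω, g x * V a x))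
  hVint : ∀ a, IntegrableOn (V a) Ω
  hV0 : ∀ a, ∀ᵐ x ∂(volume.restrict Ω), 0 ≤ V a x
  hVv : ∀ a, ∀ᵐ x ∂(volume.restrict Ω), V a x ≤ (a ⬝ᵥ v x) ^ 2
  hvm : Measurable v
  hvM : ∀ x, ‖v x‖ ≤ M
  hVs : ∀ (t : ℝ) a x, V (t • a) x = t ^ 2 * V a x
  hT : ∀ L > 0, ∀ ε > 0, ∀ᶠ n in atTop, ∀ ψ : V3 → Fin l → ℝ, ContDiff ℝ (⊤ : ℕ∞) ψ → HasCompactSupport ψ →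
    tsupport ψ ⊆ Ω → (∀ x p, |ψ x p| ≤ L) → (∀ x i p, |fderiv ℝ ψ x (Pi.single i 1) p| ≤ L) →
    |∫ x in Ω, ∑ i, (A i *ᵥ D n x) ⬝ᵥ fderiv ℝ ψ x (Pi.single i 1)| ≤ ε

theorem set_full {Ω : Set V3} {f : V3 → ℝ} (h : ∀ x, x ∉ Ω → f x = 0) : ∫ x in Ω, f x = ∫ x, f x :=
  setIntegral_eq_integral_of_forall_compl_eq_zero h

theorem dot_norm {m : ℕ} (a x : Fin m → ℝ) : |a ⬝ᵥ x| ≤ (∑ k, |a k|) * ‖x‖ :=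
  dot_bound a x _ fun k => by simpa using norm_le_pi_norm x k

theorem local_step {l m : ℕ} {Ω : Set V3} {A : Fin 3 → Matrix (Fin l) (Fin m) ℝ}
    {D : ℕ → V3 → Fin m → ℝ} {M : ℝ} {V : (Fin m → ℝ) → V3 → ℝ} {v : V3 → Fin m → ℝ}
    (P : RigPkg Ω A D M V v) (v0 : Fin m → ℝ) (hv0 : v0 ∉ waveCone A) (k : Fin m) (hk : v0 k ≠ 0) :
    ∃ C, 0 ≤ C ∧ ∀ x0 : V3, ∀ ρ > 0, Metric.closedBall x0 ρ ⊆ Ω →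
      ∫ x in Metric.closedBall x0 (ρ / 2), V (Pi.single k 1) x ≤ C * ∫ x in Metric.closedBall x0 ρ, ‖v x - v0‖ ^ 2 := by
  obtain ⟨B, hB⟩ := left_inv_exists A v0 hv0
  set a : Fin 3 → Fin 3 → Fin m → ℝ := fun i j => (B * A i) j with ha
  have haD : ∀ i j ξ, a i j ⬝ᵥ ξ = (B *ᵥ (A i *ᵥ ξ)) j := by
    intro i j ξ; rw [Matrix.mulVec_mulVec]; rfl
  set c : Fin m → ℝ := (v0 k)⁻¹ • Pi.single k 1 with hc
  have hcv : c ⬝ᵥ v0 = 1 := by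
    simp [hc, hk]
  set d : Fin 3 → Fin 3 → Fin m → ℝ := fun i j => a i j - if i = j then c else 0 with hd
  have hdv : ∀ i j, d i j ⬝ᵥ v0 = 0 := by
    intro i j
    simp only [hd, sub_dotProduct, haD, hB]
    split_ifs <;> simp [hcv]
  have hdD : ∀ i j ξ, d i j ⬝ᵥ ξ = a i j ⬝ᵥ ξ - if i = j then c ⬝ᵥ ξ else 0 := by
    intro i j ξ
    simp only [hd, sub_dotProduct]
    split_ifs <;> simp
  set Cd : ℝ := ∑ i, ∑ j, (∑ q, |d i j q|) ^ 2 with hCd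
  have hCdle : ∀ i j, (∑ q, |d i j q|) ^ 2 ≤ Cd := by
    intro i j
    refine (Finset.single_le_sum (f := fun j => (∑ q, |d i j q|) ^ 2) (fun j _ => sq_nonneg _) (Finset.mem_univ j)).trans ?_
    exact Finset.single_le_sum (f := fun i => ∑ j, (∑ q, |d i j q|) ^ 2) (fun i _ => Finset.sum_nonneg fun j _ => sq_nonneg _) (Finset.mem_univ i)
  have hCd0 : 0 ≤ Cd := Finset.sum_nonneg fun i _ => Finset.sum_nonneg fun j _ => sq_nonneg _
  have hM0 : 0 ≤ M := (norm_nonneg _).trans (P.hvM 0)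
  refine ⟨(v0 k) ^ 2 * (81 * Cd), by positivity, fun x0 ρ hρ hball => ?_⟩
  set J := ∫ x in Metric.closedBall x0 ρ, ‖v x - v0‖ ^ 2 with hJ
  have hJ0 : 0 ≤ J := integral_nonneg fun x => sq_nonneg _
  -- bump
  let χb : ContDiffBump x0 := ⟨ρ / 2, ρ, by positivity, by linarith⟩
  set χ : V3 → ℝ := fun x => χb x with hχdef
  have hχ : ContDiff ℝ (⊤ : ℕ∞) χ := χb.contDiff
  have hχc : HasCompactSupport χ := χb.hasCompactSupport
  have hχ0 : ∀ x, 0 ≤ χ x := fun x => χb.nonneg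
  have hχ1' : ∀ x, χ x ≤ 1 := fun x => χb.le_one
  have hχ1 : ∀ x, |χ x| ≤ 1 := fun x => by rw [abs_of_nonneg (hχ0 x)]; exact hχ1' x
  have hχt : tsupport χ = Metric.closedBall x0 ρ := χb.tsupport_eq
  have hχz : ∀ x, x ∉ Metric.closedBall x0 ρ → χ x = 0 := fun x hx => by
    apply image_eq_zero_of_notMem_tsupport; rwa [hχt]
  have hχzΩ : ∀ x, x ∉ Ω → χ x = 0 := fun x hx => hχz x fun h => hx (hball h)
  have hχone : ∀ x ∈ Metric.closedBall x0 (ρ / 2), χ x = 1 := fun x hx => χb.one_of_mem_closedBall hx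
  have hχm : Measurable χ := hχ.continuous.measurable
  have hchisq : ∀ x, |χ x ^ 2| ≤ 1 := fun x => by
    rw [abs_pow]; exact pow_le_one₀ (abs_nonneg _) (hχ1 x)
  obtain ⟨Cχ, hCχ⟩ : ∃ Cχ, ∀ x i, |fderiv ℝ χ x (Pi.single i 1)| ≤ Cχ := by
    have h1 : ∀ i : Fin 3, ∃ C, ∀ x, ‖fderiv ℝ χ x (Pi.single i 1)‖ ≤ C := by
      intro i
      have hcs : HasCompactSupport (fun x => fderiv ℝ χ x (Pi.single i 1)) := hχc.fderiv_apply (𝕜 := ℝ) _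
      have hcont : Continuous (fun x => fderiv ℝ χ x (Pi.single i 1)) :=
        (hχ.continuous_fderiv (by simp)).clm_apply continuous_const
      exact hcs.exists_bound_of_continuous hcont
    choose C hC using h1
    refine ⟨∑ i, |C i|, fun x i => ((hC i x).trans (le_abs_self _)).trans ?_⟩
    exact Finset.single_le_sum (f := fun i => |C i|) (fun i _ => abs_nonneg _) (Finset.mem_univ i)
  have hCχ0 : 0 ≤ Cχ := (abs_nonneg _).trans (hCχ 0 0)
  -- bounds constant
  set Mb : ℝ := (∑ i, ∑ j, ∑ q, |a i j q| + ∑ q, |c q|) * M with hMb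
  have hab : ∀ i j, ∑ q, |a i j q| ≤ ∑ i, ∑ j, ∑ q, |a i j q| := by
    intro i j
    refine (Finset.single_le_sum (f := fun j => ∑ q, |a i j q|) (fun j _ => Finset.sum_nonneg fun q _ => abs_nonneg _) (Finset.mem_univ j)).trans ?_
    exact Finset.single_le_sum (f := fun i => ∑ j, ∑ q, |a i j q|) (fun i _ => Finset.sum_nonneg fun j _ => Finset.sum_nonneg fun q _ => abs_nonneg _) (Finset.mem_univ i)
  have hc0 : 0 ≤ ∑ q, |c q| := Finset.sum_nonneg fun q _ => abs_nonneg _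
  have ha0 : 0 ≤ ∑ i, ∑ j, ∑ q, |a i j q| := Finset.sum_nonneg fun i _ => Finset.sum_nonneg fun j _ => Finset.sum_nonneg fun q _ => abs_nonneg _
  -- V bound on d
  have hVd : ∀ i j, ∫ x in Ω, χ x ^ 2 * V (d i j) x ≤ Cd * J := by
    intro i j
    have e1 : ∫ x in Ω, χ x ^ 2 * V (d i j) x = ∫ x in Metric.closedBall x0 ρ, χ x ^ 2 * V (d i j) x :=
      (setIntegral_eq_of_subset_of_forall_sdiff_eq_zero P.hΩ.measurableSet hball
        (fun x hx => by simp [hχz x hx.2]))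
    rw [e1, hJ, ← integral_const_mul]
    have hsub : volume.restrict (Metric.closedBall x0 ρ) ≤ volume.restrict Ω := Measure.restrict_mono hball le_rfl
    refine integral_mono_ae ?_ ?_ ?_
    · have := ((P.hVint (d i j)).mono_set hball)
      exact Integrable.bdd_mul (c := 1) this (hχm.pow_const 2).aestronglyMeasurable (ae_of_all _ hchisq)
    · have : IsFiniteMeasure (volume.restrict (Metric.closedBall x0 ρ)) := ⟨by
        rw [Measure.restrict_apply_univ]; exact measure_closedBall_lt_top⟩
      refine Integrable.const_mul ?_ _
      refine Integrable.of_bound ((P.hvm.sub_const v0).norm.pow_const 2).aestronglyMeasurable ((M + ‖v0‖) ^ 2) (ae_of_all _ fun x => ?_)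
      rw [Real.norm_of_nonneg (sq_nonneg _)]
      exact pow_le_pow_left₀ (norm_nonneg _) ((norm_sub_le _ _).trans (by linarith [P.hvM x])) 2
    · filter_upwards [ae_mono hsub (P.hVv (d i j)), ae_mono hsub (P.hV0 (d i j))] with x hx hx0
      have h1 : χ x ^ 2 * V (d i j) x ≤ V (d i j) x := by
        have := hchisq x
        rw [abs_of_nonneg (sq_nonneg _)] at this
        nlinarith
      refine h1.trans (hx.trans ?_)
      have h2 : d i j ⬝ᵥ v x = d i j ⬝ᵥ (v x - v0) := by rw [dotProduct_sub, hdv, sub_zero]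
      rw [h2, ← sq_abs]
      calc |d i j ⬝ᵥ (v x - v0)| ^ 2 ≤ ((∑ q, |d i j q|) * ‖v x - v0‖) ^ 2 :=
            pow_le_pow_left₀ (abs_nonneg _) (dot_norm _ _) 2
        _ = (∑ q, |d i j q|) ^ 2 * ‖v x - v0‖ ^ 2 := by ring
        _ ≤ _ := mul_le_mul_of_nonneg_right (hCdle i j) (sq_nonneg _)
  -- apply core
  have hcore : ∀ ε' > 0, ∀ ε > 0, ∀ᶠ n in atTop, ∫ x, (χ x * (c ⬝ᵥ D n x)) ^ 2 ≤ 81 * (Cd * J + ε') + ε := by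
    intro ε' hε'
    refine core χ hχ hχc hχ1 (fun n i j x => a i j ⬝ᵥ D n x) (fun n i j => dot_measurable _ _ (P.hD n)) Mb
      ?_ (fun n x => c ⬝ᵥ D n x) (fun n => dot_measurable _ _ (P.hD n)) ?_ ?_ ?_ (Cd * J + ε') (by positivity) ?_
    · intro n i j x
      refine (dot_bound _ _ M (P.hDM n x)).trans ?_
      exact mul_le_mul_of_nonneg_right ((hab i j).trans (by linarith)) hM0
    · intro n x
      refine (dot_bound _ _ M (P.hDM n x)).trans ?_
      exact mul_le_mul_of_nonneg_right (by linarith) hM0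
    · intro L hL ε hε
      set S : ℝ := ∑ p, ∑ j, |B j p| with hS
      have hSle : ∀ p, ∑ j, |B j p| ≤ S := fun p =>
        Finset.single_le_sum (f := fun p => ∑ j, |B j p|) (fun p _ => Finset.sum_nonneg fun j _ => abs_nonneg _) (Finset.mem_univ p)
      have hS0 : 0 ≤ S := Finset.sum_nonneg fun p _ => Finset.sum_nonneg fun j _ => abs_nonneg _
      filter_upwards [P.hT (S * ((Cχ + 1) * L) + 1) (by positivity) ε hε] with n hn ψ hψ hψL hψL'
      obtain ⟨hΘ, hΘ'⟩ := theta_deriv B χ ψ hχ hψ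
      have hgen : ∀ (p : Fin l) (G : Fin 3 → ℝ), (∀ j, |G j| ≤ (Cχ + 1) * L) → |∑ j, B j p * G j| ≤ S * ((Cχ + 1) * L) + 1 := by
        intro p G hG
        have : ∑ j, B j p * G j = (fun j => B j p) ⬝ᵥ G := rfl
        rw [this]
        refine (dot_bound _ _ _ hG).trans ?_
        have := mul_le_mul_of_nonneg_right (hSle p) (show 0 ≤ (Cχ + 1) * L by positivity)
        linarith
      have hts : tsupport (fun x (p : Fin l) => ∑ j, B j p * (χ x * ψ j x)) ⊆ tsupport χ := by
        refine closure_mono fun x hx => ?_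
        rw [Function.mem_support] at hx ⊢
        intro h0; apply hx; ext p; simp [h0]
      have := hn _ hΘ (hχc.mono' (subset_closure.trans hts)) (hts.trans (by rw [hχt]; exact hball)) ?_ ?_
      · convert this using 2
        rw [← set_full (Ω := Ω)]
        · refine integral_congr_ae (ae_of_all _ fun x => ?_)
          refine Finset.sum_congr rfl fun i _ => ?_
          simp only [haD]
          simp only [dotProduct, hΘ', Matrix.mulVec, Finset.mul_sum, Finset.sum_mul]
          conv_rhs => rw [Finset.sum_comm]
          refine Finset.sum_congr rfl fun j _ => ?_
          refine Finset.sum_congr rfl fun p _ => ?_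
          refine Finset.sum_congr rfl fun q _ => ?_
          ring
        · intro x hx
          have h1 : χ x = 0 := hχzΩ x hx
          have h2 : fderiv ℝ χ x = 0 := by
            have : x ∉ tsupport χ := by rw [hχt]; exact fun h => hx (hball h)
            exact image_eq_zero_of_notMem_tsupport fun h => this (tsupport_fderiv_subset ℝ h)
          simp [h1, h2]
      · intro x p
        refine hgen p _ fun j => ?_
        rw [abs_mul]
        have := mul_le_mul (hχ1 x) (hψL j x) (abs_nonneg _) zero_le_one
        nlinarith [mul_nonneg hCχ0 hL.le]
      · intro x i p
        rw [hΘ']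
        refine hgen p _ fun j => (abs_add_le _ _).trans ?_
        rw [abs_mul, abs_mul]
        have h1 := mul_le_mul (hχ1 x) (hψL' j x i) (abs_nonneg _) zero_le_one
        have h2 := mul_le_mul (hCχ x i) (hψL j x) (abs_nonneg _) hCχ0
        nlinarith
    · intro h hh ⟨C, hC⟩
      have := P.hw c (fun x => χ x * h x) (hχm.mul hh.measurable) ⟨C, fun x => by
        rw [abs_mul]
        have := mul_le_mul (hχ1 x) (hC x) (abs_nonneg _) zero_le_one
        linarith⟩
      refine this.congr fun n => ?_
      rw [set_full]
      · congr 1; ext x; ring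
      · intro x hx; simp [hχzΩ x hx]
    · have h1 : ∀ i j, ∀ᶠ n in atTop, ∫ x in Ω, χ x ^ 2 * (d i j ⬝ᵥ D n x) ^ 2 ≤ Cd * J + ε' := by
        intro i j
        have := P.hV (d i j) (fun x => χ x ^ 2) (hχm.pow_const 2) ⟨1, hchisq⟩
        filter_upwards [this.eventually_lt_const (lt_of_le_of_lt (hVd i j) (lt_add_of_pos_right _ hε'))] with n hn
        exact hn.le
      filter_upwards [eventually_all.2 fun i => eventually_all.2 fun j => h1 i j] with n hn i j
      refine le_of_eq_of_le ?_ (hn i j)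
      rw [set_full]
      · congr 1; ext x; rw [hdD, mul_pow]
      · intro x hx; simp [hχzΩ x hx]
  -- limit
  have hlim : ∫ x in Ω, χ x ^ 2 * V c x ≤ 81 * (Cd * J) := by
    refine le_of_forall_pos_le_add fun δ hδ => ?_
    have h1 := P.hV c (fun x => χ x ^ 2) (hχm.pow_const 2) ⟨1, hchisq⟩
    refine le_of_tendsto h1 ?_
    filter_upwards [hcore (δ / 162) (by positivity) (δ / 2) (by positivity)] with n hn
    refine (le_of_eq_of_le ?_ hn).trans (by linarith)
    rw [set_full]
    · congr 1; ext x; rw [mul_pow]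
    · intro x hx; simp [hχzΩ x hx]
  have hhalf : Metric.closedBall x0 (ρ / 2) ⊆ Ω := (Metric.closedBall_subset_closedBall (by linarith)).trans hball
  have hfin : ∫ x in Metric.closedBall x0 (ρ / 2), V c x ≤ ∫ x in Ω, χ x ^ 2 * V c x := by
    have e1 : ∫ x in Metric.closedBall x0 (ρ / 2), V c x = ∫ x in Metric.closedBall x0 (ρ / 2), χ x ^ 2 * V c x := by
      refine setIntegral_congr_fun measurableSet_closedBall fun x hx => ?_
      simp [hχone x hx]
    rw [e1]
    refine setIntegral_mono_set ?_ ?_ (LE.le.eventuallyLE hhalf)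
    · exact Integrable.bdd_mul (c := 1) (P.hVint c) (hχm.pow_const 2).aestronglyMeasurable (ae_of_all _ hchisq)
    · filter_upwards [P.hV0 c] with x hx
      exact mul_nonneg (sq_nonneg _) hx
  have hVk : ∀ x, V (Pi.single k 1) x = (v0 k) ^ 2 * V c x := by
    intro x
    rw [hc, P.hVs]
    field_simp
  simp only [hVk]
  rw [integral_const_mul, mul_assoc, mul_assoc]
  exact mul_le_mul_of_nonneg_left (hfin.trans hlim) (sq_nonneg _)

end Part12

section Part13
open MeasureTheory Filter Topology Bornology
open scoped Matrix ENNReal NNReal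

theorem avg_cb (f : V3 → ℝ) (x : V3) (r : ℝ) (hr : 0 < r) :
    ⨍ y in Metric.closedBall x r, f y = ((2 * r) ^ 3)⁻¹ * ∫ y in Metric.closedBall x r, f y := by
  rw [setAverage_eq, measureReal_def, vol_cb x r hr.le, ENNReal.toReal_ofReal (by positivity), smul_eq_mul]

theorem local_rig {l m : ℕ} {Ω : Set V3} {A : Fin 3 → Matrix (Fin l) (Fin m) ℝ}
    {D : ℕ → V3 → Fin m → ℝ} {M : ℝ} {V : (Fin m → ℝ) → V3 → ℝ} {v : V3 → Fin m → ℝ}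
    (P : RigPkg Ω A D M V v) (hv : ∀ᵐ x ∂(volume.restrict Ω), v x ∉ waveCone A) (k : Fin m) :
    ∀ᵐ x ∂(volume.restrict Ω), V (Pi.single k 1) x = 0 := by
  have hvl : LocallyIntegrable v volume := by
    rw [locallyIntegrable_iff]
    intro s hs
    have : IsFiniteMeasure (volume.restrict s) := ⟨by
      rw [Measure.restrict_apply_univ]; exact hs.measure_lt_top⟩
    exact Integrable.of_bound P.hvm.aestronglyMeasurable M (ae_of_all _ P.hvM)
  have hVl : LocallyIntegrable (Ω.indicator (V (Pi.single k 1))) volume :=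
    ((P.hVint _).integrable_indicator P.hΩ.measurableSet).locallyIntegrable
  have h1 := ae_restrict_of_ae (s := Ω) (IsUnifLocDoublingMeasure.ae_tendsto_average_norm_sub (μ := (volume : Measure V3)) hvl 1)
  have h2 := ae_restrict_of_ae (s := Ω) (IsUnifLocDoublingMeasure.ae_tendsto_average (μ := (volume : Measure V3)) hVl 1)
  filter_upwards [h1, h2, hv, P.hV0 (Pi.single k 1), P.hVv (Pi.single k 1), ae_restrict_mem P.hΩ.measurableSet]
    with x0 a1 a2 a3 a4 a5 a6
  by_cases hk : v x0 k = 0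
  · refine le_antisymm (a5.trans ?_) a4
    simp [hk]
  obtain ⟨C, hC0, hC⟩ := local_step P (v x0) a3 k hk
  obtain ⟨R, hR0, hR⟩ := Metric.isOpen_iff.1 P.hΩ x0 a6
  have hl : Tendsto (fun ρ : ℝ => ρ) (𝓝[>] 0) (𝓝[>] 0) := tendsto_id
  have hl2 : Tendsto (fun ρ : ℝ => ρ / 2) (𝓝[>] 0) (𝓝[>] 0) := by
    refine tendsto_nhdsWithin_iff.2 ⟨?_, ?_⟩
    · have : Tendsto (fun ρ : ℝ => ρ / 2) (𝓝 0) (𝓝 (0 / 2)) := tendsto_id.div_const 2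
      rw [zero_div] at this
      exact this.mono_left nhdsWithin_le_nhds
    · filter_upwards [self_mem_nhdsWithin] with ρ (hρ : 0 < ρ)
      exact half_pos hρ
  have b1 := a1 (fun _ => x0) (fun ρ : ℝ => ρ) hl (by
    filter_upwards [self_mem_nhdsWithin] with ρ (hρ : 0 < ρ)
    simpa using hρ.le)
  have b2 := a2 (fun _ => x0) (fun ρ : ℝ => ρ / 2) hl2 (by
    filter_upwards [self_mem_nhdsWithin] with ρ (hρ : 0 < ρ)
    have := (half_pos hρ).le
    simp only [one_mul]
    exact Metric.mem_closedBall_self this)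
  rw [Set.indicator_of_mem a6] at b2
  have b3 := b1.const_mul (C * (2 * M) * 8)
  rw [mul_zero] at b3
  refine le_antisymm (le_of_tendsto_of_tendsto b2 b3 ?_) a4
  filter_upwards [self_mem_nhdsWithin, nhdsWithin_le_nhds (Iio_mem_nhds hR0)] with ρ (hρ : 0 < ρ) (hρR : ρ < R)
  have hball : Metric.closedBall x0 ρ ⊆ Ω := (Metric.closedBall_subset_ball hρR).trans hR
  have hball2 : Metric.closedBall x0 (ρ / 2) ⊆ Ω := (Metric.closedBall_subset_closedBall (by linarith)).trans hball
  rw [avg_cb _ _ _ hρ, avg_cb _ _ _ (half_pos hρ)]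
  have e1 : ∫ y in Metric.closedBall x0 (ρ / 2), Ω.indicator (V (Pi.single k 1)) y
      = ∫ y in Metric.closedBall x0 (ρ / 2), V (Pi.single k 1) y :=
    setIntegral_congr_fun measurableSet_closedBall fun y hy => Set.indicator_of_mem (hball2 hy) _
  have e2 : ∫ y in Metric.closedBall x0 ρ, ‖v y - v x0‖ ^ 2 ≤ (2 * M) * ∫ y in Metric.closedBall x0 ρ, ‖v y - v x0‖ := by
    have : IsFiniteMeasure (volume.restrict (Metric.closedBall x0 ρ)) := ⟨by
      rw [Measure.restrict_apply_univ]; exact measure_closedBall_lt_top⟩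
    have hb : ∀ y, ‖v y - v x0‖ ≤ 2 * M := fun y =>
      (norm_sub_le _ _).trans (by linarith [P.hvM y, P.hvM x0])
    rw [← integral_const_mul]
    refine integral_mono ?_ ?_ fun y => ?_
    · refine Integrable.of_bound ((P.hvm.sub_const _).norm.pow_const 2).aestronglyMeasurable ((2 * M) ^ 2) (ae_of_all _ fun x => ?_)
      rw [Real.norm_of_nonneg (sq_nonneg _)]
      exact pow_le_pow_left₀ (norm_nonneg _) (hb x) 2
    · refine Integrable.const_mul ?_ _
      refine Integrable.of_bound ((P.hvm.sub_const _).norm).aestronglyMeasurable (2 * M) (ae_of_all _ fun x => ?_)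
      rw [norm_norm]; exact hb x
    · change ‖v y - v x0‖ ^ 2 ≤ 2 * M * ‖v y - v x0‖
      rw [sq]; exact mul_le_mul_of_nonneg_right (hb y) (norm_nonneg _)
  rw [e1]
  have e3 := (hC x0 ρ hρ hball).trans (mul_le_mul_of_nonneg_left e2 hC0)
  set I := ∫ y in Metric.closedBall x0 ρ, ‖v y - v x0‖
  calc ((2 * (ρ / 2)) ^ 3)⁻¹ * ∫ y in Metric.closedBall x0 (ρ / 2), V (Pi.single k 1) y
      ≤ ((2 * (ρ / 2)) ^ 3)⁻¹ * (C * (2 * M * I)) := mul_le_mul_of_nonneg_left e3 (by positivity)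
    _ = _ := by field_simp; ring

end Part13

section Part14
open MeasureTheory Filter Topology Bornology
open scoped Matrix ENNReal NNReal

/-- truncation of a real number to `[-R, R]` -/
noncomputable def clipR (R t : ℝ) : ℝ := max (-R) (min R t)

theorem clipR_cont (R : ℝ) : Continuous (clipR R) := continuous_const.max (continuous_const.min continuous_id)

theorem clipR_abs {R : ℝ} (hR : 0 ≤ R) (t : ℝ) : |clipR R t| ≤ R := by
  rw [abs_le]
  exact ⟨le_max_left _ _, max_le (by linarith) (min_le_left _ _)⟩

theorem clipR_eq {R t : ℝ} (h : |t| ≤ R) : clipR R t = t := by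
  rw [abs_le] at h
  rw [clipR, min_eq_right h.2, max_eq_right h.1]

theorem clipR_sub {R : ℝ} (hR : 0 ≤ R) (t : ℝ) : |t - clipR R t| ≤ |t| := by
  unfold clipR
  rcases le_total R t with h | h
  · rw [min_eq_left h, max_eq_right (by linarith), abs_of_nonneg (by linarith), abs_of_nonneg (by linarith)]
    linarith
  · rw [min_eq_right h]
    rcases le_total (-R) t with h' | h'
    · rw [max_eq_right h']; simp
    · rw [max_eq_left h', abs_of_nonpos (by linarith), abs_of_nonpos (by linarith)]; linarith

theorem gen_bdd {m : ℕ} {μ : Measure V3} [IsFiniteMeasure μ] {z : ℕ → V3 → Fin m → ℝ} {ν : V3 → Measure (Fin m → ℝ)}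
    (hgen : GeneratesYM μ z ν) (hmeas : ∀ n, Measurable (z n)) (f : (Fin m → ℝ) → ℝ) (hf : Continuous f)
    (C : ℝ) (hC : ∀ ξ, |f ξ| ≤ C) :
    Integrable (fun x => ∫ ξ, f ξ ∂(ν x)) μ ∧
    ∀ g : V3 → ℝ, Measurable g → (∃ C : ℝ, ∀ x, |g x| ≤ C) →
      Tendsto (fun n => ∫ x, g x * f (z n x) ∂μ) atTop
        (𝓝 (∫ x, g x * ∫ ξ, f ξ ∂(ν x) ∂μ)) := by
  have hm : ∀ n, AEStronglyMeasurable (fun x => f (z n x)) μ := fun n =>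
    (hf.measurable.comp (hmeas n)).aestronglyMeasurable
  refine hgen f hf (fun n => Integrable.of_bound (hm n) C (ae_of_all _ fun x => hC _)) ?_
  have hC0 : 0 ≤ C := (abs_nonneg _).trans (hC 0)
  refine unifIntegrable_of le_rfl ENNReal.one_ne_top hm fun ε hε => ⟨Real.toNNReal (C + 1), fun n => ?_⟩
  have : {x | Real.toNNReal (C + 1) ≤ ‖f (z n x)‖₊} = ∅ := by
    ext x
    simp only [Set.mem_ofPred_eq, Set.mem_empty_iff_false, iff_false]
    intro h
    have h1 : ((Real.toNNReal (C + 1) : ℝ≥0) : ℝ) ≤ ((‖f (z n x)‖₊ : ℝ≥0) : ℝ) := h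
    rw [Real.coe_toNNReal _ (by linarith), coe_nnnorm, Real.norm_eq_abs] at h1
    linarith [hC (z n x)]
  rw [this]; simp

theorem bdd_int {μ : Measure V3} [IsFiniteMeasure μ] {f : V3 → ℝ} (hf : Measurable f) {C : ℝ} (hC : ∀ x, |f x| ≤ C) :
    Integrable f μ := Integrable.of_bound hf.aestronglyMeasurable C (ae_of_all _ hC)

theorem abs_mul_le' {a b A B : ℝ} (ha : |a| ≤ A) (hb : |b| ≤ B) : |a * b| ≤ A * B := by
  rw [abs_mul]; exact mul_le_mul ha hb (abs_nonneg _) ((abs_nonneg _).trans ha)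

theorem var_limit {μ : Measure V3} [IsFiniteMeasure μ] (F : ℕ → V3 → ℝ) (W Q : V3 → ℝ) (hF : ∀ n, Measurable (F n))
    (hW : Measurable W) (B : ℝ) (hFB : ∀ n x, |F n x| ≤ B) (hWB : ∀ x, |W x| ≤ B) (hQ : Integrable Q μ)
    (h1 : ∀ g : V3 → ℝ, Measurable g → (∃ C, ∀ x, |g x| ≤ C) → Tendsto (fun n => ∫ x, g x * F n x ∂μ) atTop (𝓝 (∫ x, g x * W x ∂μ)))
    (h2 : ∀ g : V3 → ℝ, Measurable g → (∃ C, ∀ x, |g x| ≤ C) → Tendsto (fun n => ∫ x, g x * F n x ^ 2 ∂μ) atTop (𝓝 (∫ x, g x * Q x ∂μ)))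
    (g : V3 → ℝ) (hg : Measurable g) (hgb : ∃ C, ∀ x, |g x| ≤ C) :
    Tendsto (fun n => ∫ x, g x * (F n x - W x) ^ 2 ∂μ) atTop (𝓝 (∫ x, g x * (Q x - W x ^ 2) ∂μ)) := by
  obtain ⟨C, hC⟩ := hgb
  have hsq : ∀ n, Integrable (fun x => g x * F n x ^ 2) μ := fun n =>
    bdd_int (hg.mul ((hF n).pow_const 2)) (C := C * B ^ 2) fun x => abs_mul_le' (hC x) (by
      rw [abs_pow]; exact pow_le_pow_left₀ (abs_nonneg _) (hFB n x) 2)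
  have hgWb : ∀ x, |g x * W x| ≤ C * B := fun x => abs_mul_le' (hC x) (hWB x)
  have hgFW : ∀ n, Integrable (fun x => (g x * W x) * F n x) μ := fun n =>
    bdd_int ((hg.mul hW).mul (hF n)) (C := C * B * B) fun x => abs_mul_le' (hgWb x) (hFB n x)
  have hgWW : Integrable (fun x => (g x * W x) * W x) μ :=
    bdd_int ((hg.mul hW).mul hW) (C := C * B * B) fun x => abs_mul_le' (hgWb x) (hWB x)
  have hgQ : Integrable (fun x => g x * Q x) μ := Integrable.bdd_mul (c := C) hQ hg.aestronglyMeasurable (ae_of_all _ hC)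
  have t1 := h1 (fun x => g x * W x) (hg.mul hW) ⟨_, hgWb⟩
  have t2 := h2 g hg ⟨C, hC⟩
  have t3 := (t2.sub (t1.const_mul 2)).add_const (∫ x, (g x * W x) * W x ∂μ)
  have e1 : ∀ n, ∫ x, g x * (F n x - W x) ^ 2 ∂μ = (∫ x, g x * F n x ^ 2 ∂μ) - 2 * (∫ x, (g x * W x) * F n x ∂μ)
      + ∫ x, (g x * W x) * W x ∂μ := by
    intro n
    have i3 : Integrable (fun x => g x * F n x ^ 2 - 2 * (g x * W x * F n x)) μ := (hsq n).sub ((hgFW n).const_mul 2)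
    rw [← integral_const_mul, ← integral_sub (hsq n) ((hgFW n).const_mul 2), ← integral_add i3 hgWW]
    congr 1; ext x; ring
  have e2 : ∫ x, g x * (Q x - W x ^ 2) ∂μ = (∫ x, g x * Q x ∂μ) - 2 * (∫ x, (g x * W x) * W x ∂μ)
      + ∫ x, (g x * W x) * W x ∂μ := by
    have : ∫ x, g x * (Q x - W x ^ 2) ∂μ = (∫ x, g x * Q x ∂μ) - ∫ x, (g x * W x) * W x ∂μ := by
      rw [← integral_sub hgQ hgWW]
      congr 1; ext x; ring
    rw [this]; ring
  rw [e2]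
  exact t3.congr fun n => (e1 n).symm

theorem var_expand {m : ℕ} (ν : Measure (Fin m → ℝ)) [IsProbabilityMeasure ν] (X : (Fin m → ℝ) → ℝ) (hX : Continuous X) (B : ℝ)
    (hB : ∀ ξ, |X ξ| ≤ B) (α : ℝ) : Integrable (fun ξ => (X ξ - α) ^ 2) ν ∧
      ∫ ξ, (X ξ - α) ^ 2 ∂ν = ((∫ ξ, X ξ ^ 2 ∂ν) - (∫ ξ, X ξ ∂ν) ^ 2) + ((∫ ξ, X ξ ∂ν) - α) ^ 2 := by
  have i1 : Integrable X ν := Integrable.of_bound hX.aestronglyMeasurable B (ae_of_all _ hB)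
  have i2 : Integrable (fun ξ => X ξ ^ 2) ν := Integrable.of_bound (hX.pow 2).aestronglyMeasurable (B ^ 2) (ae_of_all _ fun ξ => by
    rw [norm_pow]; exact pow_le_pow_left₀ (norm_nonneg _) (hB ξ) 2)
  have i3 : Integrable (fun ξ => X ξ ^ 2 - 2 * α * X ξ) ν := i2.sub (i1.const_mul _)
  have e : (fun ξ => (X ξ - α) ^ 2) = fun ξ => (X ξ ^ 2 - 2 * α * X ξ) + α ^ 2 := by ext ξ; ring
  rw [e]
  refine ⟨i3.add (integrable_const _), ?_⟩
  rw [integral_add i3 (integrable_const _), integral_sub i2 (i1.const_mul _), integral_const_mul]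
  simp
  ring

theorem dirac_of_ae {m : ℕ} (ν : Measure (Fin m → ℝ)) [IsProbabilityMeasure ν] (w : Fin m → ℝ) (h : ∀ᵐ ξ ∂ν, ξ = w) :
    ν = Measure.dirac w := by
  have : ν.map id = ν.map (fun _ => w) := Measure.map_congr h
  rw [Measure.map_id, Measure.map_const] at this
  simpa using this

theorem test_scale {l m : ℕ} {Ω : Set V3} (hΩbdd : IsBounded Ω) (A : Fin 3 → Matrix (Fin l) (Fin m) ℝ)
    (z : ℕ → V3 → Fin m → ℝ) (r' : ℝ) (hW : AconvergesToZeroWminusOneR Ω A r' z) :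
    ∀ L > 0, ∀ ε > 0, ∀ᶠ n in atTop, ∀ ψ : V3 → Fin l → ℝ, ContDiff ℝ (⊤ : ℕ∞) ψ → HasCompactSupport ψ →
    tsupport ψ ⊆ Ω → (∀ x p, |ψ x p| ≤ L) → (∀ x i p, |fderiv ℝ ψ x (Pi.single i 1) p| ≤ L) →
    |∑ i, ∫ x in Ω, (A i *ᵥ z n x) ⬝ᵥ fderiv ℝ ψ x (Pi.single i 1)| ≤ ε := by
  intro L hL ε hε
  set κ : ℝ≥0∞ := (volume Ω) ^ (ENNReal.ofReal r').toReal⁻¹ with hκ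
  have hκt : κ ≠ ∞ := ENNReal.rpow_ne_top_of_nonneg (by positivity) hΩbdd.measure_lt_top.ne
  set S : ℝ := κ.toReal * L + κ.toReal * (3 * L) + 1 with hS
  have hS0 : 0 < S := by positivity
  obtain ⟨n₀, hn₀⟩ := hW (ε * S⁻¹) (by positivity)
  filter_upwards [eventually_ge_atTop n₀] with n hn ψ hψ hψc hψΩ hψL hψL'
  have hd : ∀ x, fderiv ℝ (S⁻¹ • ψ) x = S⁻¹ • fderiv ℝ ψ x := fun x =>
    fderiv_const_smul (hψ.differentiable (by simp) x) _
  have hts : tsupport (S⁻¹ • ψ) ⊆ tsupport ψ := closure_mono fun x hx => by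
    rw [Function.mem_support] at hx ⊢
    intro h0; apply hx; simp [h0]
  have hnψ : ∀ x, ‖ψ x‖ ≤ L := fun x => (pi_norm_le_iff_of_nonneg hL.le).2 fun p => hψL x p
  have hnd : ∀ x, ‖fderiv ℝ ψ x‖ ≤ 3 * L := by
    intro x
    apply ContinuousLinearMap.opNorm_le_bound _ (by positivity)
    intro v
    have hv : v = ∑ i, v i • (Pi.single i 1 : V3) := by
      ext j; simp [Finset.sum_apply, Pi.single_apply]
    conv_lhs => rw [hv]
    rw [map_sum]
    refine (norm_sum_le _ _).trans ?_
    have : ∀ i ∈ Finset.univ, ‖fderiv ℝ ψ x (v i • (Pi.single i 1 : V3))‖ ≤ ‖v‖ * L := by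
      intro i _
      rw [map_smul, norm_smul]
      refine mul_le_mul (norm_le_pi_norm v i) ?_ (norm_nonneg _) (norm_nonneg _)
      exact (pi_norm_le_iff_of_nonneg hL.le).2 fun p => hψL' x i p
    refine (Finset.sum_le_sum this).trans ?_
    simp; linarith
  have hκe : κ = ENNReal.ofReal κ.toReal := (ENNReal.ofReal_toReal hκt).symm
  have b1 : eLpNorm ψ (ENNReal.ofReal r') volume ≤ ENNReal.ofReal (κ.toReal * L) := by
    rw [← eLpNorm_restrict_eq_of_support_subset ((subset_tsupport _).trans hψΩ)]
    refine (eLpNorm_le_of_ae_bound (ae_of_all _ hnψ)).trans ?_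
    rw [Measure.restrict_apply_univ, ENNReal.ofReal_mul (by positivity), ← hκe]
  have b2 : eLpNorm (fun x => ‖fderiv ℝ ψ x‖) (ENNReal.ofReal r') volume ≤ ENNReal.ofReal (κ.toReal * (3 * L)) := by
    rw [← eLpNorm_restrict_eq_of_support_subset (s := Ω)]
    · refine (eLpNorm_le_of_ae_bound (ae_of_all _ fun x => (norm_norm _).le.trans (hnd x))).trans ?_
      rw [Measure.restrict_apply_univ, ENNReal.ofReal_mul (p := κ.toReal) (by positivity), ← hκe]
    · intro x hx
      rw [Function.mem_support] at hx
      apply hψΩ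
      apply tsupport_fderiv_subset ℝ (f := ψ)
      apply subset_tsupport
      rw [Function.mem_support]
      intro h0; apply hx; rw [h0]; simp
  have key := hn₀ n hn (S⁻¹ • ψ) (contDiff_const.smul hψ) (hψc.mono' (subset_closure.trans hts)) (hts.trans hψΩ) ?_
  · have e : ∑ i, ∫ x in Ω, (A i *ᵥ z n x) ⬝ᵥ fderiv ℝ (S⁻¹ • ψ) x (Pi.single i 1)
        = S⁻¹ * ∑ i, ∫ x in Ω, (A i *ᵥ z n x) ⬝ᵥ fderiv ℝ ψ x (Pi.single i 1) := by
      rw [Finset.mul_sum]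
      refine Finset.sum_congr rfl fun i _ => ?_
      rw [← integral_const_mul]
      congr 1; ext x
      rw [hd]
      change _ ⬝ᵥ (S⁻¹ • fderiv ℝ ψ x (Pi.single i 1)) = _
      rw [dotProduct_smul, smul_eq_mul]
    rw [e, abs_mul, abs_of_pos (inv_pos.2 hS0), mul_comm] at key
    exact le_of_mul_le_mul_right key (inv_pos.2 hS0)
  · have hS1 : ‖S⁻¹‖ₑ = ENNReal.ofReal S⁻¹ := Real.enorm_of_nonneg (inv_pos.2 hS0).le
    have c1 : eLpNorm (S⁻¹ • ψ) (ENNReal.ofReal r') volume ≤ ENNReal.ofReal (S⁻¹ * (κ.toReal * L)) := by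
      rw [eLpNorm_const_smul, hS1, ENNReal.ofReal_mul (by positivity)]
      gcongr
    have c2 : eLpNorm (fun x => ‖fderiv ℝ (S⁻¹ • ψ) x‖) (ENNReal.ofReal r') volume ≤ ENNReal.ofReal (S⁻¹ * (κ.toReal * (3 * L))) := by
      have : (fun x => ‖fderiv ℝ (S⁻¹ • ψ) x‖) = S⁻¹ • fun x => ‖fderiv ℝ ψ x‖ := by
        ext x
        rw [hd, norm_smul, Real.norm_of_nonneg (inv_pos.2 hS0).le]; rfl
      rw [this, eLpNorm_const_smul, hS1, ENNReal.ofReal_mul (inv_pos.2 hS0).le]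
      gcongr
    refine (add_le_add c1 c2).trans ?_
    rw [← ENNReal.ofReal_add (by positivity) (by positivity), ENNReal.ofReal_le_one]
    rw [← mul_add, inv_mul_le_iff₀ hS0]
    linarith

end Part14

section Part15
open MeasureTheory Filter Topology Bornology
open scoped Matrix ENNReal NNReal

theorem pair_bound {l m : ℕ} {μ : Measure V3} (A : Fin 3 → Matrix (Fin l) (Fin m) ℝ) (ξ : V3 → Fin m → ℝ) (hξ : Measurable ξ)
    (hi : ∀ q, Integrable (fun x => ξ x q) μ) (ψ : V3 → Fin l → ℝ) (hψ : ContDiff ℝ (⊤ : ℕ∞) ψ) (L : ℝ) (hL : 0 ≤ L)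
    (hψL' : ∀ x i p, |fderiv ℝ ψ x (Pi.single i 1) p| ≤ L) :
    (∀ i p, Integrable (fun x => fderiv ℝ ψ x (Pi.single i 1) p * (A i p ⬝ᵥ ξ x)) μ) ∧
    (∀ i, Integrable (fun x => (A i *ᵥ ξ x) ⬝ᵥ fderiv ℝ ψ x (Pi.single i 1)) μ) ∧
    |∫ x, ∑ i, (A i *ᵥ ξ x) ⬝ᵥ fderiv ℝ ψ x (Pi.single i 1) ∂μ| ≤ ((∑ i, ∑ p, ∑ q, |A i p q|) * L) * ∑ q, ∫ x, |ξ x q| ∂μ := by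
  have hm : ∀ i p, Measurable fun x => fderiv ℝ ψ x (Pi.single i 1) p := fun i p =>
    (measurable_pi_apply p).comp ((hψ.continuous_fderiv (by simp)).clm_apply continuous_const).measurable
  have hA : ∀ i p, Integrable (fun x => A i p ⬝ᵥ ξ x) μ := fun i p =>
    integrable_finsetSum _ fun q _ => (hi q).const_mul _
  have h1 : ∀ i p, Integrable (fun x => fderiv ℝ ψ x (Pi.single i 1) p * (A i p ⬝ᵥ ξ x)) μ := fun i p =>
    Integrable.bdd_mul (c := L) (hA i p) (hm i p).aestronglyMeasurable (ae_of_all _ fun x => hψL' x i p)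
  have e : ∀ i, (fun x => (A i *ᵥ ξ x) ⬝ᵥ fderiv ℝ ψ x (Pi.single i 1)) = fun x => ∑ p, fderiv ℝ ψ x (Pi.single i 1) p * (A i p ⬝ᵥ ξ x) := by
    intro i; ext x
    rw [dotProduct]
    exact Finset.sum_congr rfl fun p _ => mul_comm _ _
  have h2 : ∀ i, Integrable (fun x => (A i *ᵥ ξ x) ⬝ᵥ fderiv ℝ ψ x (Pi.single i 1)) μ := by
    intro i
    rw [e]
    exact integrable_finsetSum _ fun p _ => h1 i p
  refine ⟨h1, h2, ?_⟩
  have hs : ∫ x, ((∑ i, ∑ p, ∑ q, |A i p q|) * L) * ∑ q, |ξ x q| ∂μ = ((∑ i, ∑ p, ∑ q, |A i p q|) * L) * ∑ q, ∫ x, |ξ x q| ∂μ := by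
    rw [integral_const_mul, integral_finsetSum _ fun q _ => (hi q).abs]
  rw [← hs]
  refine (abs_integral_le_integral_abs).trans ?_
  refine integral_mono (integrable_finsetSum _ fun i _ => h2 i).abs ((integrable_finsetSum _ fun q _ => (hi q).abs).const_mul _) fun x => ?_
  change |∑ i, (A i *ᵥ ξ x) ⬝ᵥ fderiv ℝ ψ x (Pi.single i 1)| ≤ ((∑ i, ∑ p, ∑ q, |A i p q|) * L) * ∑ q, |ξ x q|
  set s := ∑ q, |ξ x q| with hsdef
  have hsq : ∀ q, |ξ x q| ≤ s := fun q => Finset.single_le_sum (f := fun q => |ξ x q|) (fun q _ => abs_nonneg _) (Finset.mem_univ q)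
  rw [mul_assoc, Finset.sum_mul]
  refine (Finset.abs_sum_le_sum_abs _ _).trans (Finset.sum_le_sum fun i _ => ?_)
  rw [congrFun (e i) x, Finset.sum_mul]
  refine (Finset.abs_sum_le_sum_abs _ _).trans (Finset.sum_le_sum fun p _ => ?_)
  rw [abs_mul]
  have := mul_le_mul (hψL' x i p) (dot_bound (A i p) (ξ x) s hsq) (abs_nonneg _) hL
  refine this.trans (le_of_eq (by ring))

theorem hT_of {l m : ℕ} {Ω : Set V3} [IsFiniteMeasure (volume.restrict Ω)] (A : Fin 3 → Matrix (Fin l) (Fin m) ℝ)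
    (z y : ℕ → V3 → Fin m → ℝ) (w : V3 → Fin m → ℝ) (R : ℝ)
    (hz : ∀ n, Measurable (z n)) (hy : ∀ n, Measurable (y n)) (hw : Measurable w)
    (hzi : ∀ n q, IntegrableOn (fun x => z n x q) Ω) (hyR : ∀ n x q, |y n x q| ≤ R) (hwR : ∀ x q, |w x q| ≤ R)
    (hzy : ∀ q, Tendsto (fun n => ∫ x in Ω, |z n x q - y n x q|) atTop (𝓝 0))
    (hwk : ∀ (a : Fin m → ℝ) (g : V3 → ℝ), Measurable g → (∃ C, ∀ x, |g x| ≤ C) →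
      Tendsto (fun n => ∫ x in Ω, g x * (a ⬝ᵥ (y n x - w x))) atTop (𝓝 0))
    (ht : ∀ L > 0, ∀ ε > 0, ∀ᶠ n in atTop, ∀ ψ : V3 → Fin l → ℝ, ContDiff ℝ (⊤ : ℕ∞) ψ → HasCompactSupport ψ →
      tsupport ψ ⊆ Ω → (∀ x p, |ψ x p| ≤ L) → (∀ x i p, |fderiv ℝ ψ x (Pi.single i 1) p| ≤ L) →
      |∑ i, ∫ x in Ω, (A i *ᵥ z n x) ⬝ᵥ fderiv ℝ ψ x (Pi.single i 1)| ≤ ε) :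
    ∀ L > 0, ∀ ε > 0, ∀ᶠ n in atTop, ∀ ψ : V3 → Fin l → ℝ, ContDiff ℝ (⊤ : ℕ∞) ψ → HasCompactSupport ψ →
      tsupport ψ ⊆ Ω → (∀ x p, |ψ x p| ≤ L) → (∀ x i p, |fderiv ℝ ψ x (Pi.single i 1) p| ≤ L) →
      |∫ x in Ω, ∑ i, (A i *ᵥ (y n x - w x)) ⬝ᵥ fderiv ℝ ψ x (Pi.single i 1)| ≤ ε := by
  have hyi : ∀ n q, IntegrableOn (fun x => y n x q) Ω := fun n q =>
    bdd_int ((measurable_pi_apply q).comp (hy n)) fun x => hyR n x q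
  have hwi : ∀ q, IntegrableOn (fun x => w x q) Ω := fun q =>
    bdd_int ((measurable_pi_apply q).comp hw) fun x => hwR x q
  -- step 1: test of y
  have s1 : ∀ L > 0, ∀ ε > 0, ∀ᶠ n in atTop, ∀ ψ : V3 → Fin l → ℝ, ContDiff ℝ (⊤ : ℕ∞) ψ → HasCompactSupport ψ →
      tsupport ψ ⊆ Ω → (∀ x p, |ψ x p| ≤ L) → (∀ x i p, |fderiv ℝ ψ x (Pi.single i 1) p| ≤ L) →
      |∫ x in Ω, ∑ i, (A i *ᵥ y n x) ⬝ᵥ fderiv ℝ ψ x (Pi.single i 1)| ≤ ε := by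
    intro L hL ε hε
    have hlim : Tendsto (fun n => ((∑ i, ∑ p, ∑ q, |A i p q|) * L) * ∑ q, ∫ x in Ω, |z n x q - y n x q|) atTop (𝓝 0) := by
      have := (tendsto_finsetSum Finset.univ fun q _ => hzy q).const_mul ((∑ i, ∑ p, ∑ q, |A i p q|) * L)
      simpa using this
    filter_upwards [ht L hL (ε / 2) (by positivity), hlim.eventually_lt_const (half_pos hε)] with n h1 h2 ψ hψ hψc hψΩ hψL hψL'
    have a1 := h1 ψ hψ hψc hψΩ hψL hψL'
    have pz := (pair_bound A (z n) (hz n) (hzi n) ψ hψ L hL.le hψL').2.1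
    have py := (pair_bound A (y n) (hy n) (hyi n) ψ hψ L hL.le hψL').2.1
    have pd := (pair_bound A (fun x => z n x - y n x) ((hz n).sub (hy n)) (fun q => (hzi n q).sub (hyi n q)) ψ hψ L hL.le hψL').2.2
    rw [← integral_finsetSum _ fun i _ => pz i] at a1
    have e : ∫ x in Ω, ∑ i, (A i *ᵥ y n x) ⬝ᵥ fderiv ℝ ψ x (Pi.single i 1)
        = (∫ x in Ω, ∑ i, (A i *ᵥ z n x) ⬝ᵥ fderiv ℝ ψ x (Pi.single i 1))
          - ∫ x in Ω, ∑ i, (A i *ᵥ (z n x - y n x)) ⬝ᵥ fderiv ℝ ψ x (Pi.single i 1) := by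
      have e' : ∀ x, ∑ i, (A i *ᵥ (z n x - y n x)) ⬝ᵥ fderiv ℝ ψ x (Pi.single i 1)
          = ∑ i, (A i *ᵥ z n x) ⬝ᵥ fderiv ℝ ψ x (Pi.single i 1) - ∑ i, (A i *ᵥ y n x) ⬝ᵥ fderiv ℝ ψ x (Pi.single i 1) := by
        intro x
        simp only [Matrix.mulVec_sub, sub_dotProduct, Finset.sum_sub_distrib]
      simp only [e']
      rw [integral_sub (integrable_finsetSum _ fun i _ => pz i) (integrable_finsetSum _ fun i _ => py i)]
      ring
    rw [e]
    refine (abs_sub _ _).trans ?_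
    have := pd.trans h2.le
    linarith
  -- step 2: w term vanishes
  have s2 : ∀ ψ : V3 → Fin l → ℝ, ContDiff ℝ (⊤ : ℕ∞) ψ → HasCompactSupport ψ →
      tsupport ψ ⊆ Ω → ∀ L > 0, (∀ x p, |ψ x p| ≤ L) → (∀ x i p, |fderiv ℝ ψ x (Pi.single i 1) p| ≤ L) →
      ∫ x in Ω, ∑ i, (A i *ᵥ w x) ⬝ᵥ fderiv ℝ ψ x (Pi.single i 1) = 0 := by
    intro ψ hψ hψc hψΩ L hL hψL hψL'
    have t1 : Tendsto (fun n => ∫ x in Ω, ∑ i, (A i *ᵥ y n x) ⬝ᵥ fderiv ℝ ψ x (Pi.single i 1)) atTop (𝓝 0) := by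
      rw [Metric.tendsto_atTop']
      intro ε hε
      obtain ⟨N, hN⟩ := eventually_atTop.1 (s1 L hL (ε / 2) (half_pos hε))
      refine ⟨N, fun n hn => ?_⟩
      rw [Real.dist_eq, sub_zero]
      have := hN n hn.le ψ hψ hψc hψΩ hψL hψL'
      linarith
    have t2 : Tendsto (fun n => ∑ i, ∑ p, ∫ x in Ω, fderiv ℝ ψ x (Pi.single i 1) p * (A i p ⬝ᵥ (y n x - w x))) atTop (𝓝 0) := by
      have : Tendsto (fun n => ∑ i : Fin 3, ∑ p : Fin l, ∫ x in Ω, fderiv ℝ ψ x (Pi.single i 1) p * (A i p ⬝ᵥ (y n x - w x))) atTop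
          (𝓝 (∑ i : Fin 3, ∑ p : Fin l, (0 : ℝ))) := by
        refine tendsto_finsetSum _ fun i _ => tendsto_finsetSum _ fun p _ => ?_
        refine hwk (A i p) (fun x => fderiv ℝ ψ x (Pi.single i 1) p) ?_ ⟨L, fun x => hψL' x i p⟩
        exact (measurable_pi_apply p).comp ((hψ.continuous_fderiv (by simp)).clm_apply continuous_const).measurable
      simpa using this
    have t3 := t1.sub t2
    rw [sub_zero] at t3
    refine tendsto_nhds_unique (tendsto_const_nhds.congr fun n => ?_) t3
    have py := (pair_bound A (y n) (hy n) (hyi n) ψ hψ L hL.le hψL').2.1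
    have pw := (pair_bound A w hw hwi ψ hψ L hL.le hψL').2.1
    have pd := (pair_bound A (fun x => y n x - w x) ((hy n).sub hw) (fun q => (hyi n q).sub (hwi q)) ψ hψ L hL.le hψL').1
    have e1 : ∑ i, ∑ p, ∫ x in Ω, fderiv ℝ ψ x (Pi.single i 1) p * (A i p ⬝ᵥ (y n x - w x))
        = ∫ x in Ω, (∑ i, (A i *ᵥ y n x) ⬝ᵥ fderiv ℝ ψ x (Pi.single i 1) - ∑ i, (A i *ᵥ w x) ⬝ᵥ fderiv ℝ ψ x (Pi.single i 1)) := by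
      have : ∀ i, ∑ p, ∫ x in Ω, fderiv ℝ ψ x (Pi.single i 1) p * (A i p ⬝ᵥ (y n x - w x))
          = ∫ x in Ω, ∑ p, fderiv ℝ ψ x (Pi.single i 1) p * (A i p ⬝ᵥ (y n x - w x)) := fun i =>
        (integral_finsetSum _ fun p _ => pd i p).symm
      simp only [this]
      rw [← integral_finsetSum _ fun i _ => integrable_finsetSum _ fun p _ => pd i p]
      congr 1; ext x
      rw [← Finset.sum_sub_distrib]
      refine Finset.sum_congr rfl fun i _ => ?_
      rw [← sub_dotProduct, ← Matrix.mulVec_sub, dotProduct]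
      exact Finset.sum_congr rfl fun p _ => mul_comm _ _
    rw [e1, integral_sub (integrable_finsetSum _ fun i _ => py i) (integrable_finsetSum _ fun i _ => pw i)]
    ring
  intro L hL ε hε
  filter_upwards [s1 L hL ε hε] with n hn ψ hψ hψc hψΩ hψL hψL'
  have py := (pair_bound A (y n) (hy n) (hyi n) ψ hψ L hL.le hψL').2.1
  have pw := (pair_bound A w hw hwi ψ hψ L hL.le hψL').2.1
  have e' : ∀ x, ∑ i, (A i *ᵥ (y n x - w x)) ⬝ᵥ fderiv ℝ ψ x (Pi.single i 1)
      = ∑ i, (A i *ᵥ y n x) ⬝ᵥ fderiv ℝ ψ x (Pi.single i 1) - ∑ i, (A i *ᵥ w x) ⬝ᵥ fderiv ℝ ψ x (Pi.single i 1) := by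
    intro x
    simp only [Matrix.mulVec_sub, sub_dotProduct, Finset.sum_sub_distrib]
  simp only [e']
  rw [integral_sub (integrable_finsetSum _ fun i _ => py i) (integrable_finsetSum _ fun i _ => pw i),
    s2 ψ hψ hψc hψΩ L hL hψL hψL', sub_zero]
  exact hn ψ hψ hψc hψΩ hψL hψL'

theorem trunc_l1 {m : ℕ} {μ : Measure V3} [IsFiniteMeasure μ] {z : ℕ → V3 → Fin m → ℝ} {ν : V3 → Measure (Fin m → ℝ)}
    (hgen : GeneratesYM μ z ν) (hzi : ∀ n, Integrable (z n) μ) (hequi : UnifIntegrable z 1 μ)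
    (R : ℝ) (hR : 0 ≤ R) (hν : ∀ᵐ x ∂μ, ∀ᵐ ξ ∂(ν x), ∀ k, |ξ k| ≤ R) (k : Fin m) :
    Tendsto (fun n => ∫ x, |z n x k - clipR R (z n x k)| ∂μ) atTop (𝓝 0) := by
  have hk : Continuous fun ξ : Fin m → ℝ => |ξ k - clipR R (ξ k)| :=
    ((continuous_apply k).sub ((clipR_cont R).comp (continuous_apply k))).abs
  have hle : ∀ ξ : Fin m → ℝ, |ξ k - clipR R (ξ k)| ≤ ‖ξ‖ := fun ξ =>
    (clipR_sub hR _).trans (norm_le_pi_norm ξ k)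
  have key := (hgen _ hk (fun n => ?_) ?_).2 (fun _ => 1) measurable_const ⟨1, fun _ => by simp⟩
  · have : ∫ x, (1 : ℝ) * ∫ ξ, |ξ k - clipR R (ξ k)| ∂(ν x) ∂μ = 0 := by
      rw [← integral_zero V3 ℝ (μ := μ)]
      refine integral_congr_ae ?_
      filter_upwards [hν] with x hx
      rw [one_mul, integral_eq_zero_of_ae]
      filter_upwards [hx] with ξ hξ
      simp [clipR_eq (hξ k)]
    rw [this] at key
    simpa using key
  · refine (hzi n).mono (hk.comp_aestronglyMeasurable (hzi n).1) (ae_of_all _ fun x => ?_)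
    rw [Real.norm_eq_abs, abs_abs]; exact hle _
  · intro ε hε
    obtain ⟨δ, hδ, h⟩ := hequi hε
    refine ⟨δ, hδ, fun n s hs hμ => (eLpNorm_mono fun x => ?_).trans (h n s hs hμ)⟩
    by_cases hx : x ∈ s
    · simp only [Set.indicator_of_mem hx, Real.norm_eq_abs, abs_abs]; exact hle _
    · simp [Set.indicator_of_notMem hx]

end Part15

/-- **rigidity for non-constant states, Theorem 2.1 of the paper.**
Let `Ω ⊂ ℝ³` be an open bounded domain, `1 ≤ p < ∞`, `𝒜` a first-order
constant-coefficient constant-rank operator with `l ≥ 3` rows and wave cone `Λ`, and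
`z̄₁, z̄₂ ∈ L^∞(Ω; ℝ^m)` with `z̄₂ − z̄₁ ∉ Λ` a.e. If `(zₙ)` is an equi-integrable
sequence, bounded in `L^p(Ω)`, with `𝒜zₙ → 0` in `W^{−1,r}(Ω)` for some `r ∈ (1, 3/2)`,
generating a compactly supported Young measure `(ν_x)` with
`supp ν_x ⊆ [z̄₁(x), z̄₂(x)]` a.e., then `ν_x = δ_{w(x)}` a.e. for some `w ∈ L¹(Ω; ℝ^m)`
and `zₙ → w` strongly in `L¹(Ω)`. -/
theorem rigidity_nonconstant_states {l m : ℕ} (hl : 3 ≤ l)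
    (Ω : Set (Fin 3 → ℝ)) (hΩopen : IsOpen Ω) (hΩbdd : IsBounded Ω)
    (p : ℝ) (hp : 1 ≤ p)
    (A : Fin 3 → Matrix (Fin l) (Fin m) ℝ)
    (hrank : ∃ k : ℕ, ∀ ξ : Fin 3 → ℝ, ξ ≠ 0 → (∑ i : Fin 3, ξ i • A i).rank = k)
    (zb₁ zb₂ : (Fin 3 → ℝ) → Fin m → ℝ)
    (hzb₁meas : Measurable zb₁) (hzb₂meas : Measurable zb₂)
    (hzb₁bdd : ∃ C : ℝ, ∀ᵐ x ∂(volume.restrict Ω), ‖zb₁ x‖ ≤ C)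
    (hzb₂bdd : ∃ C : ℝ, ∀ᵐ x ∂(volume.restrict Ω), ‖zb₂ x‖ ≤ C)
    (hΛ : ∀ᵐ x ∂(volume.restrict Ω), zb₂ x - zb₁ x ∉ waveCone A)
    (z : ℕ → (Fin 3 → ℝ) → Fin m → ℝ) (hmeas : ∀ n, Measurable (z n))
    (hequi : UnifIntegrable z 1 (volume.restrict Ω))
    (c : ℝ) (hbdd : ∀ n, eLpNorm (z n) (ENNReal.ofReal p) (volume.restrict Ω)
      ≤ ENNReal.ofReal c)
    (r r' : ℝ) (hr : 1 < r) (hr32 : r < 3 / 2) (hconj : 1/r + 1/r' = 1)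
    (hW : AconvergesToZeroWminusOneR Ω A r' z)
    (ν : (Fin 3 → ℝ) → Measure (Fin m → ℝ))
    (hYM : IsYoungMeasure (volume.restrict Ω) ν)
    (K : Set (Fin m → ℝ)) (hK : IsCompact K)
    (hsuppK : ∀ᵐ x ∂(volume.restrict Ω), ν x Kᶜ = 0)
    (hgen : GeneratesYM (volume.restrict Ω) z ν)
    (hsupp : ∀ᵐ x ∂(volume.restrict Ω), ν x (segment ℝ (zb₁ x) (zb₂ x))ᶜ = 0) :
    ∃ w : (Fin 3 → ℝ) → Fin m → ℝ,
      Integrable w (volume.restrict Ω) ∧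
      (∀ᵐ x ∂(volume.restrict Ω), ν x = MeasureTheory.Measure.dirac (w x)) ∧
      Tendsto (fun n => eLpNorm (fun x => z n x - w x) 1 (volume.restrict Ω))
        atTop (𝓝 0) := by
  have hfin : IsFiniteMeasure (volume.restrict Ω) := ⟨by
    rw [Measure.restrict_apply_univ]; exact hΩbdd.measure_lt_top⟩
  obtain ⟨R, hR0, hKR⟩ : ∃ R : ℝ, 0 ≤ R ∧ ∀ ξ ∈ K, ∀ k, |ξ k| ≤ R := by
    obtain ⟨R, hR⟩ := hK.isBounded.exists_norm_le
    refine ⟨max R 0, le_max_right _ _, fun ξ hξ k => ?_⟩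
    exact (norm_le_pi_norm ξ k).trans ((hR ξ hξ).trans (le_max_left _ _))
  have hνK : ∀ᵐ x ∂(volume.restrict Ω), ∀ᵐ ξ ∂(ν x), ∀ k, |ξ k| ≤ R := by
    filter_upwards [hsuppK] with x hx
    rw [ae_iff]
    refine measure_mono_null (fun ξ hξ hξK => hξ (hKR ξ hξK)) hx
  have hzi : ∀ n, Integrable (z n) (volume.restrict Ω) := fun n => by
    have h1 : MemLp (z n) (ENNReal.ofReal p) (volume.restrict Ω) :=
      ⟨(hmeas n).aestronglyMeasurable, (hbdd n).trans_lt ENNReal.ofReal_lt_top⟩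
    exact h1.integrable (by rw [← ENNReal.ofReal_one]; exact ENNReal.ofReal_le_ofReal hp)
  -- truncation
  set T : (Fin m → ℝ) → Fin m → ℝ := fun ξ k => clipR R (ξ k) with hT
  have hTc : Continuous T := continuous_pi fun k => (clipR_cont R).comp (continuous_apply k)
  have hTR : ∀ ξ k, |T ξ k| ≤ R := fun ξ k => clipR_abs hR0 _
  have hXc : ∀ a : Fin m → ℝ, Continuous fun ξ => a ⬝ᵥ T ξ := fun a =>
    continuous_finsetSum _ fun k _ => continuous_const.mul ((continuous_apply k).comp hTc)
  have hXb : ∀ (a : Fin m → ℝ) ξ, |a ⬝ᵥ T ξ| ≤ (∑ k, |a k|) * R := fun a ξ => dot_bound a _ R (hTR ξ)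
  set y : ℕ → (Fin 3 → ℝ) → Fin m → ℝ := fun n x => T (z n x) with hy
  have hym : ∀ n, Measurable (y n) := fun n => hTc.measurable.comp (hmeas n)
  have hyR : ∀ n x k, |y n x k| ≤ R := fun n x k => hTR _ _
  set w : (Fin 3 → ℝ) → Fin m → ℝ := fun x k => clipR R (∫ ξ, T ξ k ∂(ν x)) with hw
  have hwm : Measurable w := by
    refine measurable_pi_lambda _ fun k => (clipR_cont R).measurable.comp ?_
    have := hYM.2 (BoundedContinuousFunction.ofNormedAddCommGroup (fun ξ => T ξ k)
      ((continuous_apply k).comp hTc) R fun ξ => hTR ξ k)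
    exact this
  have hwR : ∀ x k, |w x k| ≤ R := fun x k => clipR_abs hR0 _
  have hprob := hYM.1
  have hTi : ∀ x, IsProbabilityMeasure (ν x) → ∀ k, Integrable (fun ξ => T ξ k) (ν x) := fun x _ k =>
    Integrable.of_bound ((continuous_apply k).comp hTc).aestronglyMeasurable R (ae_of_all _ fun ξ => hTR ξ k)
  have hwk : ∀ x, IsProbabilityMeasure (ν x) → ∀ k, w x k = ∫ ξ, T ξ k ∂(ν x) := by
    intro x hx k
    refine clipR_eq ?_
    have := norm_integral_le_of_norm_le_const (μ := ν x) (f := fun ξ => T ξ k) (C := R) (ae_of_all _ fun ξ => hTR ξ k)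
    simpa using this
  have hwa : ∀ x, IsProbabilityMeasure (ν x) → ∀ a : Fin m → ℝ, a ⬝ᵥ w x = ∫ ξ, a ⬝ᵥ T ξ ∂(ν x) := by
    intro x hx a
    simp only [dotProduct]
    rw [integral_finsetSum _ fun k _ => (hTi x hx k).const_mul (a k)]
    refine Finset.sum_congr rfl fun k _ => ?_
    rw [integral_const_mul, hwk x hx k]
  have hwab : ∀ (a : Fin m → ℝ) x, |a ⬝ᵥ w x| ≤ (∑ k, |a k|) * R := fun a x => dot_bound a _ R (hwR x)
  -- weak limits
  have hlin : ∀ (a : Fin m → ℝ) (g : V3 → ℝ), Measurable g → (∃ C, ∀ x, |g x| ≤ C) →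
      Tendsto (fun n => ∫ x in Ω, g x * (a ⬝ᵥ y n x)) atTop (𝓝 (∫ x in Ω, g x * (a ⬝ᵥ w x))) := by
    intro a g hg hgb
    have h := (gen_bdd hgen hmeas _ (hXc a) _ (hXb a)).2 g hg hgb
    have e : ∫ x in Ω, g x * (a ⬝ᵥ w x) = ∫ x in Ω, g x * ∫ ξ, a ⬝ᵥ T ξ ∂(ν x) := by
      refine integral_congr_ae ?_
      filter_upwards [hprob] with x hx
      rw [hwa x hx]
    rw [e]; exact h
  have hsqb : ∀ (a : Fin m → ℝ) ξ, |(a ⬝ᵥ T ξ) ^ 2| ≤ ((∑ k, |a k|) * R) ^ 2 := fun a ξ => by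
    rw [abs_pow]; exact pow_le_pow_left₀ (abs_nonneg _) (hXb a ξ) 2
  have hquad := fun a : Fin m → ℝ => gen_bdd hgen hmeas _ ((hXc a).pow 2) _ (hsqb a)
  set V : (Fin m → ℝ) → V3 → ℝ := fun a x => (∫ ξ, (a ⬝ᵥ T ξ) ^ 2 ∂(ν x)) - (a ⬝ᵥ w x) ^ 2 with hVdef
  have hwi : ∀ a : Fin m → ℝ, Measurable fun x => a ⬝ᵥ w x := fun a => dot_measurable a w hwm
  have hweak : ∀ (a : Fin m → ℝ) (g : V3 → ℝ), Measurable g → (∃ C, ∀ x, |g x| ≤ C) →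
      Tendsto (fun n => ∫ x in Ω, g x * (a ⬝ᵥ (y n x - w x))) atTop (𝓝 0) := by
    intro a g hg hgb
    have h := (hlin a g hg hgb).sub_const (∫ x in Ω, g x * (a ⬝ᵥ w x))
    rw [sub_self] at h
    refine h.congr fun n => ?_
    obtain ⟨C, hC⟩ := hgb
    rw [← integral_sub]
    · congr 1; ext x; rw [dotProduct_sub]; ring
    · exact bdd_int (hg.mul (dot_measurable a _ (hym n))) fun x => abs_mul_le' (hC x) (dot_bound a _ R (hyR n x))
    · exact bdd_int (hg.mul (hwi a)) fun x => abs_mul_le' (hC x) (hwab a x)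
  have hvar : ∀ (a : Fin m → ℝ) (g : V3 → ℝ), Measurable g → (∃ C, ∀ x, |g x| ≤ C) →
      Tendsto (fun n => ∫ x in Ω, g x * (a ⬝ᵥ (y n x - w x)) ^ 2) atTop (𝓝 (∫ x in Ω, g x * V a x)) := by
    intro a g hg hgb
    have h := var_limit (μ := volume.restrict Ω) (fun n x => a ⬝ᵥ y n x) (fun x => a ⬝ᵥ w x) (fun x => ∫ ξ, (a ⬝ᵥ T ξ) ^ 2 ∂(ν x))
      (fun n => dot_measurable a _ (hym n)) (hwi a) _ (fun n x => dot_bound a _ R (hyR n x)) (hwab a) (hquad a).1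
      (hlin a) (hquad a).2 g hg hgb
    refine h.congr fun n => ?_
    congr 1; ext x; rw [dotProduct_sub]
  have hzy : ∀ q, Tendsto (fun n => ∫ x in Ω, |z n x q - y n x q|) atTop (𝓝 0) := fun q =>
    trunc_l1 hgen hzi hequi R hR0 hνK q
  have hVx : ∀ x, IsProbabilityMeasure (ν x) → ∀ a α, Integrable (fun ξ => (a ⬝ᵥ T ξ - α) ^ 2) (ν x) ∧
      ∫ ξ, (a ⬝ᵥ T ξ - α) ^ 2 ∂(ν x) = V a x + (a ⬝ᵥ w x - α) ^ 2 := by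
    intro x hx a α
    have := var_expand (ν x) _ (hXc a) _ (hXb a) α
    rw [← hwa x hx] at this
    exact this
  -- direction field
  obtain ⟨C₁, hC₁⟩ := hzb₁bdd
  obtain ⟨C₂, hC₂⟩ := hzb₂bdd
  set M : ℝ := max (2 * R) (max 0 (C₂ + C₁)) with hM
  set v : V3 → Fin m → ℝ := fun x => if ‖zb₂ x - zb₁ x‖ ≤ C₂ + C₁ then zb₂ x - zb₁ x else 0 with hv
  have hvae : ∀ᵐ x ∂(volume.restrict Ω), v x = zb₂ x - zb₁ x := by
    filter_upwards [hC₁, hC₂] with x h1 h2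
    simp only [hv]
    rw [if_pos]
    exact (norm_sub_le _ _).trans (add_le_add h2 h1)
  have P : RigPkg Ω A (fun n x => y n x - w x) M V v := by
    refine ⟨hΩopen, fun n => (hym n).sub hwm, ?_, hweak, hvar, ?_, ?_, ?_, ?_, ?_, ?_, ?_⟩
    · intro n x k
      refine le_trans ?_ (le_max_left _ _)
      refine (abs_sub _ _).trans ?_
      linarith [hyR n x k, hwR x k]
    · intro a
      refine Integrable.sub (hquad a).1 (bdd_int ((hwi a).pow_const 2) (C := ((∑ k, |a k|) * R) ^ 2) fun x => ?_)
      rw [abs_pow]; exact pow_le_pow_left₀ (abs_nonneg _) (hwab a x) 2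
    · intro a
      filter_upwards [hprob] with x hx
      have := (hVx x hx a (a ⬝ᵥ w x)).2
      rw [sub_self] at this
      have h0 : 0 ≤ ∫ ξ, (a ⬝ᵥ T ξ - a ⬝ᵥ w x) ^ 2 ∂(ν x) := integral_nonneg fun ξ => sq_nonneg _
      linarith
    · intro a
      filter_upwards [hprob, hsupp, hνK, hvae] with x hx hs hk hvx
      have hh := hVx x hx a (a ⬝ᵥ zb₁ x)
      have h1 : V a x ≤ ∫ ξ, (a ⬝ᵥ T ξ - a ⬝ᵥ zb₁ x) ^ 2 ∂(ν x) := by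
        rw [hh.2]; linarith [sq_nonneg (a ⬝ᵥ w x - a ⬝ᵥ zb₁ x)]
      refine h1.trans ?_
      have h2 : ∫ ξ, (a ⬝ᵥ T ξ - a ⬝ᵥ zb₁ x) ^ 2 ∂(ν x) ≤ ∫ ξ, (a ⬝ᵥ v x) ^ 2 ∂(ν x) := by
        refine integral_mono_ae hh.1 (integrable_const _) ?_
        have hs' : ∀ᵐ ξ ∂(ν x), ξ ∈ segment ℝ (zb₁ x) (zb₂ x) := by
          rw [ae_iff]; exact hs
        filter_upwards [hs', hk] with ξ hξ hξR
        have hTξ : T ξ = ξ := by ext k; exact clipR_eq (hξR k)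
        rw [segment_eq_image'] at hξ
        obtain ⟨θ, hθ, rfl⟩ := hξ
        simp only at hTξ ⊢
        rw [hTξ, hvx, dotProduct_add, dotProduct_smul, smul_eq_mul, add_sub_cancel_left, mul_pow]
        have : θ ^ 2 ≤ 1 := pow_le_one₀ hθ.1 hθ.2
        exact mul_le_of_le_one_left (sq_nonneg _) this
      refine h2.trans (le_of_eq ?_)
      simp
    · exact Measurable.ite (measurableSet_le (hzb₂meas.sub hzb₁meas).norm measurable_const) (hzb₂meas.sub hzb₁meas) measurable_const
    · intro x
      refine le_trans ?_ (le_max_right _ _)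
      simp only [hv]
      split_ifs with h
      · exact h.trans (le_max_right _ _)
      · simp
    · intro t a x
      simp only [hVdef, smul_dotProduct, smul_eq_mul, mul_pow]
      rw [integral_const_mul]; ring
    · exact hT_of A z y w R hmeas hym hwm (fun n q => (hzi n).eval q) hyR hwR hzy hweak (test_scale hΩbdd A z r' hW)
  have hvΛ : ∀ᵐ x ∂(volume.restrict Ω), v x ∉ waveCone A := by
    filter_upwards [hvae, hΛ] with x h1 h2
    rwa [h1]
  have hrig := fun k => local_rig P hvΛ k
  have hwint : Integrable w (volume.restrict Ω) := by
    refine Integrable.of_bound hwm.aestronglyMeasurable R (ae_of_all _ fun x => ?_)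
    exact (pi_norm_le_iff_of_nonneg hR0).2 fun k => hwR x k
  refine ⟨w, hwint, ?_, ?_⟩
  · filter_upwards [hprob, hνK, ae_all_iff.2 hrig] with x hx hk h0
    refine dirac_of_ae _ _ ?_
    have h1 : ∀ k, ∀ᵐ ξ ∂(ν x), T ξ k = w x k := by
      intro k
      have hh := hVx x hx (Pi.single k 1) (Pi.single k 1 ⬝ᵥ w x)
      rw [h0 k, sub_self] at hh
      have h2 := (integral_eq_zero_iff_of_nonneg (fun ξ => sq_nonneg _) hh.1).1 (by rw [hh.2]; simp)
      filter_upwards [h2] with ξ hξ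
      simp only [Pi.zero_apply, single_one_dotProduct] at hξ
      have := pow_eq_zero_iff (two_ne_zero) |>.1 hξ
      linarith
    filter_upwards [ae_all_iff.2 h1, hk] with ξ hξ hξR
    ext k
    rw [← hξ k]
    exact (clipR_eq (hξR k)).symm
  · -- strong convergence
    have hD : ∀ k, Tendsto (fun n => ∫ x in Ω, |y n x k - w x k|) atTop (𝓝 0) := by
      intro k
      have h1 := hvar (Pi.single k 1) (fun _ => 1) measurable_const ⟨1, fun _ => by simp⟩
      have h2 : ∫ x in Ω, (1 : ℝ) * V (Pi.single k 1) x = 0 := by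
        rw [← integral_zero V3 ℝ (μ := volume.restrict Ω)]
        refine integral_congr_ae ?_
        filter_upwards [hrig k] with x hx
        rw [hx, mul_zero]
      rw [h2] at h1
      simp only [one_mul, single_one_dotProduct, Pi.sub_apply] at h1
      have h3 := ((Real.continuous_sqrt.tendsto 0).comp h1).const_mul (Real.sqrt (∫ x in Ω, (1 : ℝ) ^ 2))
      rw [Real.sqrt_zero, mul_zero] at h3
      refine squeeze_zero (fun n => integral_nonneg fun x => abs_nonneg _) (fun n => ?_) h3
      have hm : Measurable fun x => y n x k - w x k :=
        ((measurable_pi_apply k).comp (hym n)).sub ((measurable_pi_apply k).comp hwm)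
      have := (cs_int (μ := volume.restrict Ω) (f := fun _ => (1 : ℝ)) (g := fun x => y n x k - w x k)
        measurable_const.aestronglyMeasurable hm.aestronglyMeasurable (by simp)
        (bdd_int (hm.pow_const 2) (C := (2 * R) ^ 2) fun x => by
          rw [abs_pow]
          refine pow_le_pow_left₀ (abs_nonneg _) ((abs_sub _ _).trans ?_) 2
          linarith [hyR n x k, hwR x k])).2
      simpa using this
    have hsum : Tendsto (fun n => ∑ k, ((∫ x in Ω, |z n x k - y n x k|) + ∫ x in Ω, |y n x k - w x k|)) atTop (𝓝 0) := by
      have := tendsto_finsetSum Finset.univ fun k _ => (hzy k).add (hD k)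
      simpa using this
    have hsum' := ENNReal.tendsto_ofReal hsum
    rw [ENNReal.ofReal_zero] at hsum'
    refine tendsto_of_tendsto_of_tendsto_of_le_of_le tendsto_const_nhds hsum' (fun n => bot_le) fun n => ?_
    have hyi : ∀ k, Integrable (fun x => y n x k) (volume.restrict Ω) := fun k =>
      bdd_int ((measurable_pi_apply k).comp (hym n)) fun x => hyR n x k
    have hi1 : ∀ k, Integrable (fun x => |z n x k - y n x k|) (volume.restrict Ω) := fun k =>
      (((hzi n).eval k).sub (hyi k)).abs
    have hi2 : ∀ k, Integrable (fun x => |y n x k - w x k|) (volume.restrict Ω) := fun k =>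
      ((hyi k).sub (hwint.eval k)).abs
    change eLpNorm (fun x => z n x - w x) 1 (volume.restrict Ω) ≤ _
    have hzw : Integrable (fun x => z n x - w x) (volume.restrict Ω) := (hzi n).sub hwint
    rw [eLpNorm_one_eq_lintegral_enorm, ← ofReal_integral_norm_eq_lintegral_enorm hzw]
    refine ENNReal.ofReal_le_ofReal ?_
    have e : ∑ k, ((∫ x in Ω, |z n x k - y n x k|) + ∫ x in Ω, |y n x k - w x k|)
        = ∫ x in Ω, ∑ k, (|z n x k - y n x k| + |y n x k - w x k|) := by
      have hi3 : ∀ k, Integrable (fun x => |z n x k - y n x k| + |y n x k - w x k|) (volume.restrict Ω) :=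
        fun k => (hi1 k).add (hi2 k)
      rw [integral_finsetSum _ fun k _ => hi3 k]
      exact Finset.sum_congr rfl fun k _ => (integral_add (hi1 k) (hi2 k)).symm
    rw [e]
    refine integral_mono hzw.norm (integrable_finsetSum _ fun k _ => (hi1 k).add (hi2 k)) fun x => ?_
    refine (pi_norm_le_iff_of_nonneg (Finset.sum_nonneg fun k _ => add_nonneg (abs_nonneg _) (abs_nonneg _))).2 fun k => ?_
    refine le_trans ?_ (Finset.single_le_sum (f := fun k => |z n x k - y n x k| + |y n x k - w x k|)
      (fun k _ => add_nonneg (abs_nonneg _) (abs_nonneg _)) (Finset.mem_univ k))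
    exact abs_sub_le (z n x k) (y n x k) (w x k)
end

section
/- Let γ > 0, γ ≠ 1. The constant-in-(t,x) family of probability measures ν_{t,x} = ½ δ_{(1, (1,0), 3/2)} + ½ δ_{(γ, (1,0), 3/(2γ))} on the state space (ξ_ρ, ξ_m, ξ_E) ∈ ℝ⁺×ℝ²×ℝ⁺ is a measure-valued solution of the full compressible Euler system with the constant initial data ρ⁰ = (1+γ)/2, m⁰ = (1, 0), E⁰ = (3/2 + 3/(2γ))/2. -/
open MeasureTheory Filter Topology Bornology

noncomputable section

/-- A space-time point `(t, x₁, x₂) ∈ ℝ × ℝ²`. -/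
abbrev SpaceTime : Type := ℝ × ℝ × ℝ

/-- The state space of the full Euler system in conservative variables:
`(ξ_ρ, ξ_m, ξ_E) ∈ ℝ × ℝ² × ℝ`. -/
abbrev EulerState : Type := ℝ × (ℝ × ℝ) × ℝ

/-- The time slab `(0,T) × ℝ²`. -/
def slab (T : ℝ) : Set SpaceTime := {p | 0 < p.1 ∧ p.1 < T}

/-- Smooth test functions compactly supported in `[0,T) × ℝ²`. -/
def IsTest (T : ℝ) (φ : SpaceTime → ℝ) : Prop :=
  ContDiff ℝ (⊤ : ℕ∞) φ ∧ HasCompactSupport φ ∧ tsupport φ ⊆ {p : SpaceTime | p.1 < T}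

/-- Time derivative `∂_t φ`. -/
def dT (φ : SpaceTime → ℝ) (p : SpaceTime) : ℝ := fderiv ℝ φ p (1, 0, 0)

/-- Spatial derivative `∂_{x₁} φ`. -/
def dX1 (φ : SpaceTime → ℝ) (p : SpaceTime) : ℝ := fderiv ℝ φ p (0, 1, 0)

/-- Spatial derivative `∂_{x₂} φ`. -/
def dX2 (φ : SpaceTime → ℝ) (p : SpaceTime) : ℝ := fderiv ℝ φ p (0, 0, 1)

/-- The momentum flux `m ⊗ m / ρ + 𝕀 (E - ½|m|²/ρ)`, `(1,1)` entry. -/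
def flux11 (ξ : EulerState) : ℝ :=
  ξ.2.1.1 ^ 2 / ξ.1 + (ξ.2.2 - (ξ.2.1.1 ^ 2 + ξ.2.1.2 ^ 2) / (2 * ξ.1))

/-- The momentum flux, `(1,2)` (= `(2,1)`) entry. -/
def flux12 (ξ : EulerState) : ℝ := ξ.2.1.1 * ξ.2.1.2 / ξ.1

/-- The momentum flux, `(2,2)` entry. -/
def flux22 (ξ : EulerState) : ℝ :=
  ξ.2.1.2 ^ 2 / ξ.1 + (ξ.2.2 - (ξ.2.1.1 ^ 2 + ξ.2.1.2 ^ 2) / (2 * ξ.1))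

/-- The energy flux `(2E - ½|m|²/ρ) m/ρ`, first component. -/
def fluxE1 (ξ : EulerState) : ℝ :=
  (2 * ξ.2.2 - (ξ.2.1.1 ^ 2 + ξ.2.1.2 ^ 2) / (2 * ξ.1)) * (ξ.2.1.1 / ξ.1)

/-- The energy flux, second component. -/
def fluxE2 (ξ : EulerState) : ℝ :=
  (2 * ξ.2.2 - (ξ.2.1.1 ^ 2 + ξ.2.1.2 ^ 2) / (2 * ξ.1)) * (ξ.2.1.2 / ξ.1)

/-- A weak solution of the full compressible Euler system (ideal gas, `c_v = 1`) on
`(0,T) × ℝ²` with initial data `(ρ⁰, m⁰, E⁰)`: a locally bounded measurable triple,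
`ρ > 0` a.e., satisfying the three integral identities against all test functions. -/
structure IsWeakSolution (T : ℝ) (ρ : SpaceTime → ℝ) (m : SpaceTime → ℝ × ℝ)
    (E : SpaceTime → ℝ) (ρ0 : ℝ × ℝ → ℝ) (m0 : ℝ × ℝ → ℝ × ℝ) (E0 : ℝ × ℝ → ℝ) : Prop where
  meas_ρ : Measurable ρ
  meas_m : Measurable m
  meas_E : Measurable E
  locBdd : ∀ K : Set SpaceTime, IsCompact K →
    ∃ C : ℝ, ∀ᵐ p ∂(volume.restrict K), |ρ p| + ‖m p‖ + |E p| ≤ C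
  pos_ρ : ∀ᵐ p : SpaceTime, 0 < ρ p
  mass : ∀ φ : SpaceTime → ℝ, IsTest T φ →
    (∫ p in slab T, (ρ p * dT φ p + (m p).1 * dX1 φ p + (m p).2 * dX2 φ p))
      + ∫ x : ℝ × ℝ, ρ0 x * φ (0, x) = 0
  mom1 : ∀ φ : SpaceTime → ℝ, IsTest T φ →
    (∫ p in slab T, ((m p).1 * dT φ p + flux11 (ρ p, m p, E p) * dX1 φ p
        + flux12 (ρ p, m p, E p) * dX2 φ p))
      + ∫ x : ℝ × ℝ, (m0 x).1 * φ (0, x) = 0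
  mom2 : ∀ φ : SpaceTime → ℝ, IsTest T φ →
    (∫ p in slab T, ((m p).2 * dT φ p + flux12 (ρ p, m p, E p) * dX1 φ p
        + flux22 (ρ p, m p, E p) * dX2 φ p))
      + ∫ x : ℝ × ℝ, (m0 x).2 * φ (0, x) = 0
  energy : ∀ φ : SpaceTime → ℝ, IsTest T φ →
    (∫ p in slab T, (E p * dT φ p + fluxE1 (ρ p, m p, E p) * dX1 φ p
        + fluxE2 (ρ p, m p, E p) * dX2 φ p))
      + ∫ x : ℝ × ℝ, E0 x * φ (0, x) = 0

/-- The list of all moments occurring in the definition of a measure-valued solution. -/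
def momentList : List (EulerState → ℝ) :=
  [fun ξ => ξ.1, fun ξ => ξ.2.1.1, fun ξ => ξ.2.1.2, fun ξ => ξ.2.2,
    flux11, flux12, flux22, fluxE1, fluxE2]

/-- A measure-valued solution of the full compressible Euler system on `(0,T) × ℝ²`
with initial data `(ρ⁰, m⁰, E⁰)`: a weakly*-measurable family of probability measures
on `ℝ⁺ × ℝ² × ℝ⁺`, with all occurring moments locally integrable, satisfying the three
integral identities with the nonlinearities replaced by the corresponding averages. -/
structure IsMVSolution (T : ℝ) (ν : SpaceTime → Measure EulerState)
    (ρ0 : ℝ × ℝ → ℝ) (m0 : ℝ × ℝ → ℝ × ℝ) (E0 : ℝ × ℝ → ℝ) : Prop where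
  prob : ∀ p : SpaceTime, IsProbabilityMeasure (ν p)
  supported : ∀ᵐ p : SpaceTime, ν p {ξ : EulerState | 0 < ξ.1 ∧ 0 < ξ.2.2}ᶜ = 0
  weakStarMeas : ∀ f : BoundedContinuousFunction EulerState ℝ,
    Measurable fun p : SpaceTime => ∫ ξ, f ξ ∂(ν p)
  momentsInt : ∀ g ∈ momentList, (∀ᵐ p : SpaceTime, Integrable g (ν p)) ∧
    LocallyIntegrable (fun p : SpaceTime => ∫ ξ, g ξ ∂(ν p)) volume
  mass : ∀ φ : SpaceTime → ℝ, IsTest T φ →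
    (∫ p in slab T, ((∫ ξ, ξ.1 ∂(ν p)) * dT φ p + (∫ ξ, ξ.2.1.1 ∂(ν p)) * dX1 φ p
        + (∫ ξ, ξ.2.1.2 ∂(ν p)) * dX2 φ p))
      + ∫ x : ℝ × ℝ, ρ0 x * φ (0, x) = 0
  mom1 : ∀ φ : SpaceTime → ℝ, IsTest T φ →
    (∫ p in slab T, ((∫ ξ, ξ.2.1.1 ∂(ν p)) * dT φ p + (∫ ξ, flux11 ξ ∂(ν p)) * dX1 φ p
        + (∫ ξ, flux12 ξ ∂(ν p)) * dX2 φ p))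
      + ∫ x : ℝ × ℝ, (m0 x).1 * φ (0, x) = 0
  mom2 : ∀ φ : SpaceTime → ℝ, IsTest T φ →
    (∫ p in slab T, ((∫ ξ, ξ.2.1.2 ∂(ν p)) * dT φ p + (∫ ξ, flux12 ξ ∂(ν p)) * dX1 φ p
        + (∫ ξ, flux22 ξ ∂(ν p)) * dX2 φ p))
      + ∫ x : ℝ × ℝ, (m0 x).2 * φ (0, x) = 0
  energy : ∀ φ : SpaceTime → ℝ, IsTest T φ →
    (∫ p in slab T, ((∫ ξ, ξ.2.2 ∂(ν p)) * dT φ p + (∫ ξ, fluxE1 ξ ∂(ν p)) * dX1 φ p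
        + (∫ ξ, fluxE2 ξ ∂(ν p)) * dX2 φ p))
      + ∫ x : ℝ × ℝ, E0 x * φ (0, x) = 0

/-- `(zₙ)` generates the parametrized (Young) measure `(ν_p)_{p ∈ (0,T)×ℝ²}`:
for every continuous `f` such that `(f(zₙ))` is an equi-integrable sequence in
`L¹((0,T)×ℝ²)`, one has `f(zₙ) ⇀ ⟨ν, f⟩` weakly in `L¹`. -/
def Generates (T : ℝ) (z : ℕ → SpaceTime → EulerState)
    (ν : SpaceTime → Measure EulerState) : Prop :=
  ∀ f : EulerState → ℝ, Continuous f →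
    (∀ n, Integrable (fun p => f (z n p)) (volume.restrict (slab T))) →
    UnifIntegrable (fun n p => f (z n p)) 1 (volume.restrict (slab T)) →
    Integrable (fun p => ∫ ξ, f ξ ∂(ν p)) (volume.restrict (slab T)) ∧
    ∀ g : SpaceTime → ℝ, Measurable g → (∃ C : ℝ, ∀ p, |g p| ≤ C) →
      Tendsto (fun n => ∫ p in slab T, g p * f (z n p)) atTop
        (𝓝 (∫ p in slab T, g p * ∫ ξ, f ξ ∂(ν p)))

end

lemma integrable_fderiv_test {T : ℝ} {φ : SpaceTime → ℝ} (h : IsTest T φ) (v : SpaceTime) :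
    Integrable (fun p => fderiv ℝ φ p v) (volume : Measure SpaceTime) :=
  ((h.1.continuous_fderiv (by simp)).clm_apply continuous_const).integrable_of_hasCompactSupport
    (h.2.1.fderiv_apply (𝕜 := ℝ) v)

lemma slab_measure (T : ℝ) : (volume : Measure SpaceTime).restrict (slab T)
    = ((volume : Measure ℝ).restrict (Set.Ioo 0 T)).prod (volume : Measure (ℝ × ℝ)) := by
  have hs : slab T = Set.Ioo 0 T ×ˢ (Set.univ : Set (ℝ × ℝ)) := by
    ext p; simp [slab]
  rw [hs, Measure.volume_eq_prod, ← Measure.prod_restrict, Measure.restrict_univ]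

lemma integral_slab_space {T : ℝ} {φ : SpaceTime → ℝ} (h : IsTest T φ) (w : ℝ × ℝ) :
    ∫ p in slab T, fderiv ℝ φ p (0, w) = 0 := by
  have hi := (integrable_fderiv_test h (0, w)).restrict (s := slab T)
  rw [slab_measure] at hi ⊢
  rw [integral_prod _ hi]
  have key : ∀ t : ℝ, ∫ x : ℝ × ℝ, fderiv ℝ φ (t, x) (0, w) = 0 := by
    intro t
    have hemb : IsClosedEmbedding (fun x : ℝ × ℝ => (t, x)) :=
      ⟨isEmbedding_prodMkRight t, by
        have : Set.range (fun x : ℝ × ℝ => (t, x)) = {p : SpaceTime | p.1 = t} := by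
          ext ⟨a, b⟩; simp [eq_comm]
        rw [this]; exact isClosed_eq continuous_fst continuous_const⟩
    have hψ : ContDiff ℝ (⊤ : ℕ∞) (fun x : ℝ × ℝ => φ (t, x)) :=
      h.1.comp (contDiff_const.prodMk contDiff_id)
    have hc : HasCompactSupport (fun x : ℝ × ℝ => φ (t, x)) :=
      h.2.1.comp_isClosedEmbedding hemb
    have hd : ∀ x, fderiv ℝ φ (t, x) (0, w) = fderiv ℝ (fun x : ℝ × ℝ => φ (t, x)) x w := by
      intro x
      have h1 : HasFDerivAt φ (fderiv ℝ φ (t, x)) (t, x) :=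
        (h.1.differentiable (by simp) _).hasFDerivAt
      have h2 := h1.comp x ((hasFDerivAt_const t x).prodMk (hasFDerivAt_id x))
      have h3 : fderiv ℝ (fun x : ℝ × ℝ => φ (t, x)) x = _ := h2.fderiv
      rw [h3]; simp
    simp_rw [hd]
    have hI : Integrable (fun x => fderiv ℝ (fun x : ℝ × ℝ => φ (t, x)) x w) :=
      ((hψ.continuous_fderiv (by simp)).clm_apply continuous_const).integrable_of_hasCompactSupport
        (hc.fderiv_apply (𝕜 := ℝ) w)
    have := integral_mul_fderiv_eq_neg_fderiv_mul_of_integrable (𝕜 := ℝ)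
      (μ := (volume : Measure (ℝ × ℝ)))
      (f := fun _ : ℝ × ℝ => (1 : ℝ)) (g := fun x : ℝ × ℝ => φ (t, x)) (v := w)
      (by simp) (by simpa using hI)
      (by simpa using hψ.continuous.integrable_of_hasCompactSupport hc)
      (fun x _ => differentiableAt_const _) (fun x _ => hψ.differentiable (by simp) x)
    simpa using this
  simp [key]

lemma integral_slab_time {T : ℝ} (hT : 0 < T) {φ : SpaceTime → ℝ} (h : IsTest T φ) :
    ∫ p in slab T, dT φ p = - ∫ x : ℝ × ℝ, φ (0, x) := by
  have hi : Integrable (dT φ) (volume.restrict (slab T)) :=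
    (integrable_fderiv_test h (1, 0, 0)).restrict (s := slab T)
  rw [slab_measure] at hi ⊢
  rw [integral_prod_symm _ hi, ← integral_neg]
  congr 1
  ext x
  rw [← integral_Ioc_eq_integral_Ioo, ← intervalIntegral.integral_of_le hT.le]
  have hder : ∀ t : ℝ, HasDerivAt (fun t => φ (t, x)) (dT φ (t, x)) t := by
    intro t
    have h1 : HasFDerivAt φ (fderiv ℝ φ (t, x)) (t, x) :=
      (h.1.differentiable (by simp) _).hasFDerivAt
    exact h1.comp_hasDerivAt t ((hasDerivAt_id t).prodMk (hasDerivAt_const t x))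
  have hcont : Continuous (fun t => dT φ (t, x)) :=
    ((h.1.continuous_fderiv (by simp)).clm_apply continuous_const).comp
      (continuous_id.prodMk continuous_const)
  rw [intervalIntegral.integral_eq_sub_of_hasDerivAt (fun t _ => hder t)
    (hcont.intervalIntegrable _ _)]
  have : φ (T, x) = 0 := by
    by_contra hne
    exact lt_irrefl T (h.2.2 (subset_tsupport φ hne))
  rw [this, zero_sub]

lemma const_identity {T : ℝ} (hT : 0 < T) {φ : SpaceTime → ℝ} (h : IsTest T φ) (a b c a' : ℝ)
    (ha : a = a') :
    (∫ p in slab T, (a * dT φ p + b * dX1 φ p + c * dX2 φ p))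
      + ∫ x : ℝ × ℝ, a' * φ (0, x) = 0 := by
  subst ha
  have i0 : Integrable (dT φ) (volume.restrict (slab T)) :=
    (integrable_fderiv_test h (1, 0, 0)).restrict
  have i1 : Integrable (dX1 φ) (volume.restrict (slab T)) :=
    (integrable_fderiv_test h (0, 1, 0)).restrict
  have i2 : Integrable (dX2 φ) (volume.restrict (slab T)) :=
    (integrable_fderiv_test h (0, 0, 1)).restrict
  have e1 : ∫ p in slab T, dX1 φ p = 0 := integral_slab_space h (1, 0)
  have e2 : ∫ p in slab T, dX2 φ p = 0 := integral_slab_space h (0, 1)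
  have i01 : Integrable (fun p => a * dT φ p + b * dX1 φ p) (volume.restrict (slab T)) :=
    (i0.const_mul a).add (i1.const_mul b)
  rw [integral_add i01 (i2.const_mul c),
    integral_add (i0.const_mul a) (i1.const_mul b), integral_const_mul, integral_const_mul,
    integral_const_mul, integral_const_mul, e1, e2, integral_slab_time hT h]
  ring

lemma integrable_half_dirac (g : EulerState → ℝ) (x y : EulerState) :
    Integrable g ((1 / 2 : ENNReal) • Measure.dirac x + (1 / 2 : ENNReal) • Measure.dirac y) :=
  ((integrable_dirac (by simp)).smul_measure (by simp)).add_measure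
    ((integrable_dirac (by simp)).smul_measure (by simp))

lemma integral_half_dirac (g : EulerState → ℝ) (x y : EulerState) :
    ∫ ξ, g ξ ∂((1 / 2 : ENNReal) • Measure.dirac x + (1 / 2 : ENNReal) • Measure.dirac y)
      = (g x + g y) / 2 := by
  rw [integral_add_measure ((integrable_dirac (by simp)).smul_measure (by simp))
    ((integrable_dirac (by simp)).smul_measure (by simp)), integral_smul_measure,
    integral_smul_measure, integral_dirac, integral_dirac]
  simp; ring

/-- For `γ > 0`, `γ ≠ 1`, the constant-in-`(t,x)` family of probability
measures `ν_{t,x} = ½ δ_{(1,(1,0),3/2)} + ½ δ_{(γ,(1,0),3/(2γ))}` is a measure-valued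
solution of the full compressible Euler system with the constant initial data
`ρ⁰ = (1+γ)/2`, `m⁰ = (1,0)`, `E⁰ = (3/2 + 3/(2γ))/2`. -/
theorem halfDirac_combination_isMVSolution (T : ℝ) (hT : 0 < T) (γ : ℝ) (hγ : 0 < γ)
    (hγ1 : γ ≠ 1) :
    IsMVSolution T
      (fun _ : SpaceTime =>
        (1 / 2 : ENNReal) • Measure.dirac ((1 : ℝ), ((1 : ℝ), (0 : ℝ)), (3 / 2 : ℝ))
          + (1 / 2 : ENNReal) • Measure.dirac (γ, ((1 : ℝ), (0 : ℝ)), 3 / (2 * γ)))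
      (fun _ => (1 + γ) / 2) (fun _ => (1, 0)) (fun _ => (3 / 2 + 3 / (2 * γ)) / 2) := by
  refine ⟨?_, ?_, ?_, ?_, ?_, ?_, ?_, ?_⟩
  · intro p
    refine ⟨?_⟩
    simp [ENNReal.inv_two_add_inv_two]
  · refine Filter.Eventually.of_forall fun p => ?_
    simp [hγ]
  · intro f
    exact measurable_const
  · intro g _
    refine ⟨Filter.Eventually.of_forall fun p => integrable_half_dirac _ _ _, ?_⟩
    exact locallyIntegrable_const _
  all_goals
    intro φ h
    refine const_identity hT h _ _ _ _ ?_
    rw [integral_half_dirac]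
    try norm_num
end
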